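/- Let n ≥ 1, 0 < λ ≤ Λ, m ∈ (1,2] and s > m. Let F : ℝⁿ × Sⁿ → ℝ (Sⁿ the symmetric n×n real matrices) satisfy: (i) λ·Tr(Y) ≤ F(x,X+Y) − F(x,X) ≤ Λ·Tr(Y) for all x ∈ ℝⁿ, X ∈ Sⁿ and all positive semidefinite Y ∈ Sⁿ; (ii) F(x,0) = 0 for all x; (iii) x ↦ F(x,X) is continuous for every X ∈ Sⁿ; (iv) for every R > 0 there is a modulus of continuity ω_R such that F(x,X) − F(y,Y) ≤ ω_R(|x−y| + ε⁻¹|x−y|²) whenever ε > 0, |x|,|y| < R and X,Y ∈ Sⁿ satisfy the block inequalities −(3/ε)[[I,0],[0,I]] ≤ [[X,0],[0,−Y]] ≤ (3/ε)[[I,−I],[−I,I]] in the positive semidefinite order on 2n×2n symmetric matrices; (v) F(x,σX) = σF(x,X) for all σ ∈ (0,1), x ∈ ℝⁿ, X ∈ Sⁿ. Let H : ℝⁿ × ℝⁿ → ℝ satisfy H(x,0) = 0 for all x, the estimate |H(x,p+q) − H(y,p)| ≤ ω(|x−y|)(|p|^m + 1) + (γ₁ + γ_m(|p|^{m−1} +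 |q|^{m−1}))|q| for all x,y,p,q ∈ ℝⁿ, for some constants γ₁, γ_m > 0 and some modulus of continuity ω, and suppose −H satisfies the concavity-type condition: there exist c̄, A > 0 and σ₀ ∈ (0,1) such that −H(x,p) + σH(x,σ⁻¹p) ≤ (1−σ)(−c̄|p|^m + A) for all x,p ∈ ℝⁿ and σ ∈ (σ₀,1). Let f : ℝⁿ → ℝ be continuous and suppose there exists ρ ≥ 0 with limsup_{|x|→∞} f⁺(x)/|x|^ρ < ∞, where ρ < m(s−1)/((m−1)s) if 1 < m ≤ 2s/(s+1), and ρ < 2(s−m)/(s(m−1)) if 2s/(s+1) < m. Then the equation F(x,D²u) + H(x,Du) − |u|^{s−1}u = f(x) admits exactly one entire continuous viscosity solution u : ℝⁿ → ℝ. -/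

import Mathlib

noncomputable section
open Real

abbrev En (n : ℕ) := EuclideanSpace ℝ (Fin n)

/-- A modulus of continuity. -/
def IsModulus (ω : ℝ → ℝ) : Prop :=
  (∀ t, 0 ≤ t → 0 ≤ ω t) ∧ MonotoneOn ω (Set.Ici 0) ∧ ω 0 = 0 ∧
    ContinuousWithinAt ω (Set.Ici 0) 0

/-- The Hessian matrix of a function. -/
def hessianMatrix {n : ℕ} (φ : En n → ℝ) (x : En n) : Matrix (Fin n) (Fin n) ℝ :=
  fun i j =>
    iteratedFDeriv ℝ 2 φ x ![EuclideanSpace.single i 1, EuclideanSpace.single j 1]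

/-- Viscosity subsolution of `F(x,D²u) + H(x,Du) - |u|^{s-1}u = f(x)` in `ℝⁿ`. -/
def ViscositySubsolution {n : ℕ} (F : En n → Matrix (Fin n) (Fin n) ℝ → ℝ)
    (H : En n → En n → ℝ) (s : ℝ) (f : En n → ℝ) (u : En n → ℝ) : Prop :=
  ∀ φ : En n → ℝ, ContDiff ℝ 2 φ → ∀ x₀ : En n, IsLocalMax (u - φ) x₀ →
    F x₀ (hessianMatrix φ x₀) + H x₀ (gradient φ x₀)
      - |u x₀| ^ (s - 1) * u x₀ ≥ f x₀

def ViscositySupersolution {n : ℕ} (F : En n → Matrix (Fin n) (Fin n) ℝ → ℝ)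
    (H : En n → En n → ℝ) (s : ℝ) (f : En n → ℝ) (u : En n → ℝ) : Prop :=
  ∀ φ : En n → ℝ, ContDiff ℝ 2 φ → ∀ x₀ : En n, IsLocalMin (u - φ) x₀ →
    F x₀ (hessianMatrix φ x₀) + H x₀ (gradient φ x₀)
      - |u x₀| ^ (s - 1) * u x₀ ≤ f x₀

/-- The Pucci maximal operator. -/
def pucci (lam Lam : ℝ) {n : ℕ} (X : Matrix (Fin n) (Fin n) ℝ) : ℝ :=
  sSup ((fun A : Matrix (Fin n) (Fin n) ℝ => (A * X).trace) ''
    {A | A.IsSymm ∧ (A - lam • (1 : Matrix (Fin n) (Fin n) ℝ)).PosSemidef ∧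
      (Lam • (1 : Matrix (Fin n) (Fin n) ℝ) - A).PosSemidef})

section Reg
open Filter Topology

variable {E : Type*} [NormedAddCommGroup E] [InnerProductSpace ℝ E]

theorem exists_max_of_coercive {E : Type*} [NormedAddCommGroup E] [NormedSpace ℝ E] [FiniteDimensional ℝ E] (g : E → ℝ) (hg : UpperSemicontinuous g)
    (B c : ℝ) (hc : 0 < c) (y : E) (hb : ∀ z, g z ≤ B - c * ‖z - y‖ ^ 2) :
    ∃ z₀, ∀ z, g z ≤ g z₀ := by
  have : ProperSpace E := FiniteDimensional.proper_real E
  have hB : g y ≤ B := by have := hb y; simpa using this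
  set r : ℝ := Real.sqrt ((B - g y) / c) with hr
  have hr0 : 0 ≤ r := Real.sqrt_nonneg _
  have hr2 : r ^ 2 = (B - g y) / c := Real.sq_sqrt (div_nonneg (by linarith) hc.le)
  obtain ⟨z₀, hz₀, hmax⟩ := UpperSemicontinuousOn.exists_isMaxOn (s := Metric.closedBall y r)
    ⟨y, Metric.mem_closedBall_self hr0⟩ (isCompact_closedBall y r) (hg.upperSemicontinuousOn _)
  refine ⟨z₀, fun z => ?_⟩
  by_cases hz : z ∈ Metric.closedBall y r
  · exact hmax hz
  · have h1 : r < ‖z - y‖ := by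
      simpa [Metric.mem_closedBall, dist_eq_norm] using hz
    have h2 : g y ≤ g z₀ := hmax (Metric.mem_closedBall_self hr0)
    have h3 : r ^ 2 < ‖z - y‖ ^ 2 := by gcongr
    have h4 := hb z
    rw [hr2, div_lt_iff₀ hc] at h3
    nlinarith

theorem norm_add_sq_div (κ δ : ℝ) (hκ : 0 < κ) (hδ : 0 < δ) (u v : E) :
    ‖u + v‖ ^ 2 / (κ + δ) ≤ ‖u‖ ^ 2 / κ + ‖v‖ ^ 2 / δ := by
  have h : 0 ≤ ‖δ • u - κ • v‖ ^ 2 := by positivity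
  rw [norm_sub_sq_real, norm_smul, norm_smul, real_inner_smul_left, real_inner_smul_right,
    mul_pow, mul_pow] at h
  simp only [Real.norm_eq_abs, sq_abs] at h
  rw [norm_add_sq_real, div_add_div _ _ hκ.ne' hδ.ne', div_le_div_iff₀ (by positivity)
    (by positivity)]
  nlinarith

/-- sup-convolution -/
theorem exists_supConv [FiniteDimensional ℝ E] (a : E → ℝ) (ha : UpperSemicontinuous a)
    (B : ℝ) (hB : ∀ z, a z ≤ B) (t : ℝ) (ht : 0 < t) :
    ∃ S : E → ℝ, (∀ y z, a z - ‖z - y‖ ^ 2 / (2 * t) ≤ S y) ∧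
      (∀ y, ∃ z, S y = a z - ‖z - y‖ ^ 2 / (2 * t)) := by
  have h : ∀ y, ∃ z₀, ∀ z, a z - ‖z - y‖ ^ 2 / (2 * t) ≤ a z₀ - ‖z₀ - y‖ ^ 2 / (2 * t) := by
    intro y
    refine exists_max_of_coercive (fun z => a z - ‖z - y‖ ^ 2 / (2 * t)) ?_ B (1 / (2 * t))
      (by positivity) y ?_
    · have : Continuous fun z : E => -(‖z - y‖ ^ 2 / (2 * t)) := by fun_prop
      simpa [sub_eq_add_neg] using ha.add this.upperSemicontinuous
    · intro z
      have := hB z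
      have e : ‖z - y‖ ^ 2 / (2 * t) = 1 / (2 * t) * ‖z - y‖ ^ 2 := by ring
      linarith
  choose ζ hζ using h
  exact ⟨fun y => a (ζ y) - ‖ζ y - y‖ ^ 2 / (2 * t), fun y z => hζ y z, fun y => ⟨ζ y, rfl⟩⟩

theorem exists_infConv [FiniteDimensional ℝ E] (S : E → ℝ) (hS : LowerSemicontinuous S)
    (B : ℝ) (hB : ∀ z, B ≤ S z) (t : ℝ) (ht : 0 < t) :
    ∃ U : E → ℝ, (∀ x y, U x ≤ S y + ‖x - y‖ ^ 2 / (2 * t)) ∧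
      (∀ x, ∃ y, U x = S y + ‖x - y‖ ^ 2 / (2 * t)) := by
  have hneg : UpperSemicontinuous (fun z => - S z) := by
    intro x c hc
    have := hS x (-c) (by linarith)
    filter_upwards [this] with z hz
    linarith
  obtain ⟨U, h1, h2⟩ := exists_supConv (fun z => - S z) hneg (-B) (fun z => by
    have := hB z; linarith) t ht
  refine ⟨fun x => - U x, fun x y => ?_, fun x => ?_⟩
  · have := h1 x y
    rw [norm_sub_rev] at this
    linarith
  · obtain ⟨y, hy⟩ := h2 x
    refine ⟨y, ?_⟩
    rw [norm_sub_rev] at hy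
    simp only
    linarith

/-- The regularization lemma (Lasry and Lions). -/
theorem exists_reg [FiniteDimensional ℝ E] (a : E → ℝ) (ha : UpperSemicontinuous a)
    (B : ℝ) (hB : ∀ z, |a z| ≤ B) (κ δ : ℝ) (hκ : 0 < κ) (hδ : 0 < δ) :
    ∃ (S U : E → ℝ) (P : E → E),
      (∀ y, ∃ z, S y = a z - ‖z - y‖ ^ 2 / (2 * (κ + δ))) ∧
      (∀ x z, a z - ‖z - x‖ ^ 2 / (2 * κ) ≤ U x) ∧
      (∀ x y, U x ≤ S y + ‖x - y‖ ^ 2 / (2 * δ)) ∧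
      (∀ x, |U x| ≤ B) ∧
      (∀ x h, U (x + h) ≤ U x + inner ℝ (P x) h + ‖h‖ ^ 2 / (2 * δ)) ∧
      (∀ x h, 2 * U x - ‖h‖ ^ 2 / κ ≤ U (x + h) + U (x - h)) ∧
      (∀ x c, c < 1 / δ → (∀ᶠ h in 𝓝 (0 : E), U (x + h) ≤ U x + inner ℝ (P x) h + c / 2 * ‖h‖ ^ 2) →
        U x = a (x + κ • P x) - κ * ‖P x‖ ^ 2 / 2) := by
  have hκδ : 0 < κ + δ := by positivity
  obtain ⟨S, hS1, hS2⟩ := exists_supConv a ha B (fun z => (abs_le.1 (hB z)).2) (κ + δ) hκδ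
  have hSl : LowerSemicontinuous S := by
    intro y c hc
    obtain ⟨z, hz⟩ := hS2 y
    have hcont : Continuous fun y' => a z - ‖z - y'‖ ^ 2 / (2 * (κ + δ)) := by fun_prop
    have := (hcont.tendsto y).eventually (lt_mem_nhds (hz ▸ hc))
    filter_upwards [this] with y' hy'
    exact lt_of_lt_of_le hy' (hS1 y' z)
  have hSB : ∀ y, -B ≤ S y := fun y => by
    have h1 := hS1 y y
    have h2 := (abs_le.1 (hB y)).1
    simp at h1
    linarith
  have hSB' : ∀ y, S y ≤ B := fun y => by
    obtain ⟨z, hz⟩ := hS2 y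
    have h2 := (abs_le.1 (hB z)).2
    have : 0 ≤ ‖z - y‖ ^ 2 / (2 * (κ + δ)) := by positivity
    linarith
  obtain ⟨U, hU1, hU2⟩ := exists_infConv S hSl (-B) hSB δ hδ
  choose Y hY using hU2
  have hUa : ∀ x z, a z - ‖z - x‖ ^ 2 / (2 * κ) ≤ U x := by
    intro x z
    rw [hY x]
    have h1 := hS1 (Y x) z
    have h2 := norm_add_sq_div κ δ hκ hδ (z - x) (x - Y x)
    rw [sub_add_sub_cancel] at h2
    have e1 : ‖z - Y x‖ ^ 2 / (2 * (κ + δ)) = ‖z - Y x‖ ^ 2 / (κ + δ) / 2 := by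
      rw [div_div]; ring
    have e2 : ‖z - x‖ ^ 2 / (2 * κ) = ‖z - x‖ ^ 2 / κ / 2 := by rw [div_div]; ring
    have e3 : ‖x - Y x‖ ^ 2 / (2 * δ) = ‖x - Y x‖ ^ 2 / δ / 2 := by rw [div_div]; ring
    rw [e1] at h1
    rw [e2, e3]
    linarith
  refine ⟨S, U, fun x => (1 / δ) • (x - Y x), hS2, hUa, hU1, ?_, ?_, ?_, ?_⟩
  · intro x
    rw [abs_le]
    constructor
    · rw [hY x]
      have : 0 ≤ ‖x - Y x‖ ^ 2 / (2 * δ) := by positivity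
      linarith [hSB (Y x)]
    · have := hU1 x x
      simp at this
      linarith [hSB' x]
  · intro x h
    have h1 := hU1 (x + h) (Y x)
    rw [hY x, real_inner_smul_left]
    have e : x + h - Y x = (x - Y x) + h := by abel
    rw [e, norm_add_sq_real] at h1
    refine h1.trans (le_of_eq ?_)
    field_simp
    ring
  · intro x h
    set y₁ := Y (x + h)
    set y₂ := Y (x - h)
    set y : E := (1 / 2 : ℝ) • (y₁ + y₂) with hy
    set k : E := (1 / 2 : ℝ) • (y₁ - y₂) with hk
    have hy1 : y₁ = y + k := by rw [hy, hk]; module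
    have hy2 : y₂ = y - k := by rw [hy, hk]; module
    obtain ⟨z, hz⟩ := hS2 y
    have s1 := hS1 y₁ z
    have s2 := hS1 y₂ z
    have u := hU1 x y
    rw [hY (x + h), hY (x - h)]
    change _ ≤ S y₁ + ‖x + h - y₁‖ ^ 2 / (2 * δ) + (S y₂ + ‖x - h - y₂‖ ^ 2 / (2 * δ))
    have n1 : ‖z - y₁‖ ^ 2 + ‖z - y₂‖ ^ 2 = 2 * ‖z - y‖ ^ 2 + 2 * ‖k‖ ^ 2 := by
      have e1 : z - y₁ = (z - y) - k := by rw [hy1]; abel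
      have e2 : z - y₂ = (z - y) + k := by rw [hy2]; abel
      rw [e1, e2, norm_sub_sq_real, norm_add_sq_real]; ring
    have n2 : ‖x + h - y₁‖ ^ 2 + ‖x - h - y₂‖ ^ 2 = 2 * ‖x - y‖ ^ 2 + 2 * ‖k - h‖ ^ 2 := by
      have e1 : x + h - y₁ = (x - y) - (k - h) := by rw [hy1]; abel
      have e2 : x - h - y₂ = (x - y) + (k - h) := by rw [hy2]; abel
      rw [e1, e2, norm_sub_sq_real, norm_add_sq_real]; ring
    have n3 := norm_add_sq_div κ δ hκ hδ h (k - h)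
    rw [add_sub_cancel] at n3
    have n1' : ‖z - y₁‖ ^ 2 / (2 * (κ + δ)) + ‖z - y₂‖ ^ 2 / (2 * (κ + δ))
        = 2 * (‖z - y‖ ^ 2 / (2 * (κ + δ))) + ‖k‖ ^ 2 / (κ + δ) := by
      rw [← add_div, n1]; field_simp
    have n2' : ‖x + h - y₁‖ ^ 2 / (2 * δ) + ‖x - h - y₂‖ ^ 2 / (2 * δ)
        = 2 * (‖x - y‖ ^ 2 / (2 * δ)) + ‖k - h‖ ^ 2 / δ := by
      rw [← add_div, n2]; field_simp
    linarith
  · intro x c hc hev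
    obtain ⟨z, hz⟩ := hS2 (Y x)
    set y := Y x with hyx
    set p : E := (1 / δ) • (x - y) with hp
    set x₁ : E := y + (δ / (κ + δ)) • (z - y) with hx₁
    -- U x₁ = S y + ‖x₁ - y‖² / 2δ
    have hx1eq : U x₁ = S y + ‖x₁ - y‖ ^ 2 / (2 * δ) := by
      apply le_antisymm (hU1 x₁ y)
      refine le_trans (le_of_eq ?_) (hUa x₁ z)
      have e1 : z - x₁ = (κ / (κ + δ)) • (z - y) := by
        rw [hx₁]
        have : (κ / (κ + δ)) • (z - y) = (1 - δ / (κ + δ)) • (z - y) := by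
          congr 1; field_simp; ring
        rw [this]; module
      have e2 : x₁ - y = (δ / (κ + δ)) • (z - y) := by rw [hx₁]; abel
      rw [e1, e2, hz, norm_smul, norm_smul, mul_pow, mul_pow]
      simp only [Real.norm_eq_abs, sq_abs]
      field_simp
      ring
    have hxeq : U x = S y + ‖x - y‖ ^ 2 / (2 * δ) := hY x
    have key : x₁ = x := by
      by_contra hne
      set e : E := x₁ - x with he
      have he0 : 0 < ‖e‖ := norm_pos_iff.2 (sub_ne_zero.2 hne)
      have hseg : ∀ t : ℝ, 0 ≤ t → t ≤ 1 →
          U x + inner ℝ p (t • e) + ‖t • e‖ ^ 2 / (2 * δ) ≤ U (x + t • e) := by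
        intro t ht0 ht1
        set y' := Y (x + t • e)
        have hh : U (x + t • e) = S y' + ‖x + t • e - y'‖ ^ 2 / (2 * δ) := hY _
        have h1 := hU1 x y'
        have h2 := hU1 x₁ y'
        have e1 : x₁ = x + e := by rw [he]; abel
        have e2 : x + t • e - y' = (x - y') + t • e := by abel
        have e3 : x₁ - y' = (x - y') + e := by rw [e1]; abel
        have e4 : x₁ - y = (x - y) + e := by rw [e1]; abel
        rw [hx1eq, e4, e3, norm_add_sq_real, norm_add_sq_real] at h2
        rw [hh, e2, norm_add_sq_real, hp]
        simp only [real_inner_smul_left, real_inner_smul_right, norm_smul, mul_pow,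
          Real.norm_eq_abs, sq_abs]
        have h3 : (1 - t) * U x + t * (S y + (‖x - y‖ ^ 2 + 2 * inner ℝ (x - y) e + ‖e‖ ^ 2) / (2 * δ))
          ≤ (1 - t) * (S y' + ‖x - y'‖ ^ 2 / (2 * δ)) +
            t * (S y' + (‖x - y'‖ ^ 2 + 2 * inner ℝ (x - y') e + ‖e‖ ^ 2) / (2 * δ)) := by
          apply add_le_add
          · exact mul_le_mul_of_nonneg_left h1 (by linarith)
          · exact mul_le_mul_of_nonneg_left h2 ht0
        have l1 : (1 - t) * U x + t * (S y + (‖x - y‖ ^ 2 + 2 * inner ℝ (x - y) e + ‖e‖ ^ 2) / (2 * δ))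
            - t * ‖e‖ ^ 2 / (2 * δ) + t ^ 2 * ‖e‖ ^ 2 / (2 * δ)
            = U x + 1 / δ * (t * inner ℝ (x - y) e) + t ^ 2 * ‖e‖ ^ 2 / (2 * δ) := by
          rw [hxeq]; field_simp; ring
        have l2 : (1 - t) * (S y' + ‖x - y'‖ ^ 2 / (2 * δ)) +
            t * (S y' + (‖x - y'‖ ^ 2 + 2 * inner ℝ (x - y') e + ‖e‖ ^ 2) / (2 * δ))
            - t * ‖e‖ ^ 2 / (2 * δ) + t ^ 2 * ‖e‖ ^ 2 / (2 * δ)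
            = S y' + (‖x - y'‖ ^ 2 + 2 * (t * inner ℝ (x - y') e) + t ^ 2 * ‖e‖ ^ 2) / (2 * δ) := by
          field_simp; ring
        linarith
      have hten : Tendsto (fun t : ℝ => t • e) (𝓝[>] 0) (𝓝 0) := by
        have : Continuous fun t : ℝ => t • e := by fun_prop
        have h := this.tendsto 0
        simp only [zero_smul] at h
        exact h.mono_left nhdsWithin_le_nhds
      have hev2 := hten.eventually hev
      have hev3 : ∀ᶠ t : ℝ in 𝓝[>] 0, 0 < t ∧ t < 1 := Ioo_mem_nhdsGT one_pos
      obtain ⟨t, ht, ht0, ht1⟩ := (hev2.and hev3).exists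
      have h5 := hseg t ht0.le ht1.le
      have h6 : 0 < ‖t • e‖ ^ 2 := by
        have : 0 < ‖t • e‖ := by
          rw [norm_smul, Real.norm_eq_abs]; exact mul_pos (abs_pos.2 ht0.ne') he0
        positivity
      have h7 : ‖t • e‖ ^ 2 / (2 * δ) ≤ c / 2 * ‖t • e‖ ^ 2 := by linarith
      have h8 : ‖t • e‖ ^ 2 / (2 * δ) = (1 / δ) / 2 * ‖t • e‖ ^ 2 := by field_simp
      rw [h8] at h7
      nlinarith
    have hzx : x + κ • p = z := by
      have : x - y = (δ / (κ + δ)) • (z - y) := by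
        rw [← key, hx₁]; abel
      have h2 : κ • p = (κ / (κ + δ)) • (z - y) := by
        rw [hp, this, smul_smul, smul_smul]; congr 1; field_simp
      have h3 : x = y + (δ / (κ + δ)) • (z - y) := by rw [← this]; abel
      rw [h2]
      nth_rewrite 1 [h3]
      have : (κ / (κ + δ)) • (z - y) = (1 - δ / (κ + δ)) • (z - y) := by
        congr 1; field_simp; ring
      rw [this]; module
    change U x = a (x + κ • p) - κ * ‖p‖ ^ 2 / 2
    rw [hzx]
    clear_value p
    have nsq : ∀ c : ℝ, ‖c • p‖ ^ 2 = c ^ 2 * ‖p‖ ^ 2 := by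
      intro c; rw [norm_smul, mul_pow, Real.norm_eq_abs, sq_abs]
    apply le_antisymm
    · rw [hxeq, hz]
      have e1 : z - y = (κ + δ) • p := by
        have : x - y = δ • p := by rw [hp, smul_smul]; field_simp; simp
        rw [← hzx, add_smul, ← this]; abel
      have e2 : x - y = δ • p := by rw [hp, smul_smul]; field_simp; simp
      rw [e1, e2, nsq, nsq]
      apply le_of_eq
      field_simp
      ring
    · refine le_trans (le_of_eq ?_) (hUa x z)
      rw [← hzx, add_sub_cancel_left, nsq]
      field_simp
end Reg

section Jensen
open Filter Topology MeasureTheory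

variable {E : Type*} [NormedAddCommGroup E] [InnerProductSpace ℝ E]

theorem eq_zero_of_inner_le (v : E) (C : ℝ) (h : ∀ k : E, inner ℝ v k ≤ C * ‖k‖ ^ 2) : v = 0 := by
  by_contra hv
  have hv0 : 0 < ‖v‖ := norm_pos_iff.2 hv
  have hC : 0 < |C| + 1 := by positivity
  have h1 := h ((1 / (2 * (|C| + 1))) • v)
  rw [real_inner_smul_right, real_inner_self_eq_norm_sq, norm_smul, mul_pow, Real.norm_eq_abs,
    sq_abs] at h1
  have h2 : C * ((1 / (2 * (|C| + 1))) ^ 2 * ‖v‖ ^ 2) ≤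
      (|C| + 1) * ((1 / (2 * (|C| + 1))) ^ 2 * ‖v‖ ^ 2) := by
    gcongr
    linarith [le_abs_self C]
  have h3 : (|C| + 1) * ((1 / (2 * (|C| + 1))) ^ 2 * ‖v‖ ^ 2) =
      (1 / (2 * (|C| + 1)) * ‖v‖ ^ 2) / 2 := by
    field_simp
  have h4 : 0 < 1 / (2 * (|C| + 1)) * ‖v‖ ^ 2 := by positivity
  linarith

theorem grad_lip (U : E → ℝ) (P : E → E) (C : ℝ) (hC : 0 ≤ C)
    (h : ∀ x k, |U (x + k) - U x - inner ℝ (P x) k| ≤ C * ‖k‖ ^ 2) :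
    LipschitzWith (Real.toNNReal (6 * C)) P := by
  refine LipschitzWith.of_dist_le_mul fun x y => ?_
  rw [dist_eq_norm, dist_eq_norm, Real.coe_toNNReal _ (by positivity)]
  by_cases hP : P x - P y = 0
  · rw [hP]; simp; positivity
  have hP0 : 0 < ‖P x - P y‖ := norm_pos_iff.2 hP
  set k : E := (‖x - y‖ / ‖P x - P y‖) • (P y - P x) with hk
  have hkn : ‖k‖ = ‖x - y‖ := by
    rw [hk, norm_smul, Real.norm_eq_abs, abs_of_nonneg (by positivity), norm_sub_rev (P y)]
    field_simp
  have h1 := (abs_le.1 (h x (y - x + k))).2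
  have h2 := (abs_le.1 (h y k)).1
  have h3 := (abs_le.1 (h x (y - x))).1
  have e1 : x + (y - x + k) = y + k := by abel
  have e2 : x + (y - x) = y := by abel
  rw [e1, inner_add_right] at h1
  rw [e2] at h3
  have h4 : ‖y - x + k‖ ≤ 2 * ‖x - y‖ := by
    refine (norm_add_le _ _).trans ?_
    rw [hkn, norm_sub_rev]; linarith
  have h5 : ‖y - x + k‖ ^ 2 ≤ 4 * ‖x - y‖ ^ 2 := by nlinarith [norm_nonneg (y - x + k)]
  rw [norm_sub_rev y x] at h3
  rw [hkn] at h2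
  have h6 : inner ℝ (P y) k - inner ℝ (P x) k ≤ 6 * C * ‖x - y‖ ^ 2 := by nlinarith
  have h7 : inner ℝ (P y) k - inner ℝ (P x) k = ‖x - y‖ * ‖P x - P y‖ := by
    rw [← inner_sub_left, hk, real_inner_smul_right, real_inner_self_eq_norm_sq,
      norm_sub_rev (P y)]
    field_simp
  by_cases hxy : ‖x - y‖ = 0
  · have : x = y := sub_eq_zero.1 (norm_eq_zero.1 hxy)
    exact absurd (by rw [this]; simp) hP
  · have h0 : 0 < ‖x - y‖ := lt_of_le_of_ne (norm_nonneg _) (Ne.symm hxy)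
    rw [h7] at h6
    have : ‖x - y‖ * ‖P x - P y‖ ≤ ‖x - y‖ * (6 * C * ‖x - y‖) := by linarith
    exact le_of_mul_le_mul_left this h0

theorem second_order (U : E → ℝ) (P : E → E) (x : E) (A : E →L[ℝ] E)
    (hU : ∀ᶠ y in 𝓝 x, HasFDerivAt U (innerSL ℝ (P y)) y)
    (hA : HasFDerivAt P A x) (η : ℝ) (hη : 0 < η) :
    ∀ᶠ h in 𝓝 (0 : E), |U (x + h) - U x - inner ℝ (P x) h - inner ℝ (A h) h / 2| ≤ η * ‖h‖ ^ 2 := by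
  have h1 : ∀ᶠ y in 𝓝 x, ‖P y - P x - A (y - x)‖ ≤ η * ‖y - x‖ := hA.isLittleO.def hη
  obtain ⟨r, hr, hball⟩ := Metric.eventually_nhds_iff_ball.1 (hU.and h1)
  have : ∀ᶠ h in 𝓝 (0 : E), h ∈ Metric.ball (0 : E) r := Metric.ball_mem_nhds _ hr
  filter_upwards [this] with h hh
  have hh' : ‖h‖ < r := by simpa using hh
  have hmem : ∀ t ∈ Set.Icc (0 : ℝ) 1, x + t • h ∈ Metric.ball x r := by
    intro t ht
    simp only [Metric.mem_ball, dist_eq_norm, add_sub_cancel_left, norm_smul, Real.norm_eq_abs,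
      abs_of_nonneg ht.1]
    nlinarith [ht.2, norm_nonneg h]
  set ψ : ℝ → ℝ := fun t => U (x + t • h) - t * inner ℝ (P x) h - t ^ 2 / 2 * inner ℝ (A h) h
  have hder : ∀ t ∈ Set.Icc (0 : ℝ) 1, HasDerivWithinAt ψ
      (inner ℝ (P (x + t • h)) h - inner ℝ (P x) h - t * inner ℝ (A h) h) (Set.Icc 0 1) t := by
    intro t ht
    have d1 := (hball _ (hmem t ht)).1
    have d2 : HasDerivAt (fun t : ℝ => x + t • h) h t := by
      simpa using ((hasDerivAt_id t).smul_const h).const_add x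
    have d3 : HasDerivAt (fun t : ℝ => U (x + t • h)) (inner ℝ (P (x + t • h)) h) t := by
      exact d1.comp_hasDerivAt t d2
    have d4 : HasDerivAt (fun t : ℝ => t * inner ℝ (P x) h) (inner ℝ (P x) h) t := by
      simpa using (hasDerivAt_id t).mul_const (inner ℝ (P x) h)
    have d5 : HasDerivAt (fun t : ℝ => t ^ 2 / 2 * inner ℝ (A h) h) (t * inner ℝ (A h) h) t := by
      have := (((hasDerivAt_id' t).pow 2).div_const 2).mul_const (inner ℝ (A h) h)
      refine this.congr_deriv ?_
      simp
    exact ((d3.sub d4).sub d5).hasDerivWithinAt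
  have hbound : ∀ t ∈ Set.Icc (0 : ℝ) 1,
      ‖inner ℝ (P (x + t • h)) h - inner ℝ (P x) h - t * inner ℝ (A h) h‖ ≤ η * ‖h‖ ^ 2 := by
    intro t ht
    have d1 := (hball _ (hmem t ht)).2
    rw [add_sub_cancel_left] at d1
    have e : inner ℝ (P (x + t • h)) h - inner ℝ (P x) h - t * inner ℝ (A h) h =
        inner ℝ (P (x + t • h) - P x - A (t • h)) h := by
      rw [inner_sub_left, inner_sub_left, map_smul, real_inner_smul_left]
    rw [e]
    refine (norm_inner_le_norm _ _).trans ?_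
    have : ‖t • h‖ ≤ ‖h‖ := by
      rw [norm_smul, Real.norm_eq_abs, abs_of_nonneg ht.1]
      nlinarith [ht.2, norm_nonneg h]
    calc ‖P (x + t • h) - P x - A (t • h)‖ * ‖h‖ ≤ (η * ‖t • h‖) * ‖h‖ := by gcongr
      _ ≤ (η * ‖h‖) * ‖h‖ := by gcongr
      _ = η * ‖h‖ ^ 2 := by ring
  have := (convex_Icc (0 : ℝ) 1).norm_image_sub_le_of_norm_hasDerivWithin_le hder hbound
    (Set.left_mem_Icc.2 zero_le_one) (Set.right_mem_Icc.2 zero_le_one)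
  simp only [ψ, one_smul, zero_smul, add_zero, sub_zero, norm_one, mul_one, Real.norm_eq_abs] at this
  refine le_trans (le_of_eq ?_) this
  congr 1
  ring

theorem exists_small_notMem_image {V : Type*} [NormedAddCommGroup V] [NormedSpace ℝ V]
    [FiniteDimensional ℝ V] [MeasurableSpace V] [BorelSpace V] (μ : Measure V)
    [μ.IsAddHaarMeasure] (G : V → V) (K : NNReal) (hG : LipschitzWith K G) (N : Set V) (hN : μ N = 0)
    (r : ℝ) (hr : 0 < r) : ∃ l : V, ‖l‖ < r ∧ l ∉ G '' N := by
  by_contra hcon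
  push Not at hcon
  have hsub : Metric.ball (0 : V) r ⊆ G '' N := fun l hl => hcon l (by simpa using hl)
  have hN' : μH[Module.finrank ℝ V] N = 0 :=
    (Measure.absolutelyContinuous_isAddHaarMeasure _ μ) hN
  have h1 := hG.hausdorffMeasure_image_le (d := Module.finrank ℝ V) (by positivity) N
  rw [hN', mul_zero] at h1
  have h2 : μH[Module.finrank ℝ V] (Metric.ball (0 : V) r) = 0 :=
    le_antisymm ((measure_mono hsub).trans h1) bot_le
  have h3 : 0 < (μH[Module.finrank ℝ V] : Measure V) (Metric.ball (0 : V) r) :=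
    Metric.measure_ball_pos _ _ hr
  exact h3.ne' h2

end Jensen

section Sums
open Filter Topology MeasureTheory

variable {E : Type*} [NormedAddCommGroup E] [InnerProductSpace ℝ E]

theorem nsq_smul (c : ℝ) (v : E) : ‖c • v‖ ^ 2 = c ^ 2 * ‖v‖ ^ 2 := by
  rw [norm_smul, mul_pow, Real.norm_eq_abs, sq_abs]

theorem sums_upper (a₁ a₂ S₁ S₂ U₁ U₂ : E → ℝ) (ε M : ℝ) (hε : 0 < ε)
    (hM : ∀ z w, a₁ z + a₂ w ≤ M + ‖z - w‖ ^ 2 / (2 * ε))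
    (hS₁ : ∀ y, ∃ z, S₁ y = a₁ z - ‖z - y‖ ^ 2 / (2 * (ε / 3 + ε / 12)))
    (hS₂ : ∀ y, ∃ z, S₂ y = a₂ z - ‖z - y‖ ^ 2 / (2 * (ε / 3 + ε / 12)))
    (hU₁ : ∀ x y, U₁ x ≤ S₁ y + ‖x - y‖ ^ 2 / (2 * (ε / 12)))
    (hU₂ : ∀ x y, U₂ x ≤ S₂ y + ‖x - y‖ ^ 2 / (2 * (ε / 12))) (x y : E) :
    U₁ x + U₂ y ≤ M + 3 / (2 * ε) * ‖x - y‖ ^ 2 := by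
  set d := x - y with hd
  set y₁ := x - (1 / 4 : ℝ) • d with hy₁
  set y₂ := y + (1 / 4 : ℝ) • d with hy₂
  obtain ⟨z, hz⟩ := hS₁ y₁
  obtain ⟨w, hw⟩ := hS₂ y₂
  have u1 := hU₁ x y₁
  have u2 := hU₂ y y₂
  have e1 : x - y₁ = (1 / 4 : ℝ) • d := by rw [hy₁]; abel
  have e2 : y - y₂ = (-(1 / 4) : ℝ) • d := by rw [hy₂]; module
  have e3 : y₁ - y₂ = (1 / 2 : ℝ) • d := by rw [hy₁, hy₂, hd]; module
  rw [e1, nsq_smul] at u1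
  rw [e2, nsq_smul] at u2
  have m := hM z w
  have k1 := norm_add_sq_div (5 * ε / 6) (ε / 6) (by positivity) (by positivity)
    ((z - y₁) - (w - y₂)) (y₁ - y₂)
  have e4 : (z - y₁) - (w - y₂) + (y₁ - y₂) = z - w := by abel
  rw [e4, e3, nsq_smul] at k1
  have k2 : ‖(z - y₁) - (w - y₂)‖ ^ 2 ≤ 2 * (‖z - y₁‖ ^ 2 + ‖w - y₂‖ ^ 2) := by
    have := parallelogram_law_with_norm ℝ (z - y₁) (w - y₂)
    nlinarith [sq_nonneg ‖z - y₁ + (w - y₂)‖]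
  have k3 : ‖(z - y₁) - (w - y₂)‖ ^ 2 / (5 * ε / 6) ≤
      2 * (‖z - y₁‖ ^ 2 + ‖w - y₂‖ ^ 2) / (5 * ε / 6) := by gcongr
  have e5 : 5 * ε / 6 + ε / 6 = ε := by ring
  rw [e5] at k1
  have k4 : ‖z - w‖ ^ 2 / (2 * ε) = ‖z - w‖ ^ 2 / ε / 2 := by field_simp
  have k5 : 2 * (‖z - y₁‖ ^ 2 + ‖w - y₂‖ ^ 2) / (5 * ε / 6) / 2 =
    ‖z - y₁‖ ^ 2 / (2 * (ε / 3 + ε / 12)) + ‖w - y₂‖ ^ 2 / (2 * (ε / 3 + ε / 12)) := by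
    field_simp; ring
  have k6 : 3 / (2 * ε) * ‖d‖ ^ 2 = (1 / 2) ^ 2 * ‖d‖ ^ 2 / (ε / 6) / 2 +
    (1 / 4) ^ 2 * ‖d‖ ^ 2 / (2 * (ε / 12)) + (-(1 / 4)) ^ 2 * ‖d‖ ^ 2 / (2 * (ε / 12)) := by
    field_simp; ring
  linarith

theorem sums_lower (a₁ a₂ U₁ U₂ : E → ℝ) (ε : ℝ) (hε : 0 < ε)
    (hU₁ : ∀ x z, a₁ z - ‖z - x‖ ^ 2 / (2 * (ε / 3)) ≤ U₁ x)
    (hU₂ : ∀ x z, a₂ z - ‖z - x‖ ^ 2 / (2 * (ε / 3)) ≤ U₂ x) (z w : E) :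
    ∃ x y, a₁ z + a₂ w - ‖z - w‖ ^ 2 / (2 * ε) ≤ U₁ x + U₂ y - 3 / (2 * ε) * ‖x - y‖ ^ 2 := by
  set d := z - w with hd
  refine ⟨z - (1 / 3 : ℝ) • d, w + (1 / 3 : ℝ) • d, ?_⟩
  have u1 := hU₁ (z - (1 / 3 : ℝ) • d) z
  have u2 := hU₂ (w + (1 / 3 : ℝ) • d) w
  have e1 : z - (z - (1 / 3 : ℝ) • d) = (1 / 3 : ℝ) • d := by abel
  have e2 : w - (w + (1 / 3 : ℝ) • d) = (-(1 / 3) : ℝ) • d := by module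
  have e3 : z - (1 / 3 : ℝ) • d - (w + (1 / 3 : ℝ) • d) = (1 / 3 : ℝ) • d := by rw [hd]; module
  rw [e1, nsq_smul] at u1
  rw [e2, nsq_smul] at u2
  rw [e3, nsq_smul]
  have : ‖d‖ ^ 2 / (2 * ε) = (1 / 3) ^ 2 * ‖d‖ ^ 2 / (2 * (ε / 3)) +
    (-(1 / 3)) ^ 2 * ‖d‖ ^ 2 / (2 * (ε / 3)) + 3 / (2 * ε) * ((1 / 3) ^ 2 * ‖d‖ ^ 2) := by
    field_simp; ring
  linarith

/-- exact value computation at the shifted points -/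
theorem sums_shift (ε u₁ u₂ : ℝ) (hε : 0 < ε) (x y p₁ p₂ : E) :
    u₁ + u₂ - 3 / (2 * ε) * ‖x - y‖ ^ 2 ≤
      (u₁ + ε / 3 * ‖p₁‖ ^ 2 / 2) + (u₂ + ε / 3 * ‖p₂‖ ^ 2 / 2) -
      ‖(x + (ε / 3) • p₁) - (y + (ε / 3) • p₂)‖ ^ 2 / (2 * ε) := by
  set d := x - y with hd
  set e₁ := p₁ - (3 / ε) • d with he₁
  set e₂ := p₂ + (3 / ε) • d with he₂
  have hp₁ : p₁ = (3 / ε) • d + e₁ := by rw [he₁]; abel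
  have hp₂ : p₂ = e₂ - (3 / ε) • d := by rw [he₂]; abel
  have hz : (x + (ε / 3) • p₁) - (y + (ε / 3) • p₂) = (3 : ℝ) • d + (ε / 3) • (e₁ - e₂) := by
    have h1 : (ε / 3) • ((3 / ε) • d) = d := by
      rw [smul_smul, show ε / 3 * (3 / ε) = 1 by field_simp, one_smul]
    have h2 : (ε / 3) • p₁ = d + (ε / 3) • e₁ := by rw [he₁, smul_sub _ p₁, h1]; abel
    have h3 : (ε / 3) • p₂ = (ε / 3) • e₂ - d := by rw [he₂, smul_add _ p₂, h1]; abel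
    rw [h2, h3, hd]; module
  clear_value e₁ e₂ d
  rw [hz, hp₁, hp₂, norm_add_sq_real, norm_add_sq_real, norm_sub_sq_real, nsq_smul, nsq_smul,
    nsq_smul, norm_sub_sq_real]
  simp only [real_inner_smul_left, real_inner_smul_right, inner_sub_right]
  rw [real_inner_comm d e₂]
  have h : 0 ≤ ‖e₁ + e₂‖ ^ 2 := by positivity
  rw [norm_add_sq_real] at h
  have h2 := sq_nonneg ‖e₁‖
  have h3 := sq_nonneg ‖e₂‖
  have key : (u₁ + ε / 3 * ((3 / ε) ^ 2 * ‖d‖ ^ 2 + 2 * (3 / ε * inner ℝ d e₁) + ‖e₁‖ ^ 2) / 2 +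
        (u₂ + ε / 3 * (‖e₂‖ ^ 2 - 2 * (3 / ε * inner ℝ d e₂) + (3 / ε) ^ 2 * ‖d‖ ^ 2) / 2) -
      (3 ^ 2 * ‖d‖ ^ 2 + 2 * (3 * (ε / 3 * (inner ℝ d e₁ - inner ℝ d e₂))) +
          (ε / 3) ^ 2 * (‖e₁‖ ^ 2 - 2 * inner ℝ e₁ e₂ + ‖e₂‖ ^ 2)) / (2 * ε)) -
      (u₁ + u₂ - 3 / (2 * ε) * ‖d‖ ^ 2) =
      ε / 18 * ((‖e₁‖ ^ 2 + 2 * inner ℝ e₁ e₂ + ‖e₂‖ ^ 2) + ‖e₁‖ ^ 2 + ‖e₂‖ ^ 2) := by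
    field_simp; ring
  have : 0 ≤ ε / 18 * ((‖e₁‖ ^ 2 + 2 * inner ℝ e₁ e₂ + ‖e₂‖ ^ 2) + ‖e₁‖ ^ 2 + ‖e₂‖ ^ 2) := by
    apply mul_nonneg (by positivity); linarith
  have e : ∀ a b c : ℝ, b - c = a → 0 ≤ a → c ≤ b := fun a b c h1 h2 => by linarith
  refine e _ _ _ ?_ this
  rw [← key]; ring

end Sums

section Sums2
open Filter Topology MeasureTheory

variable {E : Type*} [NormedAddCommGroup E] [InnerProductSpace ℝ E]

theorem continuous_of_quad (U : E → ℝ) (P : E → E) (C : ℝ)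
    (h : ∀ x k, |U (x + k) - U x - inner ℝ (P x) k| ≤ C * ‖k‖ ^ 2) (x : E) :
    HasFDerivAt U (innerSL ℝ (P x)) x := by
  rw [hasFDerivAt_iff_isLittleO_nhds_zero]
  have : (fun k : E => U (x + k) - U x - (innerSL ℝ (P x)) k) =O[𝓝 0] fun k => ‖k‖ ^ 2 := by
    refine Asymptotics.IsBigO.of_bound C (Eventually.of_forall fun k => ?_)
    have := h x k
    simpa using this
  refine this.trans_isLittleO ?_
  exact Asymptotics.isLittleO_norm_pow_id one_lt_two

theorem jensen_point [FiniteDimensional ℝ E] [MeasurableSpace E] [BorelSpace E]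
    (U₁ U₂ : E → ℝ) (P₁ P₂ : E → E) (C B θ η : ℝ) (hC : 0 ≤ C) (hη : 0 < η) (hθ : 0 ≤ θ)
    (h₁ : ∀ x k, |U₁ (x + k) - U₁ x - inner ℝ (P₁ x) k| ≤ C * ‖k‖ ^ 2)
    (h₂ : ∀ x k, |U₂ (x + k) - U₂ x - inner ℝ (P₂ x) k| ≤ C * ‖k‖ ^ 2)
    (hB₁ : ∀ x, |U₁ x| ≤ B) (hB₂ : ∀ x, |U₂ x| ≤ B) :
    ∃ (x y l₁ l₂ : E) (A₁ A₂ : E →L[ℝ] E), HasFDerivAt P₁ A₁ x ∧ HasFDerivAt P₂ A₂ y ∧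
      ‖l₁‖ < η ∧ ‖l₂‖ < η ∧ P₁ x = θ • (x - y) + η • x + l₁ ∧ P₂ y = η • y + l₂ - θ • (x - y) ∧
      (∀ h k, U₁ (x + h) + U₂ (y + k) ≤ U₁ x + U₂ y + inner ℝ (P₁ x) h + inner ℝ (P₂ y) k +
        θ / 2 * ‖h - k‖ ^ 2 + η / 2 * (‖h‖ ^ 2 + ‖k‖ ^ 2)) ∧
      (∀ x' y', U₁ x' + U₂ y' - θ / 2 * ‖x' - y'‖ ^ 2 - η / 2 * (‖x'‖ ^ 2 + ‖y'‖ ^ 2)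
          - inner ℝ l₁ x' - inner ℝ l₂ y' ≤
        U₁ x + U₂ y - θ / 2 * ‖x - y‖ ^ 2 - η / 2 * (‖x‖ ^ 2 + ‖y‖ ^ 2)
          - inner ℝ l₁ x - inner ℝ l₂ y) := by
  have hL₁ := grad_lip U₁ P₁ C hC h₁
  have hL₂ := grad_lip U₂ P₂ C hC h₂
  have hd₁ := continuous_of_quad U₁ P₁ C h₁
  have hd₂ := continuous_of_quad U₂ P₂ C h₂
  have hc₁ : Continuous U₁ := continuous_iff_continuousAt.2 fun x => (hd₁ x).continuousAt
  have hc₂ : Continuous U₂ := continuous_iff_continuousAt.2 fun x => (hd₂ x).continuousAt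
  let b := stdOrthonormalBasis ℝ E
  let μ : Measure E := b.toBasis.addHaar
  haveI : ProperSpace E := FiniteDimensional.proper_real E
  set N : Set (E × E) := {z | ¬ (DifferentiableAt ℝ P₁ z.1 ∧ DifferentiableAt ℝ P₂ z.2)} with hN
  have hN0 : (μ.prod μ) N = 0 := by
    have e1 : ∀ᵐ z ∂(μ.prod μ), DifferentiableAt ℝ P₁ z.1 :=
      Measure.quasiMeasurePreserving_fst.ae hL₁.ae_differentiableAt
    have e2 : ∀ᵐ z ∂(μ.prod μ), DifferentiableAt ℝ P₂ z.2 :=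
      Measure.quasiMeasurePreserving_snd.ae hL₂.ae_differentiableAt
    exact ae_iff.1 (e1.and e2)
  let G : E × E → E × E := fun z =>
    (P₁ z.1 - (θ • (z.1 - z.2) + η • z.1), P₂ z.2 - (η • z.2 - θ • (z.1 - z.2)))
  have hfst := (LipschitzWith.prod_fst (α := E) (β := E))
  have hsnd := (LipschitzWith.prod_snd (α := E) (β := E))
  have hsm : ∀ (c : ℝ) (g : E × E → E) (K : NNReal), LipschitzWith K g →
      LipschitzWith (‖c‖₊ * K) (fun z => c • g z) := fun c g K hg =>
    (lipschitzWith_smul c).comp hg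
  have hsub := hfst.sub hsnd
  have hG := ((hL₁.comp hfst).sub ((hsm θ _ _ hsub).add (hsm η _ _ hfst))).prodMk
    ((hL₂.comp hsnd).sub ((hsm η _ _ hsnd).sub (hsm θ _ _ hsub)))
  obtain ⟨l, hl, hlN⟩ := exists_small_notMem_image (μ.prod μ) G _ hG N hN0 η hη
  obtain ⟨l₁, l₂⟩ := l
  have hl₁ : ‖l₁‖ < η := lt_of_le_of_lt (norm_fst_le (l₁, l₂)) hl
  have hl₂ : ‖l₂‖ < η := lt_of_le_of_lt (norm_snd_le (l₁, l₂)) hl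
  let W : E × E → ℝ := fun z => U₁ z.1 + U₂ z.2 - θ / 2 * ‖z.1 - z.2‖ ^ 2
    - η / 2 * (‖z.1‖ ^ 2 + ‖z.2‖ ^ 2) - inner ℝ l₁ z.1 - inner ℝ l₂ z.2
  have hW : Continuous W := by fun_prop
  have hin : ∀ a c : E, ‖a‖ < η → - inner ℝ a c ≤ η + η / 4 * ‖c‖ ^ 2 := by
    intro a c ha
    have := abs_real_inner_le_norm a c
    have h3 := neg_abs_le (inner ℝ a c)
    have h4 : ‖a‖ * ‖c‖ ≤ η * ‖c‖ := by gcongr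
    nlinarith [sq_nonneg (‖c‖ - 2)]
  have hb : ∀ z : E × E, W z ≤ (2 * B + 2 * η) - η / 4 * ‖z - 0‖ ^ 2 := by
    intro z
    have a1 := (abs_le.1 (hB₁ z.1)).2
    have a2 := (abs_le.1 (hB₂ z.2)).2
    have a3 := hin l₁ z.1 hl₁
    have a4 := hin l₂ z.2 hl₂
    have a5 : ‖z - 0‖ ^ 2 ≤ ‖z.1‖ ^ 2 + ‖z.2‖ ^ 2 := by
      rw [sub_zero, Prod.norm_def]
      rcases max_choice ‖z.1‖ ‖z.2‖ with h | h <;> rw [h] <;> nlinarith [sq_nonneg ‖z.1‖, sq_nonneg ‖z.2‖]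
    have a6 : 0 ≤ θ / 2 * ‖z.1 - z.2‖ ^ 2 := by positivity
    have a7 : η / 4 * ‖z - 0‖ ^ 2 ≤ η / 4 * (‖z.1‖ ^ 2 + ‖z.2‖ ^ 2) := by gcongr
    simp only [W]
    linarith
  obtain ⟨⟨x, y⟩, hmax⟩ := exists_max_of_coercive W hW.upperSemicontinuous _ _
    (by positivity : 0 < η / 4) 0 hb
  have hmax' : ∀ x' y', W (x', y') ≤ W (x, y) := fun x' y' => hmax (x', y')
  simp only [W] at hmax'
  set p₁ := θ • (x - y) + η • x + l₁ with hp₁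
  set p₂ := η • y + l₂ - θ • (x - y) with hp₂
  have key : ∀ h k, U₁ (x + h) + U₂ (y + k) ≤ U₁ x + U₂ y + inner ℝ p₁ h + inner ℝ p₂ k +
        θ / 2 * ‖h - k‖ ^ 2 + η / 2 * (‖h‖ ^ 2 + ‖k‖ ^ 2) := by
    intro h k
    have := hmax' (x + h) (y + k)
    have e : x + h - (y + k) = (x - y) + (h - k) := by abel
    rw [e, norm_add_sq_real (x - y), norm_add_sq_real x, norm_add_sq_real y, inner_add_right,
      inner_add_right] at this
    rw [hp₁, hp₂]
    have i1 : inner ℝ (θ • (x - y) + η • x + l₁) h =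
      θ * inner ℝ (x - y) h + η * inner ℝ x h + inner ℝ l₁ h := by
      rw [inner_add_left, inner_add_left, real_inner_smul_left, real_inner_smul_left]
    have i2 : inner ℝ (η • y + l₂ - θ • (x - y)) k =
      η * inner ℝ y k + inner ℝ l₂ k - θ * inner ℝ (x - y) k := by
      rw [inner_sub_left, inner_add_left, real_inner_smul_left, real_inner_smul_left]
    rw [i1, i2]
    rw [inner_sub_right (x - y) h k] at this
    linarith
  have hP₁ : P₁ x = p₁ := by
    rw [← sub_eq_zero]
    refine eq_zero_of_inner_le _ (C + θ / 2 + η / 2) fun k => ?_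
    have a := key k 0
    have b := (abs_le.1 (h₁ x k)).1
    simp only [add_zero, inner_zero_right, sub_zero, norm_zero] at a
    rw [inner_sub_left]
    nlinarith
  have hP₂ : P₂ y = p₂ := by
    rw [← sub_eq_zero]
    refine eq_zero_of_inner_le _ (C + θ / 2 + η / 2) fun k => ?_
    have a := key 0 k
    have b := (abs_le.1 (h₂ y k)).1
    simp only [add_zero, inner_zero_right, zero_sub, norm_neg, norm_zero] at a
    rw [inner_sub_left]
    nlinarith
  have hnN : (x, y) ∉ N := by
    intro hmem
    apply hlN
    refine ⟨(x, y), hmem, ?_⟩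
    simp only [G, hP₁, hP₂, hp₁, hp₂]
    ext <;> simp
  have hnN' : DifferentiableAt ℝ P₁ x ∧ DifferentiableAt ℝ P₂ y := by
    by_contra hcon; exact hnN hcon
  refine ⟨x, y, l₁, l₂, _, _, hnN'.1.hasFDerivAt, hnN'.2.hasFDerivAt, hl₁, hl₂, hP₁, hP₂, ?_, ?_⟩
  · rw [hP₁, hP₂]; exact key
  · exact hmax'

end Sums2

section Sums3
open Filter Topology MeasureTheory

variable {E : Type*} [NormedAddCommGroup E] [InnerProductSpace ℝ E]

theorem eventually_scale {p : E → Prop} (hp : ∀ᶠ h in 𝓝 (0 : E), p h) (h : E) :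
    ∀ᶠ t in 𝓝[>] (0 : ℝ), p (t • h) := by
  have : Tendsto (fun t : ℝ => t • h) (𝓝[>] 0) (𝓝 0) := by
    have h1 : Tendsto (fun t : ℝ => t • h) (𝓝 0) (𝓝 ((0 : ℝ) • h)) :=
      (continuous_id.smul continuous_const).tendsto _
    rw [zero_smul] at h1
    exact h1.mono_left nhdsWithin_le_nhds
  exact this.eventually hp

theorem quad_scale (A : E →L[ℝ] E) (t : ℝ) (h : E) :
    inner ℝ (A (t • h)) (t • h) = t ^ 2 * inner ℝ (A h) h := by
  rw [map_smul, real_inner_smul_left, real_inner_smul_right]; ring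

theorem frac_bound (r T a : ℝ) (hr : 0 ≤ r) (hT : 0 ≤ T) (ha : 0 ≤ a) :
    r / (2 * (a + 1)) * (T * a) ≤ T * (r / 2) := by
  rw [div_mul_eq_mul_div, div_le_iff₀ (by positivity)]
  have : 0 ≤ r * T := by positivity
  nlinarith

set_option maxHeartbeats 1000000 in
theorem approx_sums [FiniteDimensional ℝ E] [MeasurableSpace E] [BorelSpace E]
    (a₁ a₂ : E → ℝ) (ha₁ : UpperSemicontinuous a₁) (ha₂ : UpperSemicontinuous a₂)
    (B : ℝ) (hB₁ : ∀ z, |a₁ z| ≤ B) (hB₂ : ∀ z, |a₂ z| ≤ B) (ε η M : ℝ) (hε : 0 < ε) (hη : 0 < η)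
    (hM : ∀ z w, a₁ z + a₂ w ≤ M + ‖z - w‖ ^ 2 / (2 * ε)) (z₀ w₀ : E)
    (h₀ : M - η ≤ a₁ z₀ + a₂ w₀ - ‖z₀ - w₀‖ ^ 2 / (2 * ε)) :
    ∃ (z w p₁ p₂ : E) (A₁ A₂ : E →L[ℝ] E),
      M - 2 * η ≤ a₁ z + a₂ w - ‖z - w‖ ^ 2 / (2 * ε) ∧ ‖p₁ + p₂‖ ≤ η ∧
      (∀ η' > 0, ∀ᶠ h in 𝓝 (0 : E), a₁ (z + h) ≤ a₁ z + inner ℝ p₁ h + inner ℝ (A₁ h) h / 2 + η' * ‖h‖ ^ 2) ∧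
      (∀ η' > 0, ∀ᶠ h in 𝓝 (0 : E), a₂ (w + h) ≤ a₂ w + inner ℝ p₂ h + inner ℝ (A₂ h) h / 2 + η' * ‖h‖ ^ 2) ∧
      (∀ h, -(3 / ε) * ‖h‖ ^ 2 ≤ inner ℝ (A₁ h) h) ∧
      (∀ h, -(3 / ε) * ‖h‖ ^ 2 ≤ inner ℝ (A₂ h) h) ∧
      (∀ h k, inner ℝ (A₁ h) h + inner ℝ (A₂ k) k ≤ 3 / ε * ‖h - k‖ ^ 2 + η * (‖h‖ ^ 2 + ‖k‖ ^ 2)) := by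
  obtain ⟨S₁, U₁, P₁, b1, b2, b3, b4, b5, b6, b7⟩ :=
    exists_reg a₁ ha₁ B hB₁ (ε / 3) (ε / 12) (by positivity) (by positivity)
  obtain ⟨S₂, U₂, P₂, c1, c2, c3, c4, c5, c6, c7⟩ :=
    exists_reg a₂ ha₂ B hB₂ (ε / 3) (ε / 12) (by positivity) (by positivity)
  have hup := sums_upper a₁ a₂ S₁ S₂ U₁ U₂ ε M hε hM b1 c1 b3 c3
  obtain ⟨x₀, y₀, hlow⟩ := sums_lower a₁ a₂ U₁ U₂ ε hε b2 c2 z₀ w₀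
  have two : ∀ (U : E → ℝ) (P : E → E), (∀ x h, U (x + h) ≤ U x + inner ℝ (P x) h + ‖h‖ ^ 2 / (2 * (ε / 12))) →
      (∀ x h, 2 * U x - ‖h‖ ^ 2 / (ε / 3) ≤ U (x + h) + U (x - h)) →
      ∀ x k, |U (x + k) - U x - inner ℝ (P x) k| ≤ 9 / ε * ‖k‖ ^ 2 := by
    intro U P h1 h2 x k
    have i1 := h1 x k
    have i2 := h1 x (-k)
    have i3 := h2 x k
    rw [← sub_eq_add_neg, inner_neg_right, norm_neg] at i2
    have e1 : ‖k‖ ^ 2 / (2 * (ε / 12)) = 6 / ε * ‖k‖ ^ 2 := by field_simp; ring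
    have e2 : ‖k‖ ^ 2 / (ε / 3) = 3 / ε * ‖k‖ ^ 2 := by field_simp
    have e3 : 0 ≤ 3 / ε * ‖k‖ ^ 2 := by positivity
    have e4 : 9 / ε * ‖k‖ ^ 2 = 6 / ε * ‖k‖ ^ 2 + 3 / ε * ‖k‖ ^ 2 := by ring
    rw [e1] at i1 i2
    rw [e2] at i3
    rw [abs_le]
    constructor <;> linarith
  have t1 := two U₁ P₁ b5 b6
  have t2 := two U₂ P₂ c5 c6
  set C₀ : ℝ := ‖x₀‖ ^ 2 / 2 + ‖y₀‖ ^ 2 / 2 + ‖x₀‖ + ‖y₀‖ + 2 with hC₀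
  have hC₀pos : 0 < C₀ := by positivity
  obtain ⟨τ, hτ, hτ1, hτ2, hτ3⟩ : ∃ τ : ℝ, 0 < τ ∧ τ * C₀ ≤ η ∧ τ ≤ η / 128 ∧ τ ≤ 1 / ε := by
    refine ⟨min (min (η / C₀) (η / 128)) (1 / ε), by positivity, ?_, ?_, min_le_right _ _⟩
    · rw [← le_div_iff₀ hC₀pos]; exact (min_le_left _ _).trans (min_le_left _ _)
    · exact (min_le_left _ _).trans (min_le_right _ _)
  obtain ⟨x, y, l₁, l₂, A₁, A₂, hA₁, hA₂, hl₁, hl₂, hP₁, hP₂, key, hmax⟩ :=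
    jensen_point U₁ U₂ P₁ P₂ (9 / ε) B (3 / ε) τ (by positivity) hτ (by positivity) t1 t2 b4 c4
  have hin : ∀ a c : E, ‖a‖ < τ → - inner ℝ a c ≤ τ + τ / 4 * ‖c‖ ^ 2 := by
    intro a c ha
    have := abs_real_inner_le_norm a c
    have h3 := neg_abs_le (inner ℝ a c)
    have h4 : ‖a‖ * ‖c‖ ≤ τ * ‖c‖ := by gcongr
    nlinarith [sq_nonneg (‖c‖ - 2)]
  have hin2 : ∀ a c : E, ‖a‖ < τ → inner ℝ a c ≤ τ * ‖c‖ := by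
    intro a c ha
    have := abs_real_inner_le_norm a c
    have h3 := le_abs_self (inner ℝ a c)
    have h4 : ‖a‖ * ‖c‖ ≤ τ * ‖c‖ := by gcongr
    linarith
  have e32 : 3 / (2 * ε) = 3 / ε / 2 := by field_simp
  have hval : M - 2 * η + τ / 4 * (‖x‖ ^ 2 + ‖y‖ ^ 2) ≤ U₁ x + U₂ y - 3 / (2 * ε) * ‖x - y‖ ^ 2 := by
    have m := hmax x₀ y₀
    have i1 := hin l₁ x hl₁
    have i2 := hin l₂ y hl₂
    have i3 := hin2 l₁ x₀ hl₁
    have i4 := hin2 l₂ y₀ hl₂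
    rw [hC₀] at hτ1
    rw [e32] at hlow ⊢
    nlinarith
  have hbd : τ / 4 * (‖x‖ ^ 2 + ‖y‖ ^ 2) ≤ 2 * η := by
    have := hup x y
    linarith
  have ct1 : U₁ x = a₁ (x + (ε / 3) • P₁ x) - ε / 3 * ‖P₁ x‖ ^ 2 / 2 := by
    refine b7 x (3 / ε + τ) ?_ (Eventually.of_forall fun h => ?_)
    · have : (1 : ℝ) / (ε / 12) = 12 * (1 / ε) := by field_simp
      rw [this]
      have h3 : 3 / ε = 3 * (1 / ε) := by ring
      have : 0 < 1 / ε := by positivity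
      linarith
    · have := key h 0
      simp only [add_zero, inner_zero_right, sub_zero, norm_zero] at this
      linarith
  have ct2 : U₂ y = a₂ (y + (ε / 3) • P₂ y) - ε / 3 * ‖P₂ y‖ ^ 2 / 2 := by
    refine c7 y (3 / ε + τ) ?_ (Eventually.of_forall fun h => ?_)
    · have : (1 : ℝ) / (ε / 12) = 12 * (1 / ε) := by field_simp
      rw [this]
      have h3 : 3 / ε = 3 * (1 / ε) := by ring
      have : 0 < 1 / ε := by positivity
      linarith
    · have := key 0 h
      simp only [add_zero, inner_zero_right, zero_sub, norm_neg, norm_zero] at this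
      linarith
  have so1 := second_order U₁ P₁ x A₁ (Eventually.of_forall (continuous_of_quad U₁ P₁ _ t1)) hA₁
  have so2 := second_order U₂ P₂ y A₂ (Eventually.of_forall (continuous_of_quad U₂ P₂ _ t2)) hA₂
  have jet : ∀ (a U : E → ℝ) (P : E → E) (x : E) (A : E →L[ℝ] E),
      (∀ x z, a z - ‖z - x‖ ^ 2 / (2 * (ε / 3)) ≤ U x) →
      U x = a (x + (ε / 3) • P x) - ε / 3 * ‖P x‖ ^ 2 / 2 →
      (∀ η' > 0, ∀ᶠ h in 𝓝 (0 : E), |U (x + h) - U x - inner ℝ (P x) h - inner ℝ (A h) h / 2| ≤ η' * ‖h‖ ^ 2) →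
      (∀ η' > 0, ∀ᶠ h in 𝓝 (0 : E), a (x + (ε / 3) • P x + h) ≤ a (x + (ε / 3) • P x) + inner ℝ (P x) h + inner ℝ (A h) h / 2 + η' * ‖h‖ ^ 2) := by
    intro a U P x A h1 h2 h3 η' hη'
    filter_upwards [h3 η' hη'] with h hh
    have i1 := h1 (x + h) (x + (ε / 3) • P x + h)
    have e : x + (ε / 3) • P x + h - (x + h) = (ε / 3) • P x := by abel
    rw [e, nsq_smul] at i1
    have e2 : (ε / 3) ^ 2 * ‖P x‖ ^ 2 / (2 * (ε / 3)) = ε / 3 * ‖P x‖ ^ 2 / 2 := by field_simp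
    have := (abs_le.1 hh).2
    linarith
  have low : ∀ (U : E → ℝ) (P : E → E) (x : E) (A : E →L[ℝ] E),
      (∀ x h, 2 * U x - ‖h‖ ^ 2 / (ε / 3) ≤ U (x + h) + U (x - h)) →
      (∀ η' > 0, ∀ᶠ h in 𝓝 (0 : E), |U (x + h) - U x - inner ℝ (P x) h - inner ℝ (A h) h / 2| ≤ η' * ‖h‖ ^ 2) →
      (∀ h, -(3 / ε) * ‖h‖ ^ 2 ≤ inner ℝ (A h) h) := by
    intro U P x A h1 h2 h
    refine le_of_forall_pos_le_add fun r hr => ?_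
    have hr' : 0 < r / (2 * (‖h‖ ^ 2 + 1)) := by positivity
    obtain ⟨t, ⟨ht1, ht2⟩, ht⟩ := (((eventually_scale (h2 _ hr') h).and (eventually_scale (h2 _ hr') (-h))).and
      self_mem_nhdsWithin).exists
    have ht0 : (0 : ℝ) < t := ht
    have i1 := (abs_le.1 ht1).2
    have i2 := (abs_le.1 ht2).2
    have i3 := h1 x (t • h)
    rw [smul_neg, ← sub_eq_add_neg, inner_neg_right, norm_neg, map_neg, inner_neg_neg] at i2
    rw [quad_scale, nsq_smul] at i1 i2
    rw [nsq_smul] at i3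
    have e : t ^ 2 * ‖h‖ ^ 2 / (ε / 3) = t ^ 2 * (3 / ε * ‖h‖ ^ 2) := by field_simp
    have e2 : r / (2 * (‖h‖ ^ 2 + 1)) * (t ^ 2 * ‖h‖ ^ 2) ≤ t ^ 2 * (r / 2) := by
      exact frac_bound _ _ _ hr.le (by positivity) (by positivity)
    rw [e] at i3
    have : t ^ 2 * (-(3 / ε) * ‖h‖ ^ 2) ≤ t ^ 2 * (inner ℝ (A h) h + r) := by linarith
    exact le_of_mul_le_mul_left this (by positivity)
  refine ⟨x + (ε / 3) • P₁ x, y + (ε / 3) • P₂ y, P₁ x, P₂ y, A₁, A₂, ?_, ?_,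
    jet a₁ U₁ P₁ x A₁ b2 ct1 so1, jet a₂ U₂ P₂ y A₂ c2 ct2 so2, low U₁ P₁ x A₁ b6 so1,
    low U₂ P₂ y A₂ c6 so2, ?_⟩
  · have := sums_shift ε (U₁ x) (U₂ y) hε x y (P₁ x) (P₂ y)
    have : 0 ≤ τ / 4 * (‖x‖ ^ 2 + ‖y‖ ^ 2) := by positivity
    linarith
  · have e : P₁ x + P₂ y = τ • x + τ • y + l₁ + l₂ := by rw [hP₁, hP₂]; abel
    rw [e]
    have n1 : ∀ v : E, τ / 4 * ‖v‖ ^ 2 ≤ 2 * η → ‖τ • v‖ ≤ η / 4 := by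
      intro v hv
      rw [norm_smul, Real.norm_eq_abs, abs_of_pos hτ]
      refine abs_le_of_sq_le_sq' ?_ (by positivity) |>.2
      nlinarith
    have n2 := n1 x (by nlinarith [sq_nonneg ‖y‖])
    have n3 := n1 y (by nlinarith [sq_nonneg ‖x‖])
    have n4 := norm_add_le (τ • x + τ • y + l₁) l₂
    have n5 := norm_add_le (τ • x + τ • y) l₁
    have n6 := norm_add_le (τ • x) (τ • y)
    linarith
  · intro h k
    refine le_of_forall_pos_le_add fun r hr => ?_
    have hr1 : 0 < r / (2 * (‖h‖ ^ 2 + ‖k‖ ^ 2 + 1)) := by positivity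
    obtain ⟨t, ⟨ht1, ht2⟩, ht⟩ := (((eventually_scale (so1 _ hr1) h).and (eventually_scale (so2 _ hr1) k)).and
      self_mem_nhdsWithin).exists
    have ht0 : (0 : ℝ) < t := ht
    have i1 := (abs_le.1 ht1).1
    have i2 := (abs_le.1 ht2).1
    have i3 := key (t • h) (t • k)
    rw [quad_scale, nsq_smul] at i1 i2
    rw [← smul_sub, nsq_smul, nsq_smul, nsq_smul] at i3
    have e2 : r / (2 * (‖h‖ ^ 2 + ‖k‖ ^ 2 + 1)) * (t ^ 2 * ‖h‖ ^ 2) + r / (2 * (‖h‖ ^ 2 + ‖k‖ ^ 2 + 1)) * (t ^ 2 * ‖k‖ ^ 2) ≤ t ^ 2 * (r / 2) := by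
      rw [← mul_add, ← mul_add]
      exact frac_bound _ _ _ hr.le (by positivity) (by positivity)
    have e3 : τ * (‖h‖ ^ 2 + ‖k‖ ^ 2) ≤ η * (‖h‖ ^ 2 + ‖k‖ ^ 2) := by
      gcongr; linarith
    have e4 : t ^ 2 * (τ * (‖h‖ ^ 2 + ‖k‖ ^ 2)) ≤ t ^ 2 * (η * (‖h‖ ^ 2 + ‖k‖ ^ 2)) := by gcongr
    have : t ^ 2 * (inner ℝ (A₁ h) h + inner ℝ (A₂ k) k) ≤
      t ^ 2 * (3 / ε * ‖h - k‖ ^ 2 + η * (‖h‖ ^ 2 + ‖k‖ ^ 2) + r) := by linarith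
    exact le_of_mul_le_mul_left this (by positivity)

end Sums3

section Quad
open Filter Topology Matrix

variable {n : ℕ}

/-- quadratic form of a matrix -/
def quad (X : Matrix (Fin n) (Fin n) ℝ) (h : En n) : ℝ := h.ofLp ⬝ᵥ (X *ᵥ h.ofLp)

theorem quad_add (X Y : Matrix (Fin n) (Fin n) ℝ) (h : En n) : quad (X + Y) h = quad X h + quad Y h := by
  simp [quad, add_mulVec, dotProduct_add]

theorem quad_neg (X : Matrix (Fin n) (Fin n) ℝ) (h : En n) : quad (-X) h = - quad X h := by
  simp [quad, neg_mulVec]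

theorem quad_sub (X Y : Matrix (Fin n) (Fin n) ℝ) (h : En n) : quad (X - Y) h = quad X h - quad Y h := by
  rw [sub_eq_add_neg, quad_add, quad_neg, sub_eq_add_neg]

theorem quad_smul (c : ℝ) (X : Matrix (Fin n) (Fin n) ℝ) (h : En n) : quad (c • X) h = c * quad X h := by
  simp [quad, smul_mulVec]

theorem dot_self (h : En n) : h.ofLp ⬝ᵥ h.ofLp = ‖h‖ ^ 2 := by
  rw [EuclideanSpace.norm_sq_eq]
  simp [dotProduct, sq]

theorem quad_one (h : En n) : quad (1 : Matrix (Fin n) (Fin n) ℝ) h = ‖h‖ ^ 2 := by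
  simp [quad, dot_self]

theorem quad_zero (h : En n) : quad (0 : Matrix (Fin n) (Fin n) ℝ) h = 0 := by
  simp [quad]

theorem quad_scale_vec (X : Matrix (Fin n) (Fin n) ℝ) (t : ℝ) (h : En n) :
    quad X (t • h) = t ^ 2 * quad X h := by
  simp [quad, mulVec_smul]; ring

theorem PosSemidef.quad_nonneg {X : Matrix (Fin n) (Fin n) ℝ} (hX : X.PosSemidef) (h : En n) :
    0 ≤ quad X h := by
  have := (Matrix.posSemidef_iff_dotProduct_mulVec.1 hX).2 h.ofLp
  simpa [quad] using this

theorem posSemidef_of_quad {X : Matrix (Fin n) (Fin n) ℝ} (hs : X.IsSymm) (h : ∀ h, 0 ≤ quad X h) :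
    X.PosSemidef := by
  rw [Matrix.posSemidef_iff_dotProduct_mulVec]
  refine ⟨by rw [Matrix.IsHermitian, conjTranspose_eq_transpose_of_trivial]; exact hs, fun v => ?_⟩
  have := h (WithLp.toLp 2 v)
  simpa [quad] using this

theorem continuous_quad (X : Matrix (Fin n) (Fin n) ℝ) : Continuous (quad X) := by
  unfold quad
  simp only [dotProduct, mulVec]
  fun_prop

theorem isSymm_smul_one (c : ℝ) : (c • (1 : Matrix (Fin n) (Fin n) ℝ)).IsSymm := by
  simp [Matrix.IsSymm]

theorem exists_symm_matrix (A : En n →L[ℝ] En n) :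
    ∃ X : Matrix (Fin n) (Fin n) ℝ, X.IsSymm ∧ ∀ h, quad X h = inner ℝ (A h) h := by
  let Bm : Matrix (Fin n) (Fin n) ℝ := fun i j => (A (EuclideanSpace.single j 1)) i
  refine ⟨(1 / 2 : ℝ) • (Bm + Bmᵀ), ?_, fun h => ?_⟩
  · simp [Matrix.IsSymm, add_comm]
  · have hA : ∀ i, (A h) i = (Bm *ᵥ h.ofLp) i := by
      intro i
      have : h = ∑ j, h j • EuclideanSpace.single j (1 : ℝ) := by
        ext i; simp [Finset.sum_apply, Pi.single_apply]
      conv_lhs => rw [this]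
      simp [mulVec, dotProduct, Bm, mul_comm]
    have h1 : inner ℝ (A h) h = h.ofLp ⬝ᵥ (Bm *ᵥ h.ofLp) := by
      rw [PiLp.inner_apply]
      simp only [hA, dotProduct]
      simp
    have h2 : h.ofLp ⬝ᵥ (Bmᵀ *ᵥ h.ofLp) = h.ofLp ⬝ᵥ (Bm *ᵥ h.ofLp) := by
      rw [mulVec_transpose, dotProduct_comm, dotProduct_mulVec]
    rw [quad_smul, quad_add, h1]
    unfold quad
    rw [h2]; ring

theorem block_psd (X Y : Matrix (Fin n) (Fin n) ℝ) (hX : X.IsSymm) (hY : Y.IsSymm) (c : ℝ)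
    (h : ∀ h k : En n, 0 ≤ quad X h + quad Y k + 2 * c * (h.ofLp ⬝ᵥ k.ofLp)) :
    (Matrix.fromBlocks X (c • 1) (c • 1) Y).PosSemidef := by
  rw [Matrix.posSemidef_iff_dotProduct_mulVec]
  refine ⟨?_, fun v => ?_⟩
  · rw [Matrix.IsHermitian, conjTranspose_eq_transpose_of_trivial, fromBlocks_transpose, hX, hY]
    simp
  · have := h (WithLp.toLp 2 (v ∘ Sum.inl)) (WithLp.toLp 2 (v ∘ Sum.inr))
    rw [fromBlocks_mulVec]
    have hv : v = Sum.elim (v ∘ Sum.inl) (v ∘ Sum.inr) := by simp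
    conv_rhs => rw [hv]
    rw [star_trivial, sumElim_dotProduct_sumElim]
    simp only [quad] at this
    simp only [smul_mulVec, one_mulVec, dotProduct_add, dotProduct_smul, smul_eq_mul,
      Sum.elim_comp_inl, Sum.elim_comp_inr]
    rw [dotProduct_comm (v ∘ Sum.inr) (v ∘ Sum.inl)]
    linarith

/-- second order upper jets -/
def JetUp (u : En n → ℝ) (x p : En n) (X : Matrix (Fin n) (Fin n) ℝ) : Prop :=
  X.IsSymm ∧ ∀ η > (0 : ℝ), ∀ᶠ h in 𝓝 (0 : En n),
    u (x + h) ≤ u x + inner ℝ p h + quad X h / 2 + η * ‖h‖ ^ 2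

/-- subsolutions via jets -/
def SubJ (F : En n → Matrix (Fin n) (Fin n) ℝ → ℝ)
    (H : En n → En n → ℝ) (s : ℝ) (f : En n → ℝ) (u : En n → ℝ) : Prop :=
  ∀ x p X, JetUp u x p X → f x ≤ F x X + H x p - |u x| ^ (s - 1) * u x

theorem norm_sub_sq_dot (h k : En n) : ‖h - k‖ ^ 2 = ‖h‖ ^ 2 + ‖k‖ ^ 2 - 2 * (h.ofLp ⬝ᵥ k.ofLp) := by
  rw [← dot_self, ← dot_self, ← dot_self]
  simp only [WithLp.ofLp_sub, sub_dotProduct, dotProduct_sub]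
  rw [dotProduct_comm k.ofLp h.ofLp]; ring

theorem doubling (a₁ a₂ : En n → ℝ) (ha₁ : UpperSemicontinuous a₁) (ha₂ : UpperSemicontinuous a₂)
    (B : ℝ) (hB₁ : ∀ z, |a₁ z| ≤ B) (hB₂ : ∀ z, |a₂ z| ≤ B) (x₀ : En n) (h₀ : 0 < a₁ x₀ + a₂ x₀)
    (e : ℝ) (he : 0 < e) :
    ∃ (ε η : ℝ) (z w p₁ p₂ : En n) (X₁ X₂ : Matrix (Fin n) (Fin n) ℝ),
      0 < ε ∧ 0 < η ∧ η < e ∧ 0 < a₁ z + a₂ w ∧ ‖z - w‖ + ε⁻¹ * ‖z - w‖ ^ 2 < e ∧ ‖p₁ + p₂‖ < e ∧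
      JetUp a₁ z p₁ X₁ ∧ JetUp a₂ w p₂ X₂ ∧
      (Matrix.fromBlocks (X₁ - η • 1) 0 0 (-(-(X₂ - η • 1))) +
          (3 / ε) • (1 : Matrix (Fin n ⊕ Fin n) (Fin n ⊕ Fin n) ℝ)).PosSemidef ∧
      ((3 / ε) • Matrix.fromBlocks (1 : Matrix (Fin n) (Fin n) ℝ) (-1) (-1) 1 -
          Matrix.fromBlocks (X₁ - η • 1) 0 0 (-(-(X₂ - η • 1)))).PosSemidef := by
  let mm : ℝ → ℝ := fun ε => ⨆ v : En n × En n, (a₁ v.1 + a₂ v.2 - ‖v.1 - v.2‖ ^ 2 / (2 * ε))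
  have hbdd : ∀ ε > 0, BddAbove (Set.range fun v : En n × En n =>
      (a₁ v.1 + a₂ v.2 - ‖v.1 - v.2‖ ^ 2 / (2 * ε))) := by
    intro ε hε
    refine ⟨2 * B, ?_⟩
    rintro _ ⟨v, rfl⟩
    have := (abs_le.1 (hB₁ v.1)).2
    have := (abs_le.1 (hB₂ v.2)).2
    have : 0 ≤ ‖v.1 - v.2‖ ^ 2 / (2 * ε) := by positivity
    simp only; linarith
  have hle : ∀ ε > 0, ∀ z w, a₁ z + a₂ w - ‖z - w‖ ^ 2 / (2 * ε) ≤ mm ε := fun ε hε z w =>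
    le_ciSup (hbdd ε hε) (z, w)
  have hmono : ∀ ε ε', 0 < ε → ε ≤ ε' → mm ε ≤ mm ε' := by
    intro ε ε' h1 h2
    refine ciSup_le fun v => ?_
    refine le_trans ?_ (hle ε' (by linarith) v.1 v.2)
    gcongr
  have hM0 : ∀ ε > 0, a₁ x₀ + a₂ x₀ ≤ mm ε := by
    intro ε hε
    have := hle ε hε x₀ x₀
    simpa using this
  set M0 := a₁ x₀ + a₂ x₀ with hM0d
  obtain ⟨η, hη, hη1, hη2⟩ : ∃ η : ℝ, 0 < η ∧ η < M0 / 2 ∧ 192 * η < e := by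
    refine ⟨min (M0 / 4) (e / 193), by positivity, ?_, ?_⟩
    · have := min_le_left (M0 / 4) (e / 193); linarith
    · have := min_le_right (M0 / 4) (e / 193); linarith
  have hI : BddBelow (mm '' Set.Ioi 0) := ⟨M0, by rintro _ ⟨ε, hε, rfl⟩; exact hM0 ε hε⟩
  set L := sInf (mm '' Set.Ioi 0) with hL
  have hne : (mm '' Set.Ioi 0).Nonempty := ⟨_, 1, by simp, rfl⟩
  obtain ⟨_, ⟨ε₀, hε₀, rfl⟩, hlt⟩ := exists_lt_of_csInf_lt hne (show L < L + η by linarith)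
  have hε₀ : 0 < ε₀ := hε₀
  obtain ⟨ε, hε, hε1, hε2, hε3⟩ : ∃ ε : ℝ, 0 < ε ∧ 4 * ε ≤ ε₀ ∧ ε ≤ e ∧ η ≤ 3 / (2 * ε) := by
    refine ⟨min (ε₀ / 4) (min e (1 / η)), by positivity, ?_, ?_, ?_⟩
    · have := min_le_left (ε₀ / 4) (min e (1 / η)); linarith
    · exact (min_le_right _ _).trans (min_le_left _ _)
    · have h1 : min (ε₀ / 4) (min e (1 / η)) ≤ 1 / η := (min_le_right _ _).trans (min_le_right _ _)
      have h2 : 0 < min (ε₀ / 4) (min e (1 / η)) := by positivity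
      rw [le_div_iff₀ (by positivity)]
      have : min (ε₀ / 4) (min e (1 / η)) * η ≤ 1 := by rwa [← le_div_iff₀ hη]
      nlinarith
  obtain ⟨v, hv⟩ := exists_lt_of_lt_ciSup (show mm (2 * ε) - η < mm (2 * ε) by linarith)
  obtain ⟨z, w, p₁, p₂, A₁, A₂, q1, q2, j1, j2, l1, l2, q3⟩ := approx_sums a₁ a₂ ha₁ ha₂ B hB₁ hB₂ (2 * ε) η
    (mm (2 * ε)) (by positivity) hη (fun z w => by have := hle (2 * ε) (by positivity) z w; linarith)
    v.1 v.2 hv.le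
  obtain ⟨X₁, s1, hX₁⟩ := exists_symm_matrix A₁
  obtain ⟨X₂, s2, hX₂⟩ := exists_symm_matrix A₂
  have hd : ε⁻¹ * ‖z - w‖ ^ 2 ≤ 24 * η := by
    have h1 := hle (2 * (2 * ε)) (by positivity) z w
    have h2 := hmono (2 * (2 * ε)) ε₀ (by positivity) (by linarith)
    have h3 : L ≤ mm (2 * ε) := csInf_le hI ⟨2 * ε, by simp; positivity, rfl⟩
    have e1 : ‖z - w‖ ^ 2 / (2 * (2 * ε)) = (ε⁻¹ * ‖z - w‖ ^ 2) / 4 := by field_simp; ring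
    have e2 : ‖z - w‖ ^ 2 / (2 * (2 * (2 * ε))) = (ε⁻¹ * ‖z - w‖ ^ 2) / 8 := by field_simp; ring
    rw [e1] at q1
    rw [e2] at h1
    linarith
  have hd2 : ‖z - w‖ ≤ e / 2 := by
    have h1 : ‖z - w‖ ^ 2 ≤ 24 * η * ε := by
      rw [inv_mul_le_iff₀ hε] at hd; linarith
    refine abs_le_of_sq_le_sq' ?_ (by positivity) |>.2
    have : 24 * η * ε ≤ e / 8 * e := by
      apply mul_le_mul _ hε2 hε.le (by positivity); linarith
    nlinarith
  have sy : ∀ X : Matrix (Fin n) (Fin n) ℝ, X.IsSymm → ∀ c : ℝ, (X + c • (1 : Matrix (Fin n) (Fin n) ℝ)).IsSymm :=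
    fun X hX c => hX.add (isSymm_smul_one c)
  refine ⟨ε, η, z, w, p₁, p₂, X₁, X₂, hε, hη, by linarith, ?_, by linarith, by linarith,
    ⟨s1, fun η' h => by simpa only [hX₁] using j1 η' h⟩, ⟨s2, fun η' h => by simpa only [hX₂] using j2 η' h⟩, ?_, ?_⟩
  · have := hM0 (2 * ε) (by positivity)
    have : 0 ≤ ‖z - w‖ ^ 2 / (2 * (2 * ε)) := by positivity
    linarith
  · have := block_psd (X₁ + (3 / ε - η) • 1) (X₂ + (3 / ε - η) • 1) (sy _ s1 _) (sy _ s2 _) 0 (by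
      intro h k
      rw [quad_add, quad_add, quad_smul, quad_smul, quad_one, quad_one, hX₁, hX₂]
      have i1 := l1 h
      have i2 := l2 k
      have e1 : 3 / (2 * ε) = 3 / ε / 2 := by field_simp
      rw [e1] at hε3
      have e2 : 3 / (2 * ε) = 3 / ε / 2 := by field_simp
      rw [e2] at i1 i2
      have i3 : η * ‖h‖ ^ 2 ≤ 3 / ε / 2 * ‖h‖ ^ 2 := by gcongr
      have i4 : η * ‖k‖ ^ 2 ≤ 3 / ε / 2 * ‖k‖ ^ 2 := by gcongr
      linarith)
    convert this using 1
    rw [← fromBlocks_one, fromBlocks_smul, fromBlocks_add]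
    congr 1 <;> first | (simp; done) | module
  · have := block_psd ((-X₁) + (3 / ε + η) • 1) ((-X₂) + (3 / ε + η) • 1) (sy _ s1.neg _) (sy _ s2.neg _) (-(3 / ε)) (by
      intro h k
      rw [quad_add, quad_add, quad_smul, quad_smul, quad_one, quad_one, quad_neg, quad_neg, hX₁, hX₂]
      have i1 := q3 h k
      have e1 : 3 / (2 * ε) = 3 / ε / 2 := by field_simp
      rw [e1] at i1
      have i3 : 0 ≤ 3 / ε / 2 * ‖h - k‖ ^ 2 := by positivity
      have i4 : 3 / ε / 2 * ‖h - k‖ ^ 2 + 3 / ε / 2 * ‖h - k‖ ^ 2 = 3 / ε * (‖h‖ ^ 2 + ‖k‖ ^ 2 - 2 * (h.ofLp ⬝ᵥ k.ofLp)) := by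
        rw [← norm_sub_sq_dot]; ring
      linarith)
    convert this using 1
    rw [fromBlocks_smul, sub_eq_add_neg, fromBlocks_neg, fromBlocks_add]
    congr 1 <;> first | (simp; done) | module

end Quad

section Visc
open Filter Topology Matrix

variable {n : ℕ}

theorem quad_of_entries (A : En n →L[ℝ] En n) (X : Matrix (Fin n) (Fin n) ℝ)
    (hX : ∀ i j, X i j = inner ℝ (A (EuclideanSpace.single i 1)) (EuclideanSpace.single j 1)) (h : En n) :
    quad X h = inner ℝ (A h) h := by
  have hh : h = ∑ j, h j • EuclideanSpace.single j (1 : ℝ) := by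
    ext i; simp [Finset.sum_apply, Pi.single_apply]
  have h1 : inner ℝ (A h) h = ∑ i, ∑ j, h i * X i j * h j := by
    conv_lhs => rw [hh]
    rw [map_sum, sum_inner]
    refine Finset.sum_congr rfl fun i _ => ?_
    rw [inner_sum]
    refine Finset.sum_congr rfl fun j _ => ?_
    rw [map_smul, real_inner_smul_left, real_inner_smul_right, hX]; ring
  rw [h1]
  simp only [quad, dotProduct, mulVec, Finset.mul_sum]
  refine Finset.sum_congr rfl fun i _ => Finset.sum_congr rfl fun j _ => by ring

theorem hessianMatrix_eq (φ : En n → ℝ) (P : En n → En n) (A : En n →L[ℝ] En n) (x : En n)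
    (h1 : ∀ y, HasFDerivAt φ (innerSL ℝ (P y)) y) (h2 : HasFDerivAt P A x) (i j : Fin n) :
    hessianMatrix φ x i j = inner ℝ (A (EuclideanSpace.single i 1)) (EuclideanSpace.single j 1) := by
  unfold hessianMatrix
  rw [iteratedFDeriv_two_apply]
  have e : fderiv ℝ φ = fun y => innerSL ℝ (P y) := funext fun y => (h1 y).fderiv
  have h3 : HasFDerivAt (fun y => innerSL ℝ (P y)) ((innerSL ℝ).comp A) x :=
    (innerSL ℝ).hasFDerivAt.comp x h2
  rw [e, h3.fderiv]
  simp

theorem gradient_eq_of (φ : En n → ℝ) (p x : En n) (h : HasFDerivAt φ (innerSL ℝ p) x) :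
    gradient φ x = p :=
  HasGradientAt.gradient (hasGradientAt_iff_hasFDerivAt.2 h)

theorem symm_quad_ext {X Y : Matrix (Fin n) (Fin n) ℝ} (hX : X.IsSymm) (hY : Y.IsSymm)
    (h : ∀ v, quad X v = quad Y v) : X = Y := by
  have h1 : (X - Y).PosSemidef := posSemidef_of_quad (hX.sub hY) fun v => by rw [quad_sub, h]; simp
  have h2 : (Y - X).PosSemidef := posSemidef_of_quad (hY.sub hX) fun v => by rw [quad_sub, h]; simp
  have hb : ∀ u v : En n, u.ofLp ⬝ᵥ ((X - Y) *ᵥ v.ofLp) = 0 := by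
    intro u v
    have e := fun w => (by rw [quad_sub, h]; simp : quad (X - Y) w = 0)
    have a := e (u + v)
    have b := e u
    have c := e v
    unfold quad at a b c
    simp only [WithLp.ofLp_add, mulVec_add, dotProduct_add, add_dotProduct] at a
    have d : v.ofLp ⬝ᵥ ((X - Y) *ᵥ u.ofLp) = u.ofLp ⬝ᵥ ((X - Y) *ᵥ v.ofLp) := by
      conv_lhs => rw [← (hX.sub hY).eq]
      rw [mulVec_transpose, dotProduct_comm, dotProduct_mulVec]
    linarith
  ext i j
  have := hb (EuclideanSpace.single i 1) (EuclideanSpace.single j 1)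
  simp at this
  linarith

theorem JetUp.add_one {u : En n → ℝ} {x p : En n} {X : Matrix (Fin n) (Fin n) ℝ} (h : JetUp u x p X)
    (c : ℝ) (hc : 0 < c) : ∀ᶠ k in 𝓝 (0 : En n), u (x + k) ≤ u x + inner ℝ p k + quad (X + c • 1) k / 2 := by
  filter_upwards [h.2 (c / 2) (by positivity)] with k hk
  rw [quad_add, quad_smul, quad_one]; linarith

/-- uniformly elliptic operators -/
structure EllF (lam Lam : ℝ) (F : En n → Matrix (Fin n) (Fin n) ℝ → ℝ) : Prop where
  hlam : 0 < lam
  hle : lam ≤ Lam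
  ell : ∀ (x : En n) (X Y : Matrix (Fin n) (Fin n) ℝ), X.IsSymm → Y.IsSymm →
      Y.PosSemidef →
      lam * Y.trace ≤ F x (X + Y) - F x X ∧ F x (X + Y) - F x X ≤ Lam * Y.trace

variable {lam Lam : ℝ} {F : En n → Matrix (Fin n) (Fin n) ℝ → ℝ}

theorem EllF.mono (hF : EllF lam Lam F) (x : En n) {X Y : Matrix (Fin n) (Fin n) ℝ} (hX : X.IsSymm)
    (hY : Y.IsSymm) (h : ∀ v, quad X v ≤ quad Y v) : F x X ≤ F x Y := by
  have h1 : (Y - X).PosSemidef := posSemidef_of_quad (hY.sub hX) fun v => by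
    rw [quad_sub]; linarith [h v]
  have := (hF.ell x X (Y - X) hX (hY.sub hX) h1).1
  have h2 := h1.trace_nonneg
  rw [add_sub_cancel] at this
  have : 0 ≤ lam * (Y - X).trace := mul_nonneg hF.hlam.le h2
  linarith

theorem posSemidef_smul_one (c : ℝ) (hc : 0 ≤ c) : (c • (1 : Matrix (Fin n) (Fin n) ℝ)).PosSemidef :=
  posSemidef_of_quad (isSymm_smul_one c) fun v => by rw [quad_smul, quad_one]; positivity

theorem EllF.add_one (hF : EllF lam Lam F) (x : En n) {X : Matrix (Fin n) (Fin n) ℝ} (hX : X.IsSymm)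
    (c : ℝ) (hc : 0 ≤ c) : F x (X + c • 1) ≤ F x X + Lam * n * c := by
  have := (hF.ell x X (c • 1) hX (isSymm_smul_one c) (posSemidef_smul_one c hc)).2
  rw [trace_smul, trace_one] at this
  simp at this
  linarith

theorem EllF.dual (hF : EllF lam Lam F) : EllF lam Lam (fun x X => - F x (-X)) := by
  refine ⟨hF.hlam, hF.hle, fun x X Y hX hY hP => ?_⟩
  have := hF.ell x (-(X + Y)) Y (hX.add hY).neg hY hP
  have e : -(X + Y) + Y = -X := by abel
  rw [e] at this
  constructor <;> linarith [this.1, this.2]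

theorem EllF.le_add (hF : EllF lam Lam F) (x : En n) {X Y : Matrix (Fin n) (Fin n) ℝ} (hX : X.IsSymm)
    (hY : Y.IsSymm) (c : ℝ) (hc : 0 ≤ c) (h : ∀ v, quad Y v ≤ quad X v + c * ‖v‖ ^ 2) :
    F x Y ≤ F x X + Lam * n * c := by
  refine le_trans (hF.mono x hY (hX.add (isSymm_smul_one c)) fun v => ?_) (hF.add_one x hX c hc)
  rw [quad_add, quad_smul, quad_one]; exact h v

theorem subJ_of_visc (hF : EllF lam Lam F) {H : En n → En n → ℝ} {s : ℝ} {f u : En n → ℝ}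
    (hu : ViscositySubsolution F H s f u) : SubJ F H s f u := by
  intro x p X hj
  have main : ∀ c > (0 : ℝ), f x ≤ F x X + Lam * n * c + H x p - |u x| ^ (s - 1) * u x := by
    intro c hc
    set Y := X + c • (1 : Matrix (Fin n) (Fin n) ℝ) with hY
    have hYs : Y.IsSymm := hj.1.add (isSymm_smul_one c)
    let Bc : En n →L[ℝ] En n := toEuclideanCLM (𝕜 := ℝ) Y
    have hB : ∀ a b : En n, inner ℝ (Bc a) b = b.ofLp ⬝ᵥ (Y *ᵥ a.ofLp) := by
      intro a b
      rw [PiLp.inner_apply]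
      simp only [Bc, dotProduct, ofLp_toEuclideanCLM]
      simp
    have hBs : ∀ a b : En n, inner ℝ (Bc a) b = inner ℝ (Bc b) a := by
      intro a b
      rw [hB, hB]
      conv_lhs => rw [← hYs.eq]
      rw [mulVec_transpose, dotProduct_comm, dotProduct_mulVec]
    let φ : En n → ℝ := fun y => inner ℝ p (y - x) + inner ℝ (Bc (y - x)) (y - x) / 2
    let P : En n → En n := fun y => p + Bc (y - x)
    have h1 : ∀ y, HasFDerivAt φ (innerSL ℝ (P y)) y := by
      refine continuous_of_quad φ P (‖Bc‖) fun y k => ?_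
      have e : φ (y + k) - φ y - inner ℝ (P y) k = inner ℝ (Bc k) k / 2 := by
        have e1 : y + k - x = (y - x) + k := by abel
        simp only [φ, P]
        rw [e1, map_add, inner_add_right, inner_add_left, inner_add_right, inner_add_right,
          inner_add_left, hBs k (y - x)]
        ring
      rw [e]
      have h2 := abs_real_inner_le_norm (Bc k) k
      have h3 := Bc.le_opNorm k
      have h4 : ‖Bc k‖ * ‖k‖ ≤ ‖Bc‖ * ‖k‖ * ‖k‖ := by gcongr
      have h5 : 0 ≤ ‖Bc‖ * ‖k‖ * ‖k‖ := by positivity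
      rw [abs_div, abs_two]
      nlinarith
    have h2 : HasFDerivAt P Bc x := by
      have : HasFDerivAt (fun y => y - x) (ContinuousLinearMap.id ℝ (En n)) x := (hasFDerivAt_id x).sub_const x
      have := (Bc.hasFDerivAt.comp x this).const_add p
      rw [ContinuousLinearMap.comp_id] at this
      exact this
    have hφ : ContDiff ℝ 2 φ := by
      have e1 : ContDiff ℝ 2 (fun y : En n => y - x) := contDiff_id.sub contDiff_const
      exact (contDiff_const.inner ℝ e1).add (((Bc.contDiff.comp e1).inner ℝ e1).div_const 2)
    have hmax : IsLocalMax (u - φ) x := by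
      have hev := hj.add_one c hc
      have ht : Tendsto (fun y => y - x) (𝓝 x) (𝓝 0) := by
        have : Tendsto (fun y => y - x) (𝓝 x) (𝓝 (x - x)) := (continuous_id.sub continuous_const).tendsto x
        rwa [sub_self] at this
      filter_upwards [ht.eventually hev] with y hy
      rw [add_sub_cancel] at hy
      have e1 : quad Y (y - x) = inner ℝ (Bc (y - x)) (y - x) := by rw [hB]; rfl
      rw [e1] at hy
      simp only [Pi.sub_apply, φ, sub_self, inner_zero_right, map_zero]
      linarith
    have := hu φ hφ x hmax
    have g : gradient φ x = p := by
      rw [gradient_eq_of φ (P x) x (h1 x)]; simp [P]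
    have hh : hessianMatrix φ x = Y := by
      ext i j
      rw [hessianMatrix_eq φ P Bc x h1 h2, hB]
      simp
      exact hYs.apply _ _
    rw [g, hh] at this
    have := hF.add_one x hj.1 c hc.le
    linarith
  refine le_of_forall_pos_le_add fun r hr => ?_
  have hL : 0 < Lam := hF.hlam.trans_le hF.hle
  have h1 := main (r / (Lam * n + 1)) (by positivity)
  have h2 : Lam * n * (r / (Lam * n + 1)) ≤ r := by
    rw [mul_div_assoc', div_le_iff₀ (by positivity)]
    nlinarith
  linarith

theorem visc_of_subJ {H : En n → En n → ℝ} {s : ℝ} {f u : En n → ℝ}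
    (hu : SubJ F H s f u) : ViscositySubsolution F H s f u := by
  intro φ hφ x hmax
  have hd : Differentiable ℝ φ := hφ.differentiable (by norm_num)
  have h1 : ∀ y, HasFDerivAt φ (innerSL ℝ (gradient φ y)) y := fun y => by
    have := (hd y).hasGradientAt
    rw [hasGradientAt_iff_hasFDerivAt] at this
    exact this
  have hd2 : Differentiable ℝ (fderiv ℝ φ) :=
    (hφ.fderiv_right (m := 1) (by norm_num)).differentiable (by norm_num)
  let T : (En n →L[ℝ] ℝ) →L[ℝ] En n := LinearMap.mkContinuous
    { toFun := fun L => (InnerProductSpace.toDual ℝ (En n)).symm L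
      map_add' := fun a b => map_add _ a b
      map_smul' := fun c a => by simp } 1 (fun L => by simp)
  have h2 : HasFDerivAt (gradient φ) (T.comp (fderiv ℝ (fderiv ℝ φ) x)) x :=
    T.hasFDerivAt.comp x (hd2 x).hasFDerivAt
  set Ac : En n →L[ℝ] En n := T.comp (fderiv ℝ (fderiv ℝ φ) x) with hAc
  have hent := hessianMatrix_eq φ (gradient φ) Ac x h1 h2
  have hsym : (hessianMatrix φ x).IsSymm := by
    have hs : IsSymmSndFDerivAt ℝ φ x := hφ.contDiffAt.isSymmSndFDerivAt (by simp)
    ext i j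
    simp only [transpose_apply, hessianMatrix, iteratedFDeriv_two_apply]
    exact hs _ _
  refine hu x _ _ ⟨hsym, fun η hη => ?_⟩
  have ht : Tendsto (fun h => x + h) (𝓝 (0 : En n)) (𝓝 x) := by
    have : Tendsto (fun h => x + h) (𝓝 0) (𝓝 (x + 0)) := (continuous_const.add continuous_id).tendsto 0
    rwa [add_zero] at this
  filter_upwards [second_order φ (gradient φ) x Ac (Eventually.of_forall h1) h2 η hη, ht.eventually hmax] with h hh hm
  have := (abs_le.1 hh).2
  rw [quad_of_entries Ac _ hent]
  simp only [Pi.sub_apply] at hm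
  linarith

theorem hessianMatrix_neg (φ : En n → ℝ) (x : En n) : hessianMatrix (-φ) x = - hessianMatrix φ x := by
  ext i j
  simp [hessianMatrix, iteratedFDeriv_neg]

theorem gradient_neg' (φ : En n → ℝ) (x : En n) : gradient (-φ) x = - gradient φ x := by
  simp [gradient, fderiv_neg]

/-- dual operator -/
def dualF (F : En n → Matrix (Fin n) (Fin n) ℝ → ℝ) : En n → Matrix (Fin n) (Fin n) ℝ → ℝ :=
  fun x X => - F x (-X)

/-- dual hamiltonian -/
def dualH (H : En n → En n → ℝ) : En n → En n → ℝ := fun x p => - H x (-p)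

theorem super_iff_sub {H : En n → En n → ℝ} {s : ℝ} {f u : En n → ℝ} :
    ViscositySupersolution F H s f u ↔ ViscositySubsolution (dualF F) (dualH H) s (-f) (-u) := by
  constructor
  · intro h φ hφ x hm
    have := h (-φ) hφ.neg x (by
      have h2 := hm.neg
      have e : u - -φ = (fun x => -(-u - φ) x) := by funext y; simp; ring
      rw [e]; exact h2)
    rw [hessianMatrix_neg, gradient_neg'] at this
    simp only [dualF, dualH, Pi.neg_apply, abs_neg]
    linarith
  · intro h φ hφ x hm
    have := h (-φ) hφ.neg x (by
      have h2 := hm.neg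
      have e : -u - -φ = (fun x => -(u - φ) x) := by funext y; simp; ring
      rw [e]; exact h2)
    rw [hessianMatrix_neg, gradient_neg'] at this
    simp only [dualF, dualH, Pi.neg_apply, abs_neg, neg_neg] at this
    linarith

end Visc

section Jets
open Filter Topology Matrix

variable {n : ℕ}

/-- two sided second order expansion -/
def Jet2 (u : En n → ℝ) (x p : En n) (X : Matrix (Fin n) (Fin n) ℝ) : Prop :=
  X.IsSymm ∧ ∀ η > (0 : ℝ), ∀ᶠ h in 𝓝 (0 : En n),
    |u (x + h) - u x - inner ℝ p h - quad X h / 2| ≤ η * ‖h‖ ^ 2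

theorem tendsto_add_zero_nhds (x : En n) : Tendsto (fun h => x + h) (𝓝 (0 : En n)) (𝓝 x) := by
  have : Tendsto (fun h => x + h) (𝓝 0) (𝓝 (x + 0)) := (continuous_const.add continuous_id).tendsto 0
  rwa [add_zero] at this

theorem JetUp.mono {u v : En n → ℝ} {x p : En n} {X : Matrix (Fin n) (Fin n) ℝ} (h : JetUp u x p X)
    (hv : ∀ᶠ y in 𝓝 x, v y ≤ u y) (hx : v x = u x) : JetUp v x p X := by
  refine ⟨h.1, fun η hη => ?_⟩
  filter_upwards [h.2 η hη, (tendsto_add_zero_nhds x).eventually hv] with k h1 h2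
  linarith

theorem JetUp.add {u φ : En n → ℝ} {x p q : En n} {X Y : Matrix (Fin n) (Fin n) ℝ} (h : JetUp u x p X)
    (h' : Jet2 φ x q Y) : JetUp (fun y => u y + φ y) x (p + q) (X + Y) := by
  refine ⟨h.1.add h'.1, fun η hη => ?_⟩
  filter_upwards [h.2 (η / 2) (by positivity), h'.2 (η / 2) (by positivity)] with k h1 h2
  have := (abs_le.1 h2).2
  rw [inner_add_left, quad_add]
  linarith

theorem Jet2.add {u φ : En n → ℝ} {x p q : En n} {X Y : Matrix (Fin n) (Fin n) ℝ} (h : Jet2 u x p X)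
    (h' : Jet2 φ x q Y) : Jet2 (fun y => u y + φ y) x (p + q) (X + Y) := by
  refine ⟨h.1.add h'.1, fun η hη => ?_⟩
  filter_upwards [h.2 (η / 2) (by positivity), h'.2 (η / 2) (by positivity)] with k h1 h2
  have a := abs_le.1 h2
  have b := abs_le.1 h1
  rw [inner_add_left, quad_add, abs_le]
  constructor <;> linarith [a.1, a.2, b.1, b.2]

theorem Jet2.neg {u : En n → ℝ} {x p : En n} {X : Matrix (Fin n) (Fin n) ℝ} (h : Jet2 u x p X) :
    Jet2 (fun y => - u y) x (-p) (-X) := by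
  refine ⟨h.1.neg, fun η hη => ?_⟩
  filter_upwards [h.2 η hη] with k h1
  have b := abs_le.1 h1
  rw [inner_neg_left, quad_neg, abs_le]
  constructor <;> linarith [b.1, b.2]

theorem Jet2.const (c : ℝ) (x : En n) : Jet2 (fun _ => c) x 0 0 := by
  refine ⟨by simp [Matrix.IsSymm], fun η hη => ?_⟩
  filter_upwards with k
  simp [quad_zero]; positivity

theorem Jet2.up {u : En n → ℝ} {x p : En n} {X : Matrix (Fin n) (Fin n) ℝ} (h : Jet2 u x p X) :
    JetUp u x p X := by
  refine ⟨h.1, fun η hη => ?_⟩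
  filter_upwards [h.2 η hη] with k h1
  linarith [(abs_le.1 h1).2]

theorem jetUp_of_max {u φ : En n → ℝ} {x p : En n} {X : Matrix (Fin n) (Fin n) ℝ} (h : Jet2 φ x p X)
    (hm : ∀ᶠ y in 𝓝 x, u y - φ y ≤ u x - φ x) : JetUp u x p X := by
  refine ⟨h.1, fun η hη => ?_⟩
  filter_upwards [h.2 η hη, (tendsto_add_zero_nhds x).eventually hm] with k h1 h2
  linarith [(abs_le.1 h1).2]

theorem JetUp.of_smul {u : En n → ℝ} {x p : En n} {X : Matrix (Fin n) (Fin n) ℝ} {σ : ℝ} (hσ : 0 < σ)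
    (h : JetUp (fun y => σ * u y) x p X) : JetUp u x (σ⁻¹ • p) (σ⁻¹ • X) := by
  refine ⟨h.1.smul _, fun η hη => ?_⟩
  filter_upwards [h.2 (σ * η) (by positivity)] with k h1
  rw [real_inner_smul_left, quad_smul]
  have h2 : σ * u (x + k) ≤ σ * (u x + σ⁻¹ * inner ℝ p k + σ⁻¹ * quad X k / 2 + η * ‖k‖ ^ 2) := by
    have e : σ * (u x + σ⁻¹ * inner ℝ p k + σ⁻¹ * quad X k / 2 + η * ‖k‖ ^ 2) =
      σ * u x + inner ℝ p k + quad X k / 2 + σ * η * ‖k‖ ^ 2 := by field_simp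
    rw [e]; exact h1
  exact le_of_mul_le_mul_left h2 hσ

/-- comparing an upper jet and a two sided one -/
theorem JetUp.compare {u : En n → ℝ} {x p q : En n} {X Y : Matrix (Fin n) (Fin n) ℝ} (h : JetUp u x p X)
    (h' : Jet2 u x q Y) : p = q ∧ ∀ v, quad Y v ≤ quad X v := by
  have key : ∀ η > (0 : ℝ), ∀ᶠ k in 𝓝 (0 : En n),
      inner ℝ (q - p) k + quad (Y - X) k / 2 ≤ η * ‖k‖ ^ 2 := by
    intro η hη
    filter_upwards [h.2 (η / 2) (by positivity), h'.2 (η / 2) (by positivity)] with k h1 h2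
    have := (abs_le.1 h2).1
    rw [inner_sub_left, quad_sub]
    linarith
  have hp : q - p = 0 := by
    by_contra hne
    have hpos : 0 < ‖q - p‖ ^ 2 := by have := norm_pos_iff.2 hne; positivity
    set c := |quad (Y - X) (q - p)| / 2 + ‖q - p‖ ^ 2 + 1 with hc
    have hc0 : 0 < c := by positivity
    have hev := eventually_scale (key 1 one_pos) (q - p)
    have hsm : ∀ᶠ t in 𝓝[>] (0 : ℝ), t < ‖q - p‖ ^ 2 / c :=
      nhdsWithin_le_nhds (Iio_mem_nhds (by positivity))
    obtain ⟨t, ⟨h1, h2⟩, ht⟩ := ((hev.and hsm).and self_mem_nhdsWithin).exists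
    have ht : 0 < t := ht
    rw [real_inner_smul_right, real_inner_self_eq_norm_sq, quad_scale_vec, nsq_smul] at h1
    have h3 := neg_abs_le (quad (Y - X) (q - p))
    rw [lt_div_iff₀ hc0] at h2
    have h4 : t * ‖q - p‖ ^ 2 ≤ t * (t * c) := by
      rw [hc]; nlinarith [sq_nonneg t]
    have := le_of_mul_le_mul_left h4 ht
    linarith
  refine ⟨(sub_eq_zero.1 hp).symm, fun v => ?_⟩
  refine le_of_forall_pos_le_add fun r hr => ?_
  have hr' : 0 < r / (2 * (‖v‖ ^ 2 + 1)) := by positivity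
  obtain ⟨t, h1, ht⟩ := ((eventually_scale (key _ hr') v).and self_mem_nhdsWithin).exists
  have ht : 0 < t := ht
  rw [hp, inner_zero_left, quad_scale_vec, nsq_smul, quad_sub] at h1
  have e2 := frac_bound r (t ^ 2) (‖v‖ ^ 2) hr.le (by positivity) (by positivity)
  have : t ^ 2 * quad Y v ≤ t ^ 2 * (quad X v + r) := by linarith
  exact le_of_mul_le_mul_left this (by positivity)

theorem quad_vecMulVec (x h : En n) : quad (vecMulVec x.ofLp x.ofLp) h = (inner ℝ x h) ^ 2 := by
  unfold quad
  rw [vecMulVec_mulVec, PiLp.inner_apply]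
  simp only [dotProduct, sq]
  simp only [Pi.smul_apply, MulOpposite.smul_eq_mul_unop, MulOpposite.unop_op, RCLike.inner_apply, conj_trivial]
  rw [Finset.sum_mul]
  refine Finset.sum_congr rfl fun i _ => ?_
  have : ∑ j, x.ofLp j * h.ofLp j = ∑ j, h.ofLp j * x.ofLp j :=
    Finset.sum_congr rfl fun j _ => mul_comm _ _
  rw [this]; ring

theorem jet_quad (x₀ p : En n) (X : Matrix (Fin n) (Fin n) ℝ) (hX : X.IsSymm) (c : ℝ) (x : En n) :
    Jet2 (fun y => c + inner ℝ p (y - x₀) + quad X (y - x₀) / 2) x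
      (p + toEuclideanCLM (𝕜 := ℝ) X (x - x₀)) X := by
  refine ⟨hX, fun η hη => Eventually.of_forall fun k => ?_⟩
  have e1 : x + k - x₀ = (x - x₀) + k := by abel
  have e2 : quad X (x - x₀ + k) = quad X (x - x₀) + 2 * inner ℝ (toEuclideanCLM (𝕜 := ℝ) X (x - x₀)) k + quad X k := by
    have h1 : inner ℝ (toEuclideanCLM (𝕜 := ℝ) X (x - x₀)) k = k.ofLp ⬝ᵥ (X *ᵥ (x - x₀).ofLp) := by
      rw [PiLp.inner_apply]
      simp only [dotProduct, ofLp_toEuclideanCLM]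
      simp
    have h2 : (x - x₀).ofLp ⬝ᵥ (X *ᵥ k.ofLp) = k.ofLp ⬝ᵥ (X *ᵥ (x - x₀).ofLp) := by
      conv_lhs => rw [← hX.eq]
      rw [mulVec_transpose, dotProduct_comm, dotProduct_mulVec]
    rw [h1]
    unfold quad
    rw [WithLp.ofLp_add, mulVec_add, dotProduct_add, add_dotProduct, add_dotProduct, h2]
    ring
  beta_reduce
  rw [e1, e2, inner_add_right, inner_add_left]
  have : c + (inner ℝ p (x - x₀) + inner ℝ p k) +
          (quad X (x - x₀) + 2 * inner ℝ (toEuclideanCLM (𝕜 := ℝ) X (x - x₀)) k + quad X k) / 2 -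
        (c + inner ℝ p (x - x₀) + quad X (x - x₀) / 2) -
      (inner ℝ p k + inner ℝ (toEuclideanCLM (𝕜 := ℝ) X (x - x₀)) k) - quad X k / 2 = 0 := by ring
  rw [this, abs_zero]; positivity

theorem jet_radial (g g' : ℝ → ℝ) (g2 : ℝ) (x : En n)
    (h1 : ∀ᶠ t in 𝓝 (‖x‖ ^ 2), HasDerivAt g (g' t) t) (h2 : HasDerivAt g' g2 (‖x‖ ^ 2)) :
    Jet2 (fun y => g (‖y‖ ^ 2)) x ((2 * g' (‖x‖ ^ 2)) • x)
      ((2 * g' (‖x‖ ^ 2)) • 1 + (4 * g2) • vecMulVec x.ofLp x.ofLp) := by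
  refine ⟨(isSymm_smul_one _).add (IsSymm.smul (by ext i j; simp [vecMulVec_apply, mul_comm]) _), fun η hη => ?_⟩
  set T := ‖x‖ ^ 2 with hT
  set N := (2 * ‖x‖ + 1) ^ 2 with hN
  have hN0 : 0 < N := by positivity
  have so := second_order g g' T (ContinuousLinearMap.toSpanSingleton ℝ g2) (by
      filter_upwards [h1] with t ht
      have e : innerSL ℝ (g' t) = ContinuousLinearMap.toSpanSingleton ℝ (g' t) := by
        ext; simp
      rw [e]
      exact ht.hasFDerivAt) (by
      exact h2.hasFDerivAt) (η / (2 * N)) (by positivity)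
  have htau : Tendsto (fun h : En n => 2 * inner ℝ x h + ‖h‖ ^ 2) (𝓝 0) (𝓝 0) := by
    have : Continuous (fun h : En n => 2 * inner ℝ x h + ‖h‖ ^ 2) := by fun_prop
    have := this.tendsto 0
    simpa using this
  have hsmall : ∀ᶠ h in 𝓝 (0 : En n), |g2| / 2 * (4 * ‖x‖ * ‖h‖ + ‖h‖ ^ 2) ≤ η / 2 := by
    have : Continuous (fun h : En n => |g2| / 2 * (4 * ‖x‖ * ‖h‖ + ‖h‖ ^ 2)) := by fun_prop
    have h3 := this.tendsto 0
    simp only [norm_zero, mul_zero, ne_eq, OfNat.ofNat_ne_zero, not_false_eq_true, zero_pow, add_zero] at h3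
    exact h3.eventually (Iic_mem_nhds (by positivity))
  have hone : ∀ᶠ h in 𝓝 (0 : En n), ‖h‖ ≤ 1 := by
    have := (continuous_norm (E := En n)).tendsto 0
    rw [norm_zero] at this
    exact this.eventually (Iic_mem_nhds one_pos)
  filter_upwards [htau.eventually so, hsmall, hone] with h k1 k2 k3
  have e1 : ‖x + h‖ ^ 2 = T + (2 * inner ℝ x h + ‖h‖ ^ 2) := by rw [norm_add_sq_real]; ring
  rw [e1, quad_add, quad_smul, quad_smul, quad_one, quad_vecMulVec, real_inner_smul_left]
  have hxh := abs_real_inner_le_norm x h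
  set a := inner ℝ x h with ha
  have hi : ∀ c d : ℝ, inner ℝ c d = c * d := fun c d => by simp [mul_comm]
  simp only [ContinuousLinearMap.toSpanSingleton_apply, hi, smul_eq_mul] at k1
  have e2 : g (T + (2 * a + ‖h‖ ^ 2)) - g T - 2 * g' T * a - (2 * g' T * ‖h‖ ^ 2 + 4 * g2 * a ^ 2) / 2 =
    (g (T + (2 * a + ‖h‖ ^ 2)) - g T - g' T * (2 * a + ‖h‖ ^ 2) - (2 * a + ‖h‖ ^ 2) * g2 * (2 * a + ‖h‖ ^ 2) / 2)
     + g2 / 2 * (4 * a + ‖h‖ ^ 2) * ‖h‖ ^ 2 := by ring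
  rw [e2]
  refine (abs_add_le _ _).trans ?_
  have b1 : ‖2 * a + ‖h‖ ^ 2‖ ^ 2 ≤ N * ‖h‖ ^ 2 := by
    rw [hN, ← mul_pow]
    gcongr
    rw [Real.norm_eq_abs]
    refine (abs_add_le _ _).trans ?_
    rw [abs_mul, abs_two, abs_of_nonneg (sq_nonneg ‖h‖)]
    nlinarith [norm_nonneg h]
  have b2 : |g2 / 2 * (4 * a + ‖h‖ ^ 2) * ‖h‖ ^ 2| ≤ η / 2 * ‖h‖ ^ 2 := by
    rw [abs_mul, abs_mul, abs_of_nonneg (sq_nonneg ‖h‖), abs_div, abs_two]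
    gcongr
    refine le_trans ?_ k2
    gcongr
    refine (abs_add_le _ _).trans ?_
    rw [abs_mul, abs_of_nonneg (sq_nonneg ‖h‖), abs_of_pos (by norm_num : (0 : ℝ) < 4)]
    nlinarith
  have b3 : η / (2 * N) * ‖2 * a + ‖h‖ ^ 2‖ ^ 2 ≤ η / 2 * ‖h‖ ^ 2 := by
    calc η / (2 * N) * ‖2 * a + ‖h‖ ^ 2‖ ^ 2 ≤ η / (2 * N) * (N * ‖h‖ ^ 2) := by gcongr
      _ = η / 2 * ‖h‖ ^ 2 := by field_simp
  linarith [k1, b2, b3]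

end Jets

section Barriers
open Filter Topology Matrix

variable {n : ℕ}

theorem barrier_jet {m s α R V : ℝ} (hm : 1 < m) (hα0 : 0 < α) (hα1 : 2 / (s - 1) ≤ α)
    (hα2 : m / (s - m) ≤ α) (hsm : m < s) (hR : 0 < R) (hV : 0 < V) (x : En n) (hx : ‖x‖ < R) :
    ∃ (p : En n) (X : Matrix (Fin n) (Fin n) ℝ) (τ : ℝ),
      Jet2 (fun y => V * (1 - ‖y‖ ^ 2 / R ^ 2) ^ (-α)) x p X ∧ 0 ≤ τ ∧
      (∀ h, quad X h ≤ τ * ‖h‖ ^ 2) ∧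
      τ ≤ (2 * α + 4 * α * (α + 1)) * V / R ^ 2 * ((1 - ‖x‖ ^ 2 / R ^ 2) ^ (-α)) ^ s ∧
      ‖p‖ ≤ (2 * α + 4 * α * (α + 1)) * V / R * ((1 - ‖x‖ ^ 2 / R ^ 2) ^ (-α)) ^ s ∧
      ‖p‖ ^ m ≤ ((2 * α + 4 * α * (α + 1)) * V / R) ^ m * ((1 - ‖x‖ ^ 2 / R ^ 2) ^ (-α)) ^ s := by
  have hR2 : 0 < R ^ 2 := by positivity
  have hxR : ‖x‖ ^ 2 < R ^ 2 := by gcongr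
  set θ := 1 - ‖x‖ ^ 2 / R ^ 2 with hθ
  have hθ0 : 0 < θ := by
    have : ‖x‖ ^ 2 / R ^ 2 < 1 := (div_lt_one hR2).2 hxR
    linarith
  have hθ1 : θ ≤ 1 := by
    have : 0 ≤ ‖x‖ ^ 2 / R ^ 2 := by positivity
    linarith
  set C := 2 * α + 4 * α * (α + 1) with hC
  have hC0 : 0 < C := by positivity
  -- exponents
  have hs1 : 0 < s - 1 := by linarith
  have hs2 : 0 < s - m := by linarith
  have e1 : α + 2 ≤ α * s := by
    rw [div_le_iff₀ hs1] at hα1; nlinarith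
  have e2 : (α + 1) * m ≤ α * s := by
    rw [div_le_iff₀ hs2] at hα2; nlinarith
  have hB : (θ ^ (-α)) ^ s = θ ^ (-(α * s)) := by
    rw [← rpow_mul hθ0.le]; ring_nf
  have mono : ∀ a, a ≤ α * s → θ ^ (-a) ≤ (θ ^ (-α)) ^ s := by
    intro a ha
    rw [hB]
    exact rpow_le_rpow_of_exponent_ge hθ0 hθ1 (by linarith)
  set g : ℝ → ℝ := fun t => V * (1 - t / R ^ 2) ^ (-α) with hg
  set g' : ℝ → ℝ := fun t => V * α / R ^ 2 * (1 - t / R ^ 2) ^ (-α - 1) with hg'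
  set g2 : ℝ := V * α * (α + 1) / R ^ 4 * θ ^ (-α - 2) with hg2
  have lin : ∀ t, HasDerivAt (fun t : ℝ => 1 - t / R ^ 2) (-(1 / R ^ 2)) t := fun t =>
    ((hasDerivAt_id t).div_const (R ^ 2)).const_sub 1
  have d1 : ∀ᶠ t in 𝓝 (‖x‖ ^ 2), HasDerivAt g (g' t) t := by
    filter_upwards [Iio_mem_nhds hxR] with t ht
    have ht : t < R ^ 2 := ht
    have h0 : 0 < 1 - t / R ^ 2 := by
      have : t / R ^ 2 < 1 := (div_lt_one hR2).2 ht
      linarith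
    have := ((lin t).rpow_const (p := -α) (Or.inl h0.ne')).const_mul V
    have e : g' t = V * (-(1 / R ^ 2) * -α * (1 - t / R ^ 2) ^ (-α - 1)) := by
      simp only [hg']; ring
    rw [e]; exact this
  have d2 : HasDerivAt g' g2 (‖x‖ ^ 2) := by
    have := ((lin (‖x‖ ^ 2)).rpow_const (p := -α - 1) (Or.inl hθ0.ne')).const_mul (V * α / R ^ 2)
    have e : g2 = V * α / R ^ 2 * (-(1 / R ^ 2) * (-α - 1) * (1 - ‖x‖ ^ 2 / R ^ 2) ^ (-α - 1 - 1)) := by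
      simp only [hg2, ← hθ]
      rw [show -α - 1 - 1 = -α - 2 by ring]
      field_simp
      ring
    rw [e]; exact this
  have hj := jet_radial g g' g2 x d1 d2
  have hg'x : g' (‖x‖ ^ 2) = V * α / R ^ 2 * θ ^ (-(α + 1)) := by
    simp only [hg', ← hθ]; rw [show -α - 1 = -(α + 1) by ring]
  have hg2x : g2 = V * α * (α + 1) / R ^ 4 * θ ^ (-(α + 2)) := by
    simp only [hg2]; rw [show -α - 2 = -(α + 2) by ring]
  have hp : ‖(2 * g' (‖x‖ ^ 2)) • x‖ ≤ C * V / R * θ ^ (-(α + 1)) := by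
    rw [norm_smul, hg'x, Real.norm_eq_abs, abs_of_nonneg (by positivity)]
    calc 2 * (V * α / R ^ 2 * θ ^ (-(α + 1))) * ‖x‖ ≤ 2 * (V * α / R ^ 2 * θ ^ (-(α + 1))) * R := by gcongr
      _ = (2 * α) * V / R * θ ^ (-(α + 1)) := by field_simp
      _ ≤ C * V / R * θ ^ (-(α + 1)) := by
        gcongr
        rw [hC]; nlinarith [mul_pos hα0 hα0]
  refine ⟨_, _, C * V / R ^ 2 * θ ^ (-(α + 2)), hj, by positivity, ?_, ?_, ?_, ?_⟩
  · intro h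
    rw [quad_add, quad_smul, quad_smul, quad_one, quad_vecMulVec, hg'x, hg2x]
    have hi : (inner ℝ x h) ^ 2 ≤ R ^ 2 * ‖h‖ ^ 2 := by
      rw [← mul_pow, ← sq_abs (inner ℝ x h)]
      have := abs_real_inner_le_norm x h
      gcongr
      exact this.trans (by gcongr)
    have hmn : θ ^ (-(α + 1)) ≤ θ ^ (-(α + 2)) :=
      rpow_le_rpow_of_exponent_ge hθ0 hθ1 (by linarith)
    calc 2 * (V * α / R ^ 2 * θ ^ (-(α + 1))) * ‖h‖ ^ 2 + 4 * (V * α * (α + 1) / R ^ 4 * θ ^ (-(α + 2))) * (inner ℝ x h) ^ 2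
        ≤ 2 * (V * α / R ^ 2 * θ ^ (-(α + 2))) * ‖h‖ ^ 2 + 4 * (V * α * (α + 1) / R ^ 4 * θ ^ (-(α + 2))) * (R ^ 2 * ‖h‖ ^ 2) := by gcongr
      _ = C * V / R ^ 2 * θ ^ (-(α + 2)) * ‖h‖ ^ 2 := by rw [hC]; field_simp
  · have := mono (α + 2) e1
    gcongr
  · refine hp.trans ?_
    have := mono (α + 1) (by linarith)
    gcongr
  · calc ‖(2 * g' (‖x‖ ^ 2)) • x‖ ^ m ≤ (C * V / R * θ ^ (-(α + 1))) ^ m := by gcongr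
      _ = (C * V / R) ^ m * θ ^ (-((α + 1) * m)) := by
        rw [mul_rpow (by positivity) (by positivity), ← rpow_mul hθ0.le]; ring_nf
      _ ≤ _ := by
        have := mono ((α + 1) * m) e2
        gcongr

theorem psi_jet {k : ℝ} (hk : 0 ≤ k) (L : ℝ) (hL : 0 ≤ L) (x : En n) :
    ∃ (p : En n) (X : Matrix (Fin n) (Fin n) ℝ) (τ : ℝ),
      Jet2 (fun y => L * (1 + ‖y‖ ^ 2) ^ k) x p X ∧ 0 ≤ τ ∧
      (∀ h, |quad X h| ≤ τ * ‖h‖ ^ 2) ∧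
      τ ≤ (2 * k + 4 * k * |k - 1|) * L * (1 + ‖x‖ ^ 2) ^ k ∧
      ‖p‖ ≤ (2 * k + 4 * k * |k - 1|) * L * (1 + ‖x‖ ^ 2) ^ k := by
  set T := 1 + ‖x‖ ^ 2 with hT
  have hT1 : 1 ≤ T := by have := sq_nonneg ‖x‖; linarith
  have hT0 : 0 < T := by linarith
  set g : ℝ → ℝ := fun t => L * (1 + t) ^ k with hg
  set g' : ℝ → ℝ := fun t => L * k * (1 + t) ^ (k - 1) with hg'
  set g2 : ℝ := L * k * (k - 1) * T ^ (k - 2) with hg2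
  have lin : ∀ t, HasDerivAt (fun t : ℝ => 1 + t) 1 t := fun t => (hasDerivAt_id t).const_add 1
  have d1 : ∀ᶠ t in 𝓝 (‖x‖ ^ 2), HasDerivAt g (g' t) t := by
    filter_upwards [Ioi_mem_nhds (show (-1 : ℝ) < ‖x‖ ^ 2 by have := sq_nonneg ‖x‖; linarith)] with t ht
    have ht : -1 < t := ht
    have h0 : 0 < 1 + t := by linarith
    have := ((lin t).rpow_const (p := k) (Or.inl h0.ne')).const_mul L
    have e : g' t = L * (1 * k * (1 + t) ^ (k - 1)) := by
      simp only [hg']; ring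
    rw [e]; exact this
  have d2 : HasDerivAt g' g2 (‖x‖ ^ 2) := by
    have := ((lin (‖x‖ ^ 2)).rpow_const (p := k - 1) (Or.inl hT0.ne')).const_mul (L * k)
    have e : g2 = L * k * (1 * (k - 1) * (1 + ‖x‖ ^ 2) ^ (k - 1 - 1)) := by
      simp only [hg2, ← hT]
      rw [show k - 1 - 1 = k - 2 by ring]
      ring
    rw [e]; exact this
  have hj := jet_radial g g' g2 x d1 d2
  have hg'x : g' (‖x‖ ^ 2) = L * k * T ^ (k - 1) := rfl
  have t1 : T ^ (k - 1) * T = T ^ k := by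
    conv_lhs => rw [← rpow_one T, ← rpow_mul hT0.le, ← rpow_add hT0]
    ring_nf
  have t2 : T ^ (k - 2) * T ≤ T ^ k := by
    have : T ^ (k - 2) * T = T ^ (k - 1) := by
      conv_lhs => rw [← rpow_one T, ← rpow_mul hT0.le, ← rpow_add hT0]
      ring_nf
    rw [this]
    exact rpow_le_rpow_of_exponent_le hT1 (by linarith)
  have t3 : T ^ (k - 1) ≤ T ^ k := rpow_le_rpow_of_exponent_le hT1 (by linarith)
  have hxT : ‖x‖ ≤ T := by nlinarith [sq_nonneg (‖x‖ - 1), norm_nonneg x]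
  have hx2T : ‖x‖ ^ 2 ≤ T := by linarith
  refine ⟨_, _, 2 * L * k * T ^ (k - 1) + 4 * L * k * |k - 1| * (T ^ (k - 2) * T), hj, by positivity, ?_, ?_, ?_⟩
  · intro h
    rw [quad_add, quad_smul, quad_smul, quad_one, quad_vecMulVec, hg'x]
    have hi : (inner ℝ x h) ^ 2 ≤ T * ‖h‖ ^ 2 := by
      refine le_trans ?_ (mul_le_mul_of_nonneg_right hx2T (by positivity))
      rw [← mul_pow, ← sq_abs (inner ℝ x h)]
      have := abs_real_inner_le_norm x h
      gcongr
    refine (abs_add_le _ _).trans ?_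
    have a1 : |2 * (L * k * T ^ (k - 1)) * ‖h‖ ^ 2| = 2 * L * k * T ^ (k - 1) * ‖h‖ ^ 2 := by
      rw [abs_of_nonneg (by positivity)]; ring
    have a2 : |4 * g2 * (inner ℝ x h) ^ 2| = 4 * L * k * |k - 1| * T ^ (k - 2) * (inner ℝ x h) ^ 2 := by
      rw [hg2]
      simp only [abs_mul, abs_of_nonneg hL, abs_of_nonneg hk, abs_of_nonneg (sq_nonneg (inner ℝ x h)),
        abs_of_nonneg (rpow_nonneg hT0.le (k - 2)), abs_of_pos (by norm_num : (0 : ℝ) < 4)]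
      ring
    rw [a1, a2]
    have : 4 * L * k * |k - 1| * T ^ (k - 2) * (inner ℝ x h) ^ 2 ≤ 4 * L * k * |k - 1| * T ^ (k - 2) * (T * ‖h‖ ^ 2) := by gcongr
    linarith
  · calc 2 * L * k * T ^ (k - 1) + 4 * L * k * |k - 1| * (T ^ (k - 2) * T) ≤
        2 * L * k * T ^ k + 4 * L * k * |k - 1| * T ^ k := by gcongr
      _ = _ := by ring
  · rw [norm_smul, hg'x, Real.norm_eq_abs, abs_of_nonneg (by positivity)]
    calc 2 * (L * k * T ^ (k - 1)) * ‖x‖ ≤ 2 * (L * k * T ^ (k - 1)) * T := by gcongr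
      _ = 2 * k * L * T ^ k := by rw [← t1]; ring
      _ ≤ _ := by
        gcongr
        have : 0 ≤ 4 * k * |k - 1| := by positivity
        linarith

end Barriers

section KO
open Filter Topology Matrix

variable {n : ℕ}

theorem barrier_large {α V : ℝ} (hα : 0 < α) (hV : 0 < V) (M : ℝ) :
    ∃ θ₀ > (0 : ℝ), ∀ θ, 0 < θ → θ < θ₀ → M ≤ V * θ ^ (-α) := by
  set K := max (M / V) 1 with hK
  have hK0 : 0 < K := lt_of_lt_of_le one_pos (le_max_right _ _)
  refine ⟨K ^ (-(1 / α)), by positivity, fun θ h0 h1 => ?_⟩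
  have h2 : K ≤ θ ^ (-α) := by
    have e : K = (K ^ (-(1 / α))) ^ (-α) := by
      rw [← rpow_mul hK0.le, show -(1 / α) * -α = 1 by field_simp, rpow_one]
    rw [e]
    exact rpow_le_rpow_of_nonpos h0 h1.le (by linarith)
  have h3 : M / V ≤ θ ^ (-α) := (le_max_left _ _).trans h2
  rw [div_le_iff₀ hV] at h3
  linarith

theorem theta_pos {R : ℝ} (hR : 0 < R) {x : En n} (hx : ‖x‖ < R) : 0 < 1 - ‖x‖ ^ 2 / R ^ 2 := by
  have : ‖x‖ ^ 2 / R ^ 2 < 1 := (div_lt_one (by positivity)).2 (by gcongr)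
  linarith

theorem theta_le {R : ℝ} (x : En n) : 1 - ‖x‖ ^ 2 / R ^ 2 ≤ 1 := by
  have : 0 ≤ ‖x‖ ^ 2 / R ^ 2 := by positivity
  linarith

theorem one_le_barrier {R α : ℝ} (hα : 0 < α) (hR : 0 < R) {x : En n} (hx : ‖x‖ < R) :
    1 ≤ (1 - ‖x‖ ^ 2 / R ^ 2) ^ (-α) :=
  one_le_rpow_of_pos_of_le_one_of_nonpos (theta_pos hR hx) (theta_le x) (by linarith)

/-- cutting off by a blow-up barrier keeps upper semicontinuity -/
theorem usc_cut {z : En n → ℝ} (hz : UpperSemicontinuous z) {α V R : ℝ} (hα : 0 < α) (hV : 0 < V)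
    (hR : 0 < R) (L : ℝ) :
    UpperSemicontinuous (fun x => if ‖x‖ < R then max (z x - V * (1 - ‖x‖ ^ 2 / R ^ 2) ^ (-α)) L else L) := by
  intro x c hc
  beta_reduce at hc
  have cont : Continuous (fun y : En n => 1 - ‖y‖ ^ 2 / R ^ 2) := by fun_prop
  by_cases hx : ‖x‖ < R
  · rw [if_pos hx] at hc
    obtain ⟨hc1, hc2⟩ := max_lt_iff.1 hc
    have hθ := theta_pos hR hx
    have cb : ContinuousAt (fun y : En n => V * (1 - ‖y‖ ^ 2 / R ^ 2) ^ (-α)) x :=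
      continuousAt_const.mul (cont.continuousAt.rpow_const (Or.inl hθ.ne'))
    set d := c - (z x - V * (1 - ‖x‖ ^ 2 / R ^ 2) ^ (-α)) with hd
    have hd0 : 0 < d := by linarith
    have h1 := hz x (z x + d / 2) (by linarith)
    have h2 := cb.eventually (Ioi_mem_nhds (show V * (1 - ‖x‖ ^ 2 / R ^ 2) ^ (-α) - d / 2 < _ by linarith))
    have h3 : ∀ᶠ y in 𝓝 x, ‖y‖ < R := continuous_norm.continuousAt.eventually (Iio_mem_nhds hx)
    filter_upwards [h1, h2, h3] with y k1 k2 k3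
    have k2 : V * (1 - ‖x‖ ^ 2 / R ^ 2) ^ (-α) - d / 2 < V * (1 - ‖y‖ ^ 2 / R ^ 2) ^ (-α) := k2
    rw [if_pos k3]
    exact max_lt (by linarith) hc2
  · rw [if_neg hx] at hc
    obtain ⟨θ₀, hθ₀, hb⟩ := barrier_large hα hV (z x + 1 - L)
    have hx' : R ≤ ‖x‖ := not_lt.1 hx
    have hθx : 1 - ‖x‖ ^ 2 / R ^ 2 < θ₀ := by
      have : 1 ≤ ‖x‖ ^ 2 / R ^ 2 := (one_le_div (by positivity)).2 (by gcongr)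
      linarith
    filter_upwards [hz x (z x + 1) (by linarith), cont.continuousAt.eventually (Iio_mem_nhds hθx)] with y k1 k2
    have k2 : 1 - ‖y‖ ^ 2 / R ^ 2 < θ₀ := k2
    split_ifs with hy
    · have := hb _ (theta_pos hR hy) k2
      exact max_lt (by linarith) hc
    · exact hc

theorem exists_large {m s : ℝ} (hm : 1 < m) (hsm : m < s) {a b c : ℝ} (ha : 0 ≤ a) (hb : 0 ≤ b) (hc : 0 ≤ c) :
    ∃ L : ℝ, 1 ≤ L ∧ a + b * L + c * L ^ m ≤ L ^ s := by
  have h0 : 0 < s - m := by linarith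
  set K := a + b + c + 1 with hK
  have hK1 : 1 ≤ K := by linarith
  set L := K ^ (1 / (s - m)) with hL
  have hL1 : 1 ≤ L := one_le_rpow hK1 (by positivity)
  have hL0 : 0 < L := by linarith
  refine ⟨L, hL1, ?_⟩
  have e1 : L ^ s = K * L ^ m := by
    have : L ^ (s - m) = K := by
      rw [hL, ← rpow_mul (by linarith), one_div, inv_mul_cancel₀ h0.ne', rpow_one]
    rw [← this, ← rpow_add hL0]; ring_nf
  have e2 : L ≤ L ^ m := by
    conv_lhs => rw [← rpow_one L]
    exact rpow_le_rpow_of_exponent_le hL1 hm.le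
  have e3 : 1 ≤ L ^ m := one_le_rpow hL1 (by linarith)
  rw [e1, hK]
  have : b * L ≤ b * L ^ m := by gcongr
  have : a * 1 ≤ a * L ^ m := by gcongr
  linarith

theorem add_rpow_le_two {m a b : ℝ} (hm : 0 ≤ m) (ha : 0 ≤ a) (hb : 0 ≤ b) :
    (a + b) ^ m ≤ 2 ^ m * (a ^ m + b ^ m) := by
  have key : ∀ c d : ℝ, 0 ≤ c → 0 ≤ d → c ≤ d → (c + d) ^ m ≤ 2 ^ m * (c ^ m + d ^ m) := by
    intro c d hc hd hcd
    calc (c + d) ^ m ≤ (2 * d) ^ m := by gcongr; linarith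
      _ = 2 ^ m * d ^ m := mul_rpow (by norm_num) hd
      _ ≤ _ := by
        gcongr
        have := rpow_nonneg hc m
        linarith
  rcases le_total a b with h | h
  · exact key a b ha hb h
  · rw [add_comm a, add_comm (a ^ m)]; exact key b a hb ha h

theorem keller_osserman {m s C1 C2 C3 G k α : ℝ} (hm : 1 < m) (hsm : m < s) (hC1 : 0 ≤ C1)
    (hC2 : 0 ≤ C2) (hC3 : 0 ≤ C3) (hG : 0 ≤ G) (hk : 0 ≤ k) (hα0 : 0 < α) (hα1 : 2 / (s - 1) ≤ α)
    (hα2 : m / (s - m) ≤ α) :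
    ∃ L V : ℝ, 1 ≤ L ∧ 1 ≤ V ∧ ∀ R : ℝ, 1 ≤ R → ∀ z : En n → ℝ, UpperSemicontinuous z →
      (∀ x p X τ, ‖x‖ < R → JetUp z x p X → 0 ≤ τ → (∀ h, quad X h ≤ τ * ‖h‖ ^ 2) → 0 < z x →
        z x ^ s ≤ G * ((1 + ‖x‖ ^ 2) ^ k) ^ s + C1 * τ + C2 * ‖p‖ + C3 * ‖p‖ ^ m) →
      ∀ x, ‖x‖ < R → z x ≤ L * (1 + ‖x‖ ^ 2) ^ k + V * (1 - ‖x‖ ^ 2 / R ^ 2) ^ (-α) := by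
  set Cp := 2 * k + 4 * k * |k - 1| with hCp
  have hCp0 : 0 ≤ Cp := by positivity
  set Cb := 2 * α + 4 * α * (α + 1) with hCb
  have hCb0 : 0 ≤ Cb := by positivity
  obtain ⟨L, hL1, hL⟩ := exists_large hm hsm hG (b := (C1 + C2) * Cp) (c := C3 * 2 ^ m * Cp ^ m)
    (by positivity) (by positivity)
  obtain ⟨V, hV1, hV⟩ := exists_large hm hsm le_rfl (b := (C1 + C2) * Cb) (c := C3 * 2 ^ m * Cb ^ m)
    (by positivity) (by positivity)
  refine ⟨L, V, hL1, hV1, fun R hR z hz hjet x₁ hx₁ => ?_⟩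
  have hR0 : 0 < R := by linarith
  have hL0 : 0 < L := by linarith
  have hV0 : 0 < V := by linarith
  by_contra hcon
  push Not at hcon
  set Ψ : En n → ℝ := fun y => L * (1 + ‖y‖ ^ 2) ^ k with hΨ
  set b : En n → ℝ := fun y => V * (1 - ‖y‖ ^ 2 / R ^ 2) ^ (-α) with hb
  have hΨc : Continuous Ψ := by
    refine continuous_const.mul (Continuous.rpow_const (by fun_prop) fun x => Or.inr hk)
  have hzΨ : UpperSemicontinuous (fun y => z y - Ψ y) := by
    have := hz.add (hΨc.neg.upperSemicontinuous)
    simpa [sub_eq_add_neg] using this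
  have hcut := usc_cut hzΨ hα0 hV0 hR0 0
  obtain ⟨x₀, -, hmax⟩ := UpperSemicontinuousOn.exists_isMaxOn (s := Metric.closedBall (0 : En n) R)
    ⟨x₁, by simpa using hx₁.le⟩ (isCompact_closedBall _ _) (hcut.upperSemicontinuousOn _)
  have hm1 := hmax (show x₁ ∈ Metric.closedBall (0 : En n) R by simpa using hx₁.le)
  simp only [Set.mem_ofPred_eq, if_pos hx₁] at hm1
  have hpos : 0 < z x₁ - Ψ x₁ - b x₁ := by simp only [hΨ, hb]; linarith
  have hx₀ : ‖x₀‖ < R := by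
    by_contra h
    rw [if_neg h] at hm1
    exact absurd (lt_of_lt_of_le hpos ((le_max_left _ _).trans hm1)) (lt_irrefl _)
  rw [if_pos hx₀] at hm1
  have hw0 : 0 < z x₀ - Ψ x₀ - b x₀ := by
    by_contra h
    rw [max_eq_right (not_lt.1 h)] at hm1
    exact absurd (lt_of_lt_of_le hpos ((le_max_left _ _).trans hm1)) (lt_irrefl _)
  have hloc : ∀ᶠ y in 𝓝 x₀, z y - (Ψ y + b y) ≤ z x₀ - (Ψ x₀ + b x₀) := by
    have h3 : ∀ᶠ y in 𝓝 x₀, ‖y‖ < R := continuous_norm.continuousAt.eventually (Iio_mem_nhds hx₀)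
    filter_upwards [h3] with y hy
    have h4 := hmax (show y ∈ Metric.closedBall (0 : En n) R by simpa using hy.le)
    simp only [Set.mem_ofPred_eq, if_pos hy, if_pos hx₀] at h4
    have h5 : max (z x₀ - Ψ x₀ - V * (1 - ‖x₀‖ ^ 2 / R ^ 2) ^ (-α)) 0 = z x₀ - Ψ x₀ - b x₀ :=
      max_eq_left hw0.le
    rw [h5] at h4
    have h6 : z y - Ψ y - b y ≤ _ := (le_max_left _ _).trans h4
    linarith
  obtain ⟨p1, X1, τ1, j1, ht1, hq1, hτ1, hp1⟩ := psi_jet hk L hL0.le x₀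
  obtain ⟨p2, X2, τ2, j2, ht2, hq2, hτ2, hp2, hp2m⟩ := barrier_jet hm hα0 hα1 hα2 hsm hR0 hV0 x₀ hx₀
  have hJ := jetUp_of_max (j1.add j2) hloc
  have hT1 : 1 ≤ (1 + ‖x₀‖ ^ 2) ^ k := one_le_rpow (by have := sq_nonneg ‖x₀‖; linarith) hk
  have hB1 : 1 ≤ (1 - ‖x₀‖ ^ 2 / R ^ 2) ^ (-α) := one_le_barrier hα0 hR0 hx₀
  have hwz : L * (1 + ‖x₀‖ ^ 2) ^ k + V * (1 - ‖x₀‖ ^ 2 / R ^ 2) ^ (-α) < z x₀ := by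
    have : 0 < z x₀ - L * (1 + ‖x₀‖ ^ 2) ^ k - V * (1 - ‖x₀‖ ^ 2 / R ^ 2) ^ (-α) := hw0
    linarith
  have hzpos : 0 < z x₀ := lt_trans (by positivity) hwz
  have hmain := hjet x₀ _ _ (τ1 + τ2) hx₀ hJ (by positivity) (by
    intro h
    rw [quad_add]
    have := (abs_le.1 (hq1 h)).2
    have := hq2 h
    linarith) hzpos
  generalize (1 + ‖x₀‖ ^ 2) ^ k = T at *
  generalize (1 - ‖x₀‖ ^ 2 / R ^ 2) ^ (-α) = B at *
  have hT0 : 0 < T := by linarith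
  have hB0 : 0 < B := by linarith
  have hTs : T ≤ T ^ s := by
    conv_lhs => rw [← rpow_one T]
    exact rpow_le_rpow_of_exponent_le hT1 (by linarith)
  have hTm : T ^ m ≤ T ^ s := rpow_le_rpow_of_exponent_le hT1 hsm.le
  have big : L ^ s * T ^ s + V ^ s * B ^ s < z x₀ ^ s := by
    calc L ^ s * T ^ s + V ^ s * B ^ s = (L * T) ^ s + (V * B) ^ s := by
          rw [mul_rpow hL0.le hT0.le, mul_rpow hV0.le hB0.le]
      _ ≤ (L * T + V * B) ^ s := add_rpow_le_rpow_add (by positivity) (by positivity) (by linarith)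
      _ < z x₀ ^ s := rpow_lt_rpow (by positivity) hwz (by linarith)
  have hBs : 0 < B ^ s := by positivity
  have hTs0 : 0 < T ^ s := by positivity
  have q1 : τ1 ≤ Cp * L * T ^ s := hτ1.trans (by gcongr)
  have q2 : τ2 ≤ Cb * V * B ^ s := hτ2.trans (by
    gcongr; exact div_le_self (by positivity) (one_le_pow₀ hR))
  have q3 : ‖p1‖ ≤ Cp * L * T ^ s := hp1.trans (by gcongr)
  have q4 : ‖p2‖ ≤ Cb * V * B ^ s := hp2.trans (by
    gcongr; exact div_le_self (by positivity) hR)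
  have q5 : ‖p1‖ ^ m ≤ Cp ^ m * L ^ m * T ^ s := by
    calc ‖p1‖ ^ m ≤ (Cp * L * T) ^ m := by gcongr
      _ = Cp ^ m * L ^ m * T ^ m := by
        rw [mul_rpow (by positivity) hT0.le, mul_rpow hCp0 hL0.le]
      _ ≤ _ := by gcongr
  have q6 : ‖p2‖ ^ m ≤ Cb ^ m * V ^ m * B ^ s := by
    calc ‖p2‖ ^ m ≤ (Cb * V / R) ^ m * B ^ s := hp2m
      _ ≤ (Cb * V) ^ m * B ^ s := by
        gcongr; exact div_le_self (by positivity) hR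
      _ = _ := by rw [mul_rpow hCb0 hV0.le]
  have q7 : ‖p1 + p2‖ ≤ ‖p1‖ + ‖p2‖ := norm_add_le _ _
  have q8 : ‖p1 + p2‖ ^ m ≤ 2 ^ m * (‖p1‖ ^ m + ‖p2‖ ^ m) :=
    (rpow_le_rpow (norm_nonneg _) q7 (by linarith)).trans
      (add_rpow_le_two (by linarith) (norm_nonneg _) (norm_nonneg _))
  have r1 : C1 * (τ1 + τ2) ≤ C1 * (Cp * L * T ^ s + Cb * V * B ^ s) := by gcongr
  have r2 : C2 * ‖p1 + p2‖ ≤ C2 * (Cp * L * T ^ s + Cb * V * B ^ s) := by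
    gcongr; exact q7.trans (by linarith)
  have r3 : C3 * ‖p1 + p2‖ ^ m ≤ C3 * (2 ^ m * (Cp ^ m * L ^ m * T ^ s + Cb ^ m * V ^ m * B ^ s)) := by
    gcongr; exact q8.trans (by gcongr)
  have f1 : (G + (C1 + C2) * Cp * L + C3 * 2 ^ m * Cp ^ m * L ^ m) * T ^ s ≤ L ^ s * T ^ s := by gcongr
  have f2 : (0 + (C1 + C2) * Cb * V + C3 * 2 ^ m * Cb ^ m * V ^ m) * B ^ s ≤ V ^ s * B ^ s := by gcongr
  linarith

end KO

section Setup
open Filter Topology Matrix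

variable {n : ℕ}

/-- The bundled hypotheses of the main theorem, in the form used below. -/
structure Hyps (n : ℕ) (lam Lam m s ρ γ₁ γm cbar A σ₀ : ℝ) (ω : ℝ → ℝ)
    (F : En n → Matrix (Fin n) (Fin n) ℝ → ℝ) (H : En n → En n → ℝ) (f : En n → ℝ) : Prop where
  ell : EllF lam Lam F
  m1 : 1 < m
  m2 : m ≤ 2
  sm : m < s
  F0 : ∀ x, F x 0 = 0
  Fcont : ∀ X : Matrix (Fin n) (Fin n) ℝ, X.IsSymm → Continuous fun x => F x X
  Fstruct : ∀ R > (0 : ℝ), ∃ ωR : ℝ → ℝ, IsModulus ωR ∧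
      ∀ ε > (0 : ℝ), ∀ (x y : En n) (X Y : Matrix (Fin n) (Fin n) ℝ),
        ‖x‖ < R → ‖y‖ < R → X.IsSymm → Y.IsSymm →
        (Matrix.fromBlocks X 0 0 (-Y) +
          (3 / ε) • (1 : Matrix (Fin n ⊕ Fin n) (Fin n ⊕ Fin n) ℝ)).PosSemidef →
        ((3 / ε) • Matrix.fromBlocks (1 : Matrix (Fin n) (Fin n) ℝ) (-1) (-1) 1 -
          Matrix.fromBlocks X 0 0 (-Y)).PosSemidef →
        F x X - F y Y ≤ ωR (‖x - y‖ + ε⁻¹ * ‖x - y‖ ^ 2)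
  Fhom : ∀ σ ∈ Set.Ioo (0 : ℝ) 1, ∀ (x : En n) (X : Matrix (Fin n) (Fin n) ℝ),
      F x (σ • X) = σ * F x X
  H0 : ∀ x, H x 0 = 0
  g1 : 0 < γ₁
  gm : 0 < γm
  mod : IsModulus ω
  Hstruct : ∀ x y p q : En n,
      |H x (p + q) - H y p| ≤ ω ‖x - y‖ * (‖p‖ ^ m + 1) +
        (γ₁ + γm * (‖p‖ ^ (m - 1) + ‖q‖ ^ (m - 1))) * ‖q‖
  cb : 0 < cbar
  A0 : 0 < A
  s0 : σ₀ ∈ Set.Ioo (0 : ℝ) 1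
  Hconv : ∀ (x p : En n), ∀ σ ∈ Set.Ioo σ₀ 1,
      -H x p + σ * H x (σ⁻¹ • p) ≤ (1 - σ) * (-cbar * ‖p‖ ^ m + A)
  fc : Continuous f
  rho0 : 0 ≤ ρ
  rho1 : ρ < m / (m - 1)
  fgrow : ∃ G : ℝ, 0 ≤ G ∧ ∀ x, f x ≤ G * (1 + ‖x‖ ^ 2) ^ (ρ / 2)

namespace Hyps

variable {lam Lam m s ρ γ₁ γm cbar A σ₀ : ℝ} {ω : ℝ → ℝ}
    {F : En n → Matrix (Fin n) (Fin n) ℝ → ℝ} {H : En n → En n → ℝ} {f : En n → ℝ}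

theorem Hbound (h : Hyps n lam Lam m s ρ γ₁ γm cbar A σ₀ ω F H f) (x p : En n) :
    |H x p| ≤ γ₁ * ‖p‖ + γm * ‖p‖ ^ m := by
  have h1 := h.Hstruct x x 0 p
  have hm := h.m1
  rw [zero_add, h.H0, sub_zero, sub_self, norm_zero, h.mod.2.2.1, zero_mul, zero_add,
    zero_rpow (by linarith : m - 1 ≠ 0), zero_add] at h1
  refine h1.trans (le_of_eq ?_)
  rcases eq_or_lt_of_le (norm_nonneg p) with h0 | h0
  · rw [← h0, zero_rpow (by linarith : m ≠ 0)]; ring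
  · have : ‖p‖ ^ m = ‖p‖ ^ (m - 1) * ‖p‖ := by
      conv_rhs => rw [← rpow_one ‖p‖, ← rpow_mul h0.le, ← rpow_add h0]
      ring_nf
    rw [this]; ring

theorem Lam0 (h : Hyps n lam Lam m s ρ γ₁ γm cbar A σ₀ ω F H f) : 0 < Lam :=
  lt_of_lt_of_le h.ell.hlam h.ell.hle

theorem Fupper (h : Hyps n lam Lam m s ρ γ₁ γm cbar A σ₀ ω F H f) (x : En n)
    {X : Matrix (Fin n) (Fin n) ℝ} (hX : X.IsSymm) {τ : ℝ} (hτ : 0 ≤ τ)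
    (hq : ∀ v, quad X v ≤ τ * ‖v‖ ^ 2) : F x X ≤ Lam * n * τ := by
  have := h.ell.le_add x (X := 0) (by simp [Matrix.IsSymm]) hX τ hτ (fun v => by
    rw [quad_zero]; linarith [hq v])
  rw [h.F0] at this; linarith

theorem Flower (h : Hyps n lam Lam m s ρ γ₁ γm cbar A σ₀ ω F H f) (x : En n)
    {X : Matrix (Fin n) (Fin n) ℝ} (hX : X.IsSymm) {τ : ℝ} (hτ : 0 ≤ τ)
    (hq : ∀ v, - quad X v ≤ τ * ‖v‖ ^ 2) : -(Lam * n * τ) ≤ F x X := by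
  have := h.ell.le_add x (Y := 0) hX (by simp [Matrix.IsSymm]) τ hτ (fun v => by
    rw [quad_zero]; linarith [hq v])
  rw [h.F0] at this; linarith

theorem pow_pos_eq {s a : ℝ} (ha : 0 < a) : |a| ^ (s - 1) * a = a ^ s := by
  rw [abs_of_pos ha]
  conv_lhs => rw [← rpow_one a, ← rpow_mul ha.le, ← rpow_add ha]
  ring_nf

theorem sub_ko (h : Hyps n lam Lam m s ρ γ₁ γm cbar A σ₀ ω F H f) {u : En n → ℝ} (hu : SubJ F H s f u)
    (x p : En n) (X : Matrix (Fin n) (Fin n) ℝ) (τ : ℝ) (hj : JetUp u x p X) (hτ : 0 ≤ τ)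
    (hq : ∀ v, quad X v ≤ τ * ‖v‖ ^ 2) (hpos : 0 < u x) :
    u x ^ s ≤ - f x + Lam * n * τ + γ₁ * ‖p‖ + γm * ‖p‖ ^ m := by
  have h1 := hu x p X hj
  rw [pow_pos_eq hpos] at h1
  have h2 := h.Fupper x hj.1 hτ hq
  have h3 := (abs_le.1 (h.Hbound x p)).2
  linarith

theorem super_ko (h : Hyps n lam Lam m s ρ γ₁ γm cbar A σ₀ ω F H f) {w : En n → ℝ}
    (hu : SubJ (dualF F) (dualH H) s (-f) w)
    (x p : En n) (X : Matrix (Fin n) (Fin n) ℝ) (τ : ℝ) (hj : JetUp w x p X) (hτ : 0 ≤ τ)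
    (hq : ∀ v, quad X v ≤ τ * ‖v‖ ^ 2) (hpos : 0 < w x) :
    w x ^ s ≤ f x + Lam * n * τ + γ₁ * ‖p‖ + γm * ‖p‖ ^ m := by
  have h1 := hu x p X hj
  rw [pow_pos_eq hpos] at h1
  simp only [dualF, dualH, Pi.neg_apply] at h1
  have h2 := h.Flower x hj.1.neg hτ (fun v => by rw [quad_neg]; linarith [hq v])
  have h3 := (abs_le.1 (h.Hbound x (-p))).1
  rw [norm_neg] at h3
  linarith

/-- the barrier exponent -/
def al (m s : ℝ) : ℝ := max (2 / (s - 1)) (m / (s - m))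

theorem al_pos (h : Hyps n lam Lam m s ρ γ₁ γm cbar A σ₀ ω F H f) : 0 < al m s := by
  have := h.m1
  have := h.sm
  exact lt_max_of_lt_left (div_pos two_pos (by linarith))

theorem local_bound (h : Hyps n lam Lam m s ρ γ₁ γm cbar A σ₀ ω F H f) (R : ℝ) :
    ∃ M : ℝ, ∀ u : En n → ℝ, UpperSemicontinuous u → SubJ F H s f u → ∀ x, ‖x‖ ≤ R → u x ≤ M := by
  obtain ⟨G, hG⟩ := (isCompact_closedBall (0 : En n) (2 * |R| + 1)).exists_bound_of_continuousOn h.fc.continuousOn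
  have hα := h.al_pos
  have hG0 : 0 ≤ G := (norm_nonneg _).trans (hG 0 (by simp; positivity))
  have := h.Lam0
  obtain ⟨L, V, hL, hV, hko⟩ := keller_osserman (n := n) h.m1 h.sm (C1 := Lam * n) (by positivity) h.g1.le h.gm.le
    hG0 le_rfl h.al_pos (le_max_left _ _) (le_max_right _ _)
  refine ⟨L + V * (1 / 2) ^ (-al m s), fun u hu hs x hx => ?_⟩
  have hR1 : 1 ≤ 2 * |R| + 1 := by linarith [abs_nonneg R]
  have hxR : ‖x‖ ≤ |R| := hx.trans (le_abs_self R)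
  have k := hko (2 * |R| + 1) hR1 u hu (by
    intro y p X τ hy hj hτ hq hpos
    have k1 := h.sub_ko hs y p X τ hj hτ hq hpos
    have k2 := (abs_le.1 (hG y (by simpa using hy.le))).1
    rw [rpow_zero, one_rpow]
    linarith) x (by linarith [abs_nonneg R])
  rw [rpow_zero, mul_one] at k
  have h3 : ‖x‖ ^ 2 / (2 * |R| + 1) ^ 2 ≤ 1 / 2 := by
    rw [div_le_iff₀ (by positivity)]
    nlinarith [norm_nonneg x, abs_nonneg R]
  have hb : (1 - ‖x‖ ^ 2 / (2 * |R| + 1) ^ 2) ^ (-al m s) ≤ (1 / 2) ^ (-al m s) :=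
    rpow_le_rpow_of_nonpos (by norm_num) (by linarith) (by linarith)
  have h4 := mul_le_mul_of_nonneg_left hb (by linarith : 0 ≤ V)
  linarith

theorem super_growth (h : Hyps n lam Lam m s ρ γ₁ γm cbar A σ₀ ω F H f) :
    ∃ L : ℝ, 0 ≤ L ∧ ∀ w : En n → ℝ, UpperSemicontinuous w → SubJ (dualF F) (dualH H) s (-f) w →
      ∀ x, w x ≤ L * (1 + ‖x‖ ^ 2) ^ (ρ / (2 * s)) := by
  obtain ⟨G, hG0, hG⟩ := h.fgrow
  have hα := h.al_pos
  have hm := h.m1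
  have hsm := h.sm
  have hρ := h.rho0
  have hs0 : 0 < s := by linarith
  have := h.Lam0
  obtain ⟨L, V, hL, hV, hko⟩ := keller_osserman (n := n) h.m1 h.sm (C1 := Lam * n) (by positivity) h.g1.le h.gm.le
    hG0 (k := ρ / (2 * s)) (by positivity) h.al_pos (le_max_left _ _) (le_max_right _ _)
  refine ⟨L + V * (1 / 2) ^ (-al m s), by positivity, fun w hw hs x => ?_⟩
  have k := hko (2 * ‖x‖ + 1) (by linarith [norm_nonneg x]) w hw (by
    intro y p X τ hy hj hτ hq hpos
    have k1 := h.super_ko hs y p X τ hj hτ hq hpos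
    have k2 := hG y
    rw [← rpow_mul (by positivity), show ρ / (2 * s) * s = ρ / 2 by field_simp]
    linarith) x (by linarith [norm_nonneg x])
  have hT1 : 1 ≤ (1 + ‖x‖ ^ 2) ^ (ρ / (2 * s)) :=
    one_le_rpow (by have := sq_nonneg ‖x‖; linarith) (by positivity)
  have hb : (1 - ‖x‖ ^ 2 / (2 * ‖x‖ + 1) ^ 2) ^ (-al m s) ≤ (1 / 2) ^ (-al m s) := by
    refine rpow_le_rpow_of_nonpos (by norm_num) ?_ (by linarith)
    have : ‖x‖ ^ 2 / (2 * ‖x‖ + 1) ^ 2 ≤ 1 / 2 := by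
      rw [div_le_iff₀ (by positivity)]
      nlinarith [norm_nonneg x]
    linarith
  have h2 : 0 ≤ V * (1 / 2) ^ (-al m s) := by positivity
  have h3 := mul_le_mul_of_nonneg_left hb (by linarith : 0 ≤ V)
  have h4 := mul_le_mul_of_nonneg_left hT1 h2
  rw [add_mul]
  linarith

end Hyps
end Setup

section Numeric
open Filter Topology

theorem gg_nonneg_eq {s a : ℝ} (hs : 1 < s) (ha : 0 ≤ a) : |a| ^ (s - 1) * a = a ^ s := by
  rcases eq_or_lt_of_le ha with h | h
  · rw [← h, mul_zero, zero_rpow (by linarith)]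
  · exact Hyps.pow_pos_eq h

theorem gg_neg_eq {s a : ℝ} (hs : 1 < s) (ha : a ≤ 0) : |a| ^ (s - 1) * a = -(-a) ^ s := by
  have := gg_nonneg_eq hs (neg_nonneg.2 ha)
  rw [abs_neg] at this
  linarith

theorem gg_add {s a b W : ℝ} (hs : 1 < s) (hW : 0 ≤ W) (hab : W ≤ a + b) :
    (1 / 2) ^ s * W ^ s ≤ |a| ^ (s - 1) * a + |b| ^ (s - 1) * b := by
  wlog h : b ≤ a with H
  · have := H hs hW (by linarith : W ≤ b + a) (by linarith)
    linarith
  have ha : 0 ≤ a := by linarith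
  rw [gg_nonneg_eq hs ha]
  rcases le_total 0 b with hb | hb
  · rw [gg_nonneg_eq hs hb, ← mul_rpow (by norm_num) hW]
    have h1 : (1 / 2 * W) ^ s ≤ a ^ s := by gcongr; linarith
    have h2 : 0 ≤ b ^ s := by positivity
    linarith
  · rw [gg_neg_eq hs hb]
    have h1 : W ^ s + (-b) ^ s ≤ a ^ s := by
      refine (add_rpow_le_rpow_add hW (by linarith) hs.le).trans ?_
      exact rpow_le_rpow (by linarith) (by linarith) (by linarith)
    have h2 : (1 / 2 : ℝ) ^ s * W ^ s ≤ 1 * W ^ s := by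
      gcongr; exact rpow_le_one (by norm_num) (by norm_num) (by linarith)
    linarith

theorem sigma_pow {s μ : ℝ} (hs : 1 < s) (hμ : 0 < μ) (hμ2 : μ ≤ 1 / 2) :
    (1 - μ) ^ (1 - s) ≤ 1 + 2 * (s - 1) * exp (s - 1) * μ := by
  have h1 : 0 < 1 - μ := by linarith
  have h2 : (1 - μ)⁻¹ ≤ exp (2 * μ) := by
    have : (1 - μ)⁻¹ ≤ 2 * μ + 1 := by
      rw [inv_le_comm₀ h1 (by linarith)]
      rw [inv_le_iff_one_le_mul₀ (by linarith)]
      nlinarith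
    exact this.trans (add_one_le_exp _)
  have h3 : (1 - μ) ^ (1 - s) = ((1 - μ)⁻¹) ^ (s - 1) := by
    rw [inv_rpow h1.le, ← rpow_neg h1.le]; ring_nf
  rw [h3]
  have h4 : ((1 - μ)⁻¹) ^ (s - 1) ≤ exp (2 * μ * (s - 1)) := by
    rw [exp_mul]
    exact rpow_le_rpow (by positivity) h2 (by linarith)
  refine h4.trans ?_
  set y := 2 * μ * (s - 1) with hy
  have hy0 : 0 < y := by have : 0 < s - 1 := by linarith
                         positivity
  have h5 : exp y - 1 ≤ y * exp y := by
    have := add_one_le_exp (-y)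
    have h6 : exp y * (-y + 1) ≤ exp y * exp (-y) := by gcongr
    rw [← exp_add, add_neg_cancel, exp_zero] at h6
    linarith
  have h6 : exp y ≤ exp (s - 1) := by
    apply exp_le_exp.2
    rw [hy]
    nlinarith
  have h7 : y * exp y ≤ y * exp (s - 1) := by gcongr
  rw [hy] at h5 h7 ⊢
  linarith

theorem zero_order {s μ u b W Bd : ℝ} (hs : 1 < s) (hμ : 0 < μ) (hμ2 : μ ≤ 1 / 2) (hW : 0 ≤ W)
    (hab : W ≤ (1 - μ) * u + b) (hb : b ≤ Bd) (hBd : 0 ≤ Bd) :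
    (1 / 2) ^ s * W ^ s - 2 * (s - 1) * exp (s - 1) * μ * Bd ^ s ≤
      (1 - μ) * (|u| ^ (s - 1) * u) + |b| ^ (s - 1) * b := by
  have h1 : 0 < 1 - μ := by linarith
  have hC : 0 ≤ 2 * (s - 1) * exp (s - 1) := by
    have : 0 < s - 1 := by linarith
    positivity
  have hg := gg_add hs hW hab
  have hBs : 0 ≤ Bd ^ s := by positivity
  rcases le_total 0 u with hu | hu
  · rw [gg_nonneg_eq hs (by positivity : 0 ≤ (1 - μ) * u), mul_rpow h1.le hu] at hg
    rw [gg_nonneg_eq hs hu]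
    have h2 : (1 - μ) ^ s ≤ 1 - μ := by
      conv_rhs => rw [← rpow_one (1 - μ)]
      exact rpow_le_rpow_of_exponent_ge h1 (by linarith) hs.le
    have h3 : (1 - μ) ^ s * u ^ s ≤ (1 - μ) * u ^ s := by gcongr
    have h4 : 0 ≤ 2 * (s - 1) * exp (s - 1) * μ * Bd ^ s := by positivity
    linarith
  · have ha : (1 - μ) * u ≤ 0 := mul_nonpos_of_nonneg_of_nonpos h1.le hu
    rw [gg_neg_eq hs ha] at hg
    rw [gg_neg_eq hs hu]
    have e1 : -((1 - μ) * u) = (1 - μ) * (-u) := by ring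
    have hs3 := sigma_pow hs hμ hμ2
    have e2 : (1 - μ) * (-u) ^ s = (1 - μ) ^ (1 - s) * (-((1 - μ) * u)) ^ s := by
      rw [e1, mul_rpow h1.le (by linarith), ← mul_assoc, ← rpow_add h1]
      norm_num
    have h5 : (-((1 - μ) * u)) ^ s ≤ Bd ^ s := by
      gcongr
      · linarith
      · linarith
    have h6 : 0 ≤ (-((1 - μ) * u)) ^ s := rpow_nonneg (by linarith) _
    have h7 := mul_le_mul_of_nonneg_right hs3 h6
    have h8 : 2 * (s - 1) * exp (s - 1) * μ * (-((1 - μ) * u)) ^ s ≤ 2 * (s - 1) * exp (s - 1) * μ * Bd ^ s := by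
      gcongr
    have h9 : (1 - μ) * -(-u) ^ s = - ((1 - μ) * (-u) ^ s) := by ring
    rw [h9, e2]
    linarith

theorem young_split {m κ P q : ℝ} (hm : 1 < m) (hκ : 0 < κ) (hP : 0 ≤ P) (hq : 0 ≤ q) :
    P ^ (m - 1) * q ≤ κ * P ^ m + κ ^ (1 - m) * q ^ m := by
  have em : ∀ t : ℝ, 0 ≤ t → t ^ (m - 1) * t = t ^ m := by
    intro t ht
    rcases eq_or_lt_of_le ht with h | h
    · rw [← h, mul_zero, zero_rpow (by linarith)]
    · conv_lhs => rw [← rpow_one t, ← rpow_mul h.le, ← rpow_add h]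
      ring_nf
  have h1 : 0 ≤ κ * P ^ m := by positivity
  have h2 : 0 ≤ κ ^ (1 - m) * q ^ m := by positivity
  rcases le_total q (κ * P) with h | h
  · have : P ^ (m - 1) * q ≤ P ^ (m - 1) * (κ * P) := by gcongr
    have e : P ^ (m - 1) * (κ * P) = κ * P ^ m := by rw [← em P hP]; ring
    linarith
  · have hPq : P ≤ q / κ := by rw [le_div_iff₀ hκ]; linarith
    have h3 : P ^ (m - 1) ≤ (q / κ) ^ (m - 1) := by gcongr
    have h4 : (q / κ) ^ (m - 1) = κ ^ (1 - m) * q ^ (m - 1) := by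
      rw [div_rpow hq hκ.le, show 1 - m = -(m - 1) by ring, rpow_neg hκ.le]
      field_simp
    have h5 : P ^ (m - 1) * q ≤ κ ^ (1 - m) * q ^ (m - 1) * q := by
      rw [← h4]; gcongr
    have h6 : κ ^ (1 - m) * q ^ (m - 1) * q = κ ^ (1 - m) * q ^ m := by rw [mul_assoc, em q hq]
    linarith

end Numeric

section Cut
open Filter Topology
variable {n : ℕ}

theorem usc_closed_cut {w : En n → ℝ} (hw : UpperSemicontinuous w) (R L : ℝ) :
    UpperSemicontinuous (fun x => if ‖x‖ ≤ R then max (w x) L else L) := by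
  intro x c hc
  beta_reduce at hc
  by_cases hx : ‖x‖ ≤ R
  · rw [if_pos hx] at hc
    obtain ⟨h1, h2⟩ := max_lt_iff.1 hc
    filter_upwards [hw x c h1] with y hy
    split_ifs
    · exact max_lt hy h2
    · exact h2
  · rw [if_neg hx] at hc
    have : ∀ᶠ y in 𝓝 x, R < ‖y‖ := continuous_norm.continuousAt.eventually (Ioi_mem_nhds (not_le.1 hx))
    filter_upwards [this] with y hy
    rw [if_neg (not_le.2 hy)]
    exact hc

theorem usc_bdd {w : En n → ℝ} (hw : UpperSemicontinuous w) (R : ℝ) :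
    ∃ M, ∀ x, ‖x‖ ≤ R → w x ≤ M := by
  by_cases hne : (Metric.closedBall (0 : En n) R).Nonempty
  · obtain ⟨x₀, -, h⟩ := UpperSemicontinuousOn.exists_isMaxOn hne (isCompact_closedBall _ _)
      (hw.upperSemicontinuousOn _)
    exact ⟨w x₀, fun x hx => h (by simpa using hx)⟩
  · refine ⟨0, fun x hx => absurd ⟨x, by simpa using hx⟩ hne⟩

theorem IsModulus.small {ω : ℝ → ℝ} (h : IsModulus ω) {d : ℝ} (hd : 0 < d) :
    ∀ᶠ e in 𝓝[>] (0 : ℝ), ∀ t, 0 ≤ t → t ≤ e → ω t ≤ d := by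
  have h1 : Tendsto ω (𝓝[≥] 0) (𝓝 0) := by
    have := h.2.2.2
    rw [ContinuousWithinAt, h.2.2.1] at this
    exact this
  have h2 : ∀ᶠ e in 𝓝[>] (0 : ℝ), ω e < d :=
    (h1.mono_left (nhdsWithin_mono _ Set.Ioi_subset_Ici_self)).eventually (Iio_mem_nhds hd)
  filter_upwards [h2, self_mem_nhdsWithin] with e he he0 t ht hte
  exact (h.2.1 ht (Set.mem_Ici.2 (le_of_lt he0)) hte).trans he.le

end Cut

section Comparison
open Filter Topology Matrix
namespace Hyps

variable {n : ℕ} {lam Lam m s ρ γ₁ γm cbar A σ₀ : ℝ} {ω : ℝ → ℝ}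
    {F : En n → Matrix (Fin n) (Fin n) ℝ → ℝ} {H : En n → En n → ℝ} {f : En n → ℝ}

theorem comp_core (h : Hyps n lam Lam m s ρ γ₁ γm cbar A σ₀ ω F H f) {u w : En n → ℝ}
    (hsub : SubJ F H s f u) (hsup : SubJ (dualF F) (dualH H) s (-f) w)
    {μ : ℝ} (hμ : 0 < μ) (hμ1 : μ < 1) (hσ : σ₀ < 1 - μ)
    {z y P p₂ : En n} {X₁ Xb X₂ : Matrix (Fin n) (Fin n) ℝ} {τ η E1 E2 N : ℝ}
    (hX₁ : X₁.IsSymm) (hXb : Xb.IsSymm)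
    (hJ1 : JetUp u z ((1 - μ)⁻¹ • P) ((1 - μ)⁻¹ • (X₁ + Xb)))
    (hJ2 : JetUp w y p₂ X₂) (hτ : 0 ≤ τ) (hη : 0 ≤ η) (hq : ∀ v, quad Xb v ≤ τ * ‖v‖ ^ 2)
    (hFs : F z (X₁ - η • 1) - F y (-(X₂ - η • 1)) ≤ E1)
    (hw1 : ω ‖y - z‖ ≤ E2) (hw2 : ω ‖y - z‖ ≤ μ * cbar / 2) (hN : ‖P + p₂‖ ≤ N) :
    (1 - μ) * f z - f y + ((1 - μ) * (|u z| ^ (s - 1) * u z) + |w y| ^ (s - 1) * w y) ≤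
      E1 + 2 * (Lam * n * η) + Lam * n * τ + E2 + μ * A + γ₁ * N +
        (γm + γm * (μ * cbar / (2 * γm)) ^ (1 - m)) * N ^ m := by
  have hσ0 : 0 < 1 - μ := by linarith
  have hm := h.m1
  have hcb := h.cb
  have hg1 := h.g1
  have hgm := h.gm
  have hN0 : 0 ≤ N := (norm_nonneg _).trans hN
  have k1 := hsub z _ _ hJ1
  have k2 := hsup y _ _ hJ2
  simp only [dualF, dualH, Pi.neg_apply] at k2
  have k3 : F z (X₁ + Xb) = (1 - μ) * F z ((1 - μ)⁻¹ • (X₁ + Xb)) := by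
    rw [← h.Fhom (1 - μ) ⟨hσ0, by linarith⟩, smul_smul, mul_inv_cancel₀ hσ0.ne', one_smul]
  have k4 := h.Hconv z P (1 - μ) ⟨hσ, by linarith⟩
  have k5 : F z (X₁ + Xb) ≤ F z (X₁ - η • 1) + Lam * n * (η + τ) :=
    h.ell.le_add z (hX₁.sub (isSymm_smul_one η)) (hX₁.add hXb) (η + τ) (by linarith) (fun v => by
      rw [quad_add, quad_sub, quad_smul, quad_one]
      linarith [hq v])
  have k6 : F y (-(X₂ - η • 1)) ≤ F y (-X₂) + Lam * n * η :=
    h.ell.le_add y hJ2.1.neg ((hJ2.1.sub (isSymm_smul_one η)).neg) η hη (fun v => by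
      rw [quad_neg, quad_neg, quad_sub, quad_smul, quad_one]; linarith)
  have k7 := h.Hstruct y z P (-(P + p₂))
  rw [show P + -(P + p₂) = -p₂ by abel, norm_neg] at k7
  have k8 := (abs_le.1 k7).1
  set q := ‖P + p₂‖ with hqd
  have hq0 : 0 ≤ q := norm_nonneg _
  have hP0 : 0 ≤ ‖P‖ := norm_nonneg _
  have hPm : 0 ≤ ‖P‖ ^ m := by positivity
  have y1 := young_split (κ := μ * cbar / (2 * γm)) hm (by positivity) hP0 hq0
  have y2 : γm * (‖P‖ ^ (m - 1) * q) ≤ μ * cbar / 2 * ‖P‖ ^ m +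
      γm * (μ * cbar / (2 * γm)) ^ (1 - m) * q ^ m := by
    calc γm * (‖P‖ ^ (m - 1) * q) ≤ γm * (μ * cbar / (2 * γm) * ‖P‖ ^ m + (μ * cbar / (2 * γm)) ^ (1 - m) * q ^ m) := by gcongr
      _ = _ := by field_simp
  have y3 : q ^ (m - 1) * q = q ^ m := by
    rcases eq_or_lt_of_le hq0 with h0 | h0
    · rw [← h0, mul_zero, zero_rpow (by linarith)]
    · conv_lhs => rw [← rpow_one q, ← rpow_mul h0.le, ← rpow_add h0]
      ring_nf
  have y4 : ω ‖y - z‖ * ‖P‖ ^ m ≤ μ * cbar / 2 * ‖P‖ ^ m := by gcongr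
  have y5 : (γm + γm * (μ * cbar / (2 * γm)) ^ (1 - m)) * q ^ m ≤
      (γm + γm * (μ * cbar / (2 * γm)) ^ (1 - m)) * N ^ m := by gcongr
  have y6 : γ₁ * q ≤ γ₁ * N := by gcongr
  have k1' := mul_le_mul_of_nonneg_left k1 hσ0.le
  have y7 : (γ₁ + γm * (‖P‖ ^ (m - 1) + q ^ (m - 1))) * q =
    γ₁ * q + γm * (‖P‖ ^ (m - 1) * q) + γm * q ^ m := by rw [← y3]; ring
  rw [y7] at k8
  have e1 : (1 - μ) * (F z ((1 - μ)⁻¹ • (X₁ + Xb)) + H z ((1 - μ)⁻¹ • P) - |u z| ^ (s - 1) * u z) =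
    F z (X₁ + Xb) + (1 - μ) * H z ((1 - μ)⁻¹ • P) - (1 - μ) * (|u z| ^ (s - 1) * u z) := by
    rw [k3]; ring
  rw [e1] at k1'
  linarith

theorem comp_step (h : Hyps n lam Lam m s ρ γ₁ γm cbar A σ₀ ω F H f) {u w : En n → ℝ}
    (hu : UpperSemicontinuous u) (hw : UpperSemicontinuous w)
    (hsub : SubJ F H s f u) (hsup : SubJ (dualF F) (dualH H) s (-f) w)
    {δ R μ L₁ G : ℝ} (hδ : 0 < δ) (hR : 1 ≤ R) (hμ : 0 < μ) (hμ2 : μ ≤ 1 / 2) (hσ : σ₀ < 1 - μ)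
    (hL₁0 : 0 ≤ L₁) (hL₁ : ∀ x, w x ≤ L₁ * (1 + ‖x‖ ^ 2) ^ (ρ / (2 * s)))
    (hG0 : 0 ≤ G) (hG : ∀ x, f x ≤ G * (1 + ‖x‖ ^ 2) ^ (ρ / 2))
    {Cb : ℝ} (hCb : Cb = 2 * al m s + 4 * al m s * (al m s + 1))
    (hQ : Lam * n * (Cb * δ / R ^ 2) + γ₁ * (Cb * δ / R) +
      (γm + γm * (μ * cbar / (2 * γm)) ^ (1 - m)) * (2 ^ m * (Cb * δ / R) ^ m) ≤ (1 / 2) ^ s * δ ^ s)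
    (hS : μ * A + μ * ((G + 2 * (s - 1) * exp (s - 1) * L₁ ^ s) * (1 + (R + 1) ^ 2) ^ (ρ / 2)) <
      (1 / 2) ^ s * δ ^ s) :
    ∀ x, ‖x‖ < R → (1 - μ) * u x + w x ≤ δ + δ * (1 - ‖x‖ ^ 2 / R ^ 2) ^ (-al m s) := by
  intro x₀ hx₀
  by_contra hcon
  push Not at hcon
  have hα := h.al_pos
  have hm := h.m1
  have hsm := h.sm
  have hs1 : 1 < s := by linarith
  have hσ0 : 0 < 1 - μ := by linarith
  have hR0 : 0 < R := by linarith
  have hLam := h.Lam0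
  have hg1 := h.g1
  have hgm := h.gm
  have hcb := h.cb
  have hρ := h.rho0
  set α := al m s with hαd
  set Sd := (1 / 2) ^ s * δ ^ s - (μ * A + μ * ((G + 2 * (s - 1) * exp (s - 1) * L₁ ^ s) * (1 + (R + 1) ^ 2) ^ (ρ / 2))) with hSd
  have hSd0 : 0 < Sd := by linarith
  set K := γm + γm * (μ * cbar / (2 * γm)) ^ (1 - m) with hK
  have hK0 : 0 < K := by positivity
  -- cut functions
  have hu1 : UpperSemicontinuous (fun x => (1 - μ) * u x - δ) := by
    intro x c hc
    have : u x < (c + δ) / (1 - μ) := by rw [lt_div_iff₀ hσ0]; linarith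
    filter_upwards [hu x _ this] with y hy
    rw [lt_div_iff₀ hσ0] at hy
    linarith
  obtain ⟨M₁, hM₁⟩ := usc_bdd hu1 R
  obtain ⟨M₂, hM₂⟩ := usc_bdd hw (R + 1)
  set M := max (max M₁ M₂) 0 with hM
  have hM0 : 0 ≤ M := le_max_right _ _
  have hMM₁ : M₁ ≤ M := (le_max_left _ _).trans (le_max_left _ _)
  have hMM₂ : M₂ ≤ M := (le_max_right _ _).trans (le_max_left _ _)
  set a₁ : En n → ℝ := fun x => if ‖x‖ < R then
    max ((1 - μ) * u x - δ - δ * (1 - ‖x‖ ^ 2 / R ^ 2) ^ (-α)) (-(M + 1)) else -(M + 1) with ha₁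
  set a₂ : En n → ℝ := fun x => if ‖x‖ ≤ R + 1 then max (w x) (-(M + 1)) else -(M + 1) with ha₂
  have usc1 : UpperSemicontinuous a₁ := usc_cut hu1 hα hδ hR0 (-(M + 1))
  have usc2 : UpperSemicontinuous a₂ := usc_closed_cut hw (R + 1) (-(M + 1))
  have up1 : ∀ x, a₁ x ≤ M := by
    intro x
    simp only [ha₁]
    split_ifs with hx
    · refine max_le ?_ (by linarith)
      have := hM₁ x hx.le
      have h2 : 0 ≤ δ * (1 - ‖x‖ ^ 2 / R ^ 2) ^ (-α) := by
        have := theta_pos hR0 hx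
        positivity
      linarith
    · linarith
  have up2 : ∀ x, a₂ x ≤ M := by
    intro x
    simp only [ha₂]
    split_ifs with hx
    · exact max_le ((hM₂ x hx).trans hMM₂) (by linarith)
    · linarith
  have lo1 : ∀ x, -(M + 1) ≤ a₁ x := by
    intro x
    simp only [ha₁]
    split_ifs
    · exact le_max_right _ _
    · exact le_rfl
  have lo2 : ∀ x, -(M + 1) ≤ a₂ x := by
    intro x
    simp only [ha₂]
    split_ifs
    · exact le_max_right _ _
    · exact le_rfl
  have hpos0 : 0 < a₁ x₀ + a₂ x₀ := by
    have c1 : (1 - μ) * u x₀ - δ - δ * (1 - ‖x₀‖ ^ 2 / R ^ 2) ^ (-α) ≤ a₁ x₀ := by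
      simp only [ha₁, if_pos hx₀]; exact le_max_left _ _
    have c2 : w x₀ ≤ a₂ x₀ := by
      simp only [ha₂, if_pos (show ‖x₀‖ ≤ R + 1 by linarith)]; exact le_max_left _ _
    linarith
  -- choice of the small parameter
  obtain ⟨ωR, hωR, hstr⟩ := h.Fstruct (R + 2) (by linarith)
  have ev1 := hωR.small (show 0 < Sd / 8 by positivity)
  have ev2 := h.mod.small (show 0 < Sd / 8 by positivity)
  have ev3 := h.mod.small (show 0 < μ * cbar / 2 by positivity)
  have ev4 : ∀ᶠ e in 𝓝[>] (0 : ℝ), 2 * (Lam * n * e) < Sd / 8 := by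
    have : Continuous (fun e : ℝ => 2 * (Lam * n * e)) := by fun_prop
    have h1 := this.tendsto 0
    rw [mul_zero, mul_zero] at h1
    exact nhdsWithin_le_nhds (h1.eventually (Iio_mem_nhds (by positivity)))
  have ev5 : ∀ᶠ e in 𝓝[>] (0 : ℝ), γ₁ * e < Sd / 8 := by
    have : Continuous (fun e : ℝ => γ₁ * e) := by fun_prop
    have h1 := this.tendsto 0
    rw [mul_zero] at h1
    exact nhdsWithin_le_nhds (h1.eventually (Iio_mem_nhds (by positivity)))
  have ev6 : ∀ᶠ e in 𝓝[>] (0 : ℝ), K * (2 ^ m * e ^ m) < Sd / 8 := by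
    have : Continuous (fun e : ℝ => K * (2 ^ m * e ^ m)) :=
      continuous_const.mul (continuous_const.mul (continuous_id.rpow_const fun x => Or.inr (by linarith)))
    have h1 := this.tendsto 0
    rw [zero_rpow (by linarith), mul_zero, mul_zero] at h1
    exact nhdsWithin_le_nhds (h1.eventually (Iio_mem_nhds (by positivity)))
  have ev7 : ∀ᶠ e in 𝓝[>] (0 : ℝ), e < 1 := nhdsWithin_le_nhds (Iio_mem_nhds one_pos)
  have huc : UniformContinuousOn f (Metric.closedBall (0 : En n) (R + 1)) :=
    (isCompact_closedBall _ _).uniformContinuousOn_of_continuous h.fc.continuousOn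
  obtain ⟨e₀, he₀, hfe⟩ := Metric.uniformContinuousOn_iff.1 huc (Sd / 8) (by positivity)
  have ev8 : ∀ᶠ e in 𝓝[>] (0 : ℝ), e < e₀ := nhdsWithin_le_nhds (Iio_mem_nhds he₀)
  obtain ⟨e, hall, he⟩ := (((ev1.and (ev2.and (ev3.and (ev4.and (ev5.and (ev6.and (ev7.and ev8)))))))).and
    self_mem_nhdsWithin).exists
  obtain ⟨he1, he2, he3, he4, he5, he6, he7, he8⟩ := hall
  have he : 0 < e := he
  obtain ⟨ε, η, z, y, p₁, p₂, X₁, X₂, hε, hη, hηe, hzy, hdist, hpp, J1, J2, hb1, hb2⟩ :=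
    doubling a₁ a₂ usc1 usc2 (M + 1) (fun x => abs_le.2 ⟨lo1 x, by linarith [up1 x]⟩)
      (fun x => abs_le.2 ⟨lo2 x, by linarith [up2 x]⟩) x₀ hpos0 e he
  have hd0 : 0 ≤ ε⁻¹ * ‖z - y‖ ^ 2 := by positivity
  have hzd : ‖z - y‖ < e := by linarith
  have hyd : ‖y - z‖ < e := by rw [norm_sub_rev]; exact hzd
  -- location of the points
  have ha1z : -(M + 1) < a₁ z := by linarith [up2 y]
  have ha2y : -(M + 1) < a₂ y := by linarith [up1 z]
  have hzR : ‖z‖ < R := by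
    by_contra hc
    simp only [ha₁, if_neg hc, lt_irrefl] at ha1z
  have hyR : ‖y‖ < R + 1 := by
    have : ‖y‖ ≤ ‖z‖ + ‖y - z‖ := by
      have := norm_add_le z (y - z)
      rwa [add_sub_cancel] at this
    linarith
  have a1z : a₁ z = (1 - μ) * u z - δ - δ * (1 - ‖z‖ ^ 2 / R ^ 2) ^ (-α) := by
    simp only [ha₁, if_pos hzR] at ha1z ⊢
    refine max_eq_left ?_
    by_contra hc
    rw [max_eq_right (not_le.1 hc).le] at ha1z
    exact lt_irrefl _ ha1z
  have a2y : a₂ y = w y := by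
    simp only [ha₂, if_pos hyR.le] at ha2y ⊢
    refine max_eq_left ?_
    by_contra hc
    rw [max_eq_right (not_le.1 hc).le] at ha2y
    exact lt_irrefl _ ha2y
  obtain ⟨pb, Xb, τ, jb, hτ0, hqb, hτb, hpb, hpbm⟩ :=
    barrier_jet hm hα (le_max_left _ _) (le_max_right _ _) hsm hR0 hδ z hzR
  have J1' : JetUp (fun x => (1 - μ) * u x - δ - δ * (1 - ‖x‖ ^ 2 / R ^ 2) ^ (-α)) z p₁ X₁ := by
    refine J1.mono ?_ a1z.symm
    have h3 : ∀ᶠ y in 𝓝 z, ‖y‖ < R := continuous_norm.continuousAt.eventually (Iio_mem_nhds hzR)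
    filter_upwards [h3] with x hx
    simp only [ha₁, if_pos hx]
    exact le_max_left _ _
  have J1'' : JetUp u z ((1 - μ)⁻¹ • (p₁ + pb)) ((1 - μ)⁻¹ • (X₁ + Xb)) := by
    have := (J1'.add jb).add (Jet2.const δ z)
    rw [add_zero, add_zero] at this
    refine JetUp.of_smul hσ0 ?_
    convert this using 2
    ring
  have J2' : JetUp w y p₂ X₂ := by
    refine J2.mono ?_ a2y.symm
    have h3 : ∀ᶠ x in 𝓝 y, ‖x‖ < R + 1 := continuous_norm.continuousAt.eventually (Iio_mem_nhds hyR)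
    filter_upwards [h3] with x hx
    simp only [ha₂, if_pos hx.le]
    exact le_max_left _ _
  have hFs : F z (X₁ - η • 1) - F y (-(X₂ - η • 1)) ≤ Sd / 8 :=
    (hstr ε hε z y _ _ (by linarith) (by linarith) (J1.1.sub (isSymm_smul_one η))
      ((J2.1.sub (isSymm_smul_one η)).neg) hb1 hb2).trans
      (he1 _ (by positivity) hdist.le)
  have hN : ‖p₁ + pb + p₂‖ ≤ ‖pb‖ + e := by
    have := norm_add_le pb (p₁ + p₂)
    rw [show p₁ + pb + p₂ = pb + (p₁ + p₂) by abel]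
    linarith
  have core := h.comp_core hsub hsup hμ (by linarith) hσ J1.1 jb.1 J1'' J2' hτ0 hη.le hqb hFs
    (he2 _ (norm_nonneg _) hyd.le) (he3 _ (norm_nonneg _) hyd.le) hN
  -- lower bound for the zero order terms
  set B := (1 - ‖z‖ ^ 2 / R ^ 2) ^ (-α) with hB
  have hB1 : 1 ≤ B := one_le_barrier hα hR0 hzR
  have hB0 : 0 < B := by linarith
  have hW : δ + δ * B ≤ (1 - μ) * u z + w y := by
    rw [a1z, a2y] at hzy; linarith
  have hT : (1 + ‖y‖ ^ 2) ^ (ρ / (2 * s)) ≤ (1 + (R + 1) ^ 2) ^ (ρ / (2 * s)) := by gcongr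
  have zo := zero_order (Bd := L₁ * (1 + (R + 1) ^ 2) ^ (ρ / (2 * s))) hs1 hμ hμ2 (by positivity) hW
    ((hL₁ y).trans (by gcongr)) (by positivity)
  have eBd : (L₁ * (1 + (R + 1) ^ 2) ^ (ρ / (2 * s))) ^ s = L₁ ^ s * (1 + (R + 1) ^ 2) ^ (ρ / 2) := by
    rw [mul_rpow hL₁0 (by positivity), ← rpow_mul (by positivity), show ρ / (2 * s) * s = ρ / 2 by field_simp]
  rw [eBd] at zo
  have hWs : δ ^ s + δ ^ s * B ^ s ≤ (δ + δ * B) ^ s := by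
    rw [← mul_rpow hδ.le hB0.le]
    exact add_rpow_le_rpow_add hδ.le (by positivity) hs1.le
  have hWs' := mul_le_mul_of_nonneg_left hWs (show (0 : ℝ) ≤ (1 / 2) ^ s by positivity)
  -- f
  have hfz : μ * f z ≤ μ * (G * (1 + (R + 1) ^ 2) ^ (ρ / 2)) := by
    have h1 : f z ≤ G * (1 + (R + 1) ^ 2) ^ (ρ / 2) := (hG z).trans (by
      have : ‖z‖ ≤ R + 1 := by linarith
      gcongr)
    gcongr
  have hff : -(Sd / 8) < f z - f y := by
    have := hfe z (by simpa using (by linarith : ‖z‖ ≤ R + 1)) y (by simpa using hyR.le)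
      (by rw [dist_eq_norm]; linarith)
    rw [Real.dist_eq] at this
    exact (abs_lt.1 this).1
  -- gradient terms
  have hNm : (‖pb‖ + e) ^ m ≤ 2 ^ m * (‖pb‖ ^ m + e ^ m) :=
    add_rpow_le_two (by linarith) (norm_nonneg _) he.le
  have g1 : K * (‖pb‖ + e) ^ m ≤ K * (2 ^ m * (((2 * α + 4 * α * (α + 1)) * δ / R) ^ m * B ^ s + e ^ m)) := by
    gcongr
    exact hNm.trans (by gcongr)
  have g2 : γ₁ * (‖pb‖ + e) ≤ γ₁ * ((2 * α + 4 * α * (α + 1)) * δ / R * B ^ s + e) := by gcongr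
  have g3 : Lam * n * τ ≤ Lam * n * ((2 * α + 4 * α * (α + 1)) * δ / R ^ 2 * B ^ s) := by gcongr
  have g4 : 2 * (Lam * n * η) ≤ 2 * (Lam * n * e) := by gcongr
  rw [← hCb] at g1 g2 g3
  have g5 := mul_le_mul_of_nonneg_right hQ (show 0 ≤ B ^ s by positivity)
  linarith

end Hyps
end Comparison

section Comparison2
open Filter Topology Matrix
namespace Hyps

variable {n : ℕ} {lam Lam m s ρ γ₁ γm cbar A σ₀ : ℝ} {ω : ℝ → ℝ}
    {F : En n → Matrix (Fin n) (Fin n) ℝ → ℝ} {H : En n → En n → ℝ} {f : En n → ℝ}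

theorem tendsto_div_sq (c : ℝ) : Tendsto (fun R : ℝ => c / R ^ 2) atTop (𝓝 0) :=
  tendsto_const_nhds.div_atTop (tendsto_pow_atTop two_ne_zero)

theorem comparison (h : Hyps n lam Lam m s ρ γ₁ γm cbar A σ₀ ω F H f) {u w : En n → ℝ}
    (hu : UpperSemicontinuous u) (hw : UpperSemicontinuous w)
    (hsub : SubJ F H s f u) (hsup : SubJ (dualF F) (dualH H) s (-f) w) :
    ∀ x, u x + w x ≤ 0 := by
  obtain ⟨L₁, hL₁0, hL₁⟩ := h.super_growth
  obtain ⟨G, hG0, hG⟩ := h.fgrow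
  have hα := h.al_pos
  have hm := h.m1
  have hsm := h.sm
  have hρ := h.rho0
  have hρ1 := h.rho1
  have hgm := h.gm
  have hcb := h.cb
  have hσ1 := h.s0.2
  set τ := (ρ + m / (m - 1)) / 2 with hτ
  have hτρ : ρ < τ := by linarith
  have hτ0 : 0 < τ := by linarith
  have hτm : 0 < m - τ * (m - 1) := by
    have : τ < m / (m - 1) := by linarith
    rw [lt_div_iff₀ (by linarith)] at this
    linarith
  intro x
  refine le_of_forall_pos_le_add fun r hr => ?_
  rw [zero_add]
  set δ := r / 2 with hδd
  have hδ : 0 < δ := by positivity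
  set Cb := 2 * al m s + 4 * al m s * (al m s + 1) with hCb
  have hCb0 : 0 < Cb := by positivity
  have hμlim : Tendsto (fun R : ℝ => R ^ (-τ)) atTop (𝓝 0) := tendsto_rpow_neg_atTop hτ0
  have hc0 : (0 : ℝ) < (1 / 2) ^ s * δ ^ s := by positivity
  -- first smallness condition
  have hQ : ∀ᶠ R : ℝ in atTop, Lam * n * (Cb * δ / R ^ 2) + γ₁ * (Cb * δ / R) +
      (γm + γm * (R ^ (-τ) * cbar / (2 * γm)) ^ (1 - m)) * (2 ^ m * (Cb * δ / R) ^ m) ≤ (1 / 2) ^ s * δ ^ s := by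
    have l1 : Tendsto (fun R : ℝ => Lam * n * (Cb * δ / R ^ 2)) atTop (𝓝 (Lam * n * 0)) :=
      (tendsto_div_sq _).const_mul _
    have l2 : Tendsto (fun R : ℝ => γ₁ * (Cb * δ / R)) atTop (𝓝 (γ₁ * 0)) :=
      (tendsto_const_nhds.div_atTop tendsto_id).const_mul _
    have l3 : Tendsto (fun R : ℝ => γm * (2 ^ m * (Cb * δ) ^ m) * R ^ (-m)) atTop
        (𝓝 (γm * (2 ^ m * (Cb * δ) ^ m) * 0)) :=
      (tendsto_rpow_neg_atTop (by linarith)).const_mul _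
    have l4 : Tendsto (fun R : ℝ => γm * (cbar / (2 * γm)) ^ (1 - m) * (2 ^ m * (Cb * δ) ^ m) *
        R ^ (-(m - τ * (m - 1)))) atTop
        (𝓝 (γm * (cbar / (2 * γm)) ^ (1 - m) * (2 ^ m * (Cb * δ) ^ m) * 0)) :=
      (tendsto_rpow_neg_atTop hτm).const_mul _
    have l5 := ((l1.add l2).add l3).add l4
    simp only [mul_zero, add_zero] at l5
    filter_upwards [l5.eventually (Iic_mem_nhds hc0), eventually_gt_atTop 0] with R h1 hR
    refine le_trans (le_of_eq ?_) h1
    have e1 : (Cb * δ / R) ^ m = (Cb * δ) ^ m * R ^ (-m) := by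
      rw [div_rpow (by positivity) hR.le, rpow_neg hR.le]; rfl
    have e2 : (R ^ (-τ) * cbar / (2 * γm)) ^ (1 - m) = R ^ (τ * (m - 1)) * (cbar / (2 * γm)) ^ (1 - m) := by
      rw [mul_div_assoc, mul_rpow (by positivity) (by positivity), ← rpow_mul hR.le]
      ring_nf
    have e3 : R ^ (-(m - τ * (m - 1))) = R ^ (τ * (m - 1)) * R ^ (-m) := by
      rw [← rpow_add hR]; ring_nf
    rw [e1, e2, e3]; ring
  -- second smallness condition
  have hS : ∀ᶠ R : ℝ in atTop, R ^ (-τ) * A + R ^ (-τ) * ((G + 2 * (s - 1) * exp (s - 1) * L₁ ^ s) *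
      (1 + (R + 1) ^ 2) ^ (ρ / 2)) < (1 / 2) ^ s * δ ^ s := by
    set D := G + 2 * (s - 1) * exp (s - 1) * L₁ ^ s with hD
    have hD0 : 0 ≤ D := by
      have : 0 < s - 1 := by linarith
      positivity
    have l1 := hμlim.mul_const A
    have l2 : Tendsto (fun R : ℝ => D * 5 ^ (ρ / 2) * R ^ (-(τ - ρ))) atTop (𝓝 (D * 5 ^ (ρ / 2) * 0)) :=
      (tendsto_rpow_neg_atTop (by linarith)).const_mul _
    have l3 := l1.add l2
    simp only [mul_zero, zero_mul, add_zero] at l3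
    filter_upwards [l3.eventually (Iio_mem_nhds hc0), eventually_ge_atTop 1] with R h1 hR
    have hR0 : 0 < R := by linarith
    refine lt_of_le_of_lt ?_ h1
    have e1 : (1 + (R + 1) ^ 2) ^ (ρ / 2) ≤ 5 ^ (ρ / 2) * R ^ ρ := by
      calc (1 + (R + 1) ^ 2) ^ (ρ / 2) ≤ (5 * R ^ 2) ^ (ρ / 2) := by
            gcongr; nlinarith
        _ = 5 ^ (ρ / 2) * R ^ ρ := by
            rw [mul_rpow (by norm_num) (by positivity), ← rpow_natCast R 2, ← rpow_mul hR0.le,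
              show ((2 : ℕ) : ℝ) * (ρ / 2) = ρ by push_cast; ring]
    have e2 : R ^ (-(τ - ρ)) = R ^ (-τ) * R ^ ρ := by rw [← rpow_add hR0]; ring_nf
    have e3 : R ^ (-τ) * (D * (1 + (R + 1) ^ 2) ^ (ρ / 2)) ≤ R ^ (-τ) * (D * (5 ^ (ρ / 2) * R ^ ρ)) := by gcongr
    rw [e2]
    linarith
  have hev : ∀ᶠ R : ℝ in atTop, (1 - R ^ (-τ)) * u x + w x ≤ δ + δ * (1 - ‖x‖ ^ 2 / R ^ 2) ^ (-al m s) := by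
    filter_upwards [hQ, hS, eventually_ge_atTop 1, eventually_gt_atTop ‖x‖,
      hμlim.eventually (Iio_mem_nhds (show (0 : ℝ) < 1 / 2 by norm_num)),
      hμlim.eventually (Iio_mem_nhds (show (0 : ℝ) < 1 - σ₀ by linarith))] with R h1 h2 h3 h4 h5 h6
    have h5 : R ^ (-τ) < 1 / 2 := h5
    have h6 : R ^ (-τ) < 1 - σ₀ := h6
    exact h.comp_step hu hw hsub hsup hδ h3 (by positivity) h5.le (by linarith) hL₁0 (hL₁ w hw hsup)
      hG0 hG hCb h1 h2 x h4
  have lim1 : Tendsto (fun R : ℝ => (1 - R ^ (-τ)) * u x + w x) atTop (𝓝 ((1 - 0) * u x + w x)) :=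
    ((hμlim.const_sub 1).mul_const _).add_const _
  have lim2 : Tendsto (fun R : ℝ => δ + δ * (1 - ‖x‖ ^ 2 / R ^ 2) ^ (-al m s)) atTop
      (𝓝 (δ + δ * (1 - 0) ^ (-al m s))) :=
    ((((tendsto_div_sq _).const_sub 1).rpow_const (Or.inl (by norm_num))).const_mul δ).const_add δ
  have := le_of_tendsto_of_tendsto lim1 lim2 hev
  rw [sub_zero, one_rpow] at this
  linarith

end Hyps
end Comparison2

section Envelope
open Filter Topology Matrix
variable {n : ℕ}

/-- upper semicontinuous envelope -/
def uenv (g : En n → ℝ) (x : En n) : ℝ := sInf {c | ∀ᶠ y in 𝓝 x, g y ≤ c}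

theorem uenv_bddBelow (g : En n → ℝ) (x : En n) : BddBelow {c | ∀ᶠ y in 𝓝 x, g y ≤ c} :=
  ⟨g x, fun c hc => by
    have hc : ∀ᶠ y in 𝓝 x, g y ≤ c := hc
    exact hc.self_of_nhds⟩

theorem le_uenv {g : En n → ℝ} {x : En n} (hb : ∃ c, ∀ᶠ y in 𝓝 x, g y ≤ c) : g x ≤ uenv g x :=
  le_csInf hb fun c hc => by
    have hc : ∀ᶠ y in 𝓝 x, g y ≤ c := hc
    exact hc.self_of_nhds

theorem uenv_le {g : En n → ℝ} {x : En n} {c : ℝ} (h : ∀ᶠ y in 𝓝 x, g y ≤ c) : uenv g x ≤ c :=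
  csInf_le (uenv_bddBelow g x) h

theorem uenv_frequently {g : En n → ℝ} {x : En n} {c : ℝ} (h : c < uenv g x) : ∃ᶠ y in 𝓝 x, c < g y := by
  intro h'
  have : ∀ᶠ y in 𝓝 x, g y ≤ c := by filter_upwards [h'] with y hy using not_lt.1 hy
  exact absurd (uenv_le this) (not_le.2 h)

theorem uenv_usc {g : En n → ℝ} (hb : ∀ x, ∃ c, ∀ᶠ y in 𝓝 x, g y ≤ c) : UpperSemicontinuous (uenv g) := by
  intro x c hc
  obtain ⟨c', hc', hlt⟩ := exists_lt_of_csInf_lt (hb x) hc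
  have hc' : ∀ᶠ y in 𝓝 x, g y ≤ c' := hc'
  filter_upwards [eventually_eventually_nhds.2 hc'] with y hy
  exact (uenv_le hy).trans_lt hlt

theorem stab {Fam : Set (En n → ℝ)} {U : En n → ℝ} (hF : ∀ u ∈ Fam, UpperSemicontinuous u)
    (hle : ∀ u ∈ Fam, ∀ x, u x ≤ U x) (hfr : ∀ x, ∀ c < U x, ∃ᶠ y in 𝓝 x, ∃ u ∈ Fam, c < u y)
    {x p : En n} {X : Matrix (Fin n) (Fin n) ℝ} (hJ : JetUp U x p X) {η d : ℝ} (hη : 0 < η) (hd : 0 < d) :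
    ∃ u ∈ Fam, ∃ z, ‖z - x‖ < d ∧ |u z - U x| < d ∧
      JetUp u z (p + toEuclideanCLM (𝕜 := ℝ) (X + (4 * η) • 1) (z - x)) (X + (4 * η) • 1) := by
  set Y := X + (4 * η) • (1 : Matrix (Fin n) (Fin n) ℝ) with hY
  have hYs : Y.IsSymm := hJ.1.add (isSymm_smul_one _)
  set φ : En n → ℝ := fun y => U x + inner ℝ p (y - x) + quad Y (y - x) / 2 with hφ
  have hφx : φ x = U x := by simp [hφ, quad]
  have hφc : Continuous φ := by
    have := (continuous_quad Y).comp (continuous_id.sub (continuous_const (y := x)))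
    have h2 : Continuous (fun y : En n => quad Y (y - x)) := this
    simp only [hφ]
    fun_prop
  -- a ball on which the expansion holds
  have ev1 : ∀ᶠ y in 𝓝 x, U y - φ y ≤ - (η * ‖y - x‖ ^ 2) := by
    have ht : Tendsto (fun y : En n => y - x) (𝓝 x) (𝓝 0) := by
      have : Continuous (fun y : En n => y - x) := by fun_prop
      have := this.tendsto x
      rwa [sub_self] at this
    filter_upwards [ht.eventually (hJ.2 η hη)] with y hy
    rw [add_sub_cancel] at hy
    simp only [hφ, hY, quad_add, quad_smul, quad_one]
    linarith
  have ev2 : ∀ᶠ y in 𝓝 x, |φ y - U x| < d / 2 := by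
    have : Tendsto φ (𝓝 x) (𝓝 (U x)) := by have := hφc.tendsto x; rwa [hφx] at this
    have := this.eventually (Metric.ball_mem_nhds _ (half_pos hd))
    filter_upwards [this] with y hy
    simpa [Real.dist_eq] using hy
  obtain ⟨r, hr, hball⟩ := Metric.eventually_nhds_iff.1 (ev1.and ev2)
  set r' := min (r / 2) (d / 2) with hr'
  have hr'0 : 0 < r' := lt_min (by positivity) (by positivity)
  have hr'r : r' < r := lt_of_le_of_lt (min_le_left _ _) (by linarith)
  have hr'd : r' < d := lt_of_le_of_lt (min_le_right _ _) (by linarith)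
  set e := min (d / 2) (η * r' ^ 2 / 2) with he
  have he0 : 0 < e := lt_min (by positivity) (by positivity)
  have ev3 : ∀ᶠ y in 𝓝 x, φ y < U x + e / 2 := by
    have : Tendsto φ (𝓝 x) (𝓝 (U x)) := by have := hφc.tendsto x; rwa [hφx] at this
    exact this.eventually (Iio_mem_nhds (by linarith))
  have ev4 : ∀ᶠ y in 𝓝 x, y ∈ Metric.closedBall x r' := Metric.closedBall_mem_nhds x hr'0
  obtain ⟨y, ⟨u, huF, huy⟩, hy3, hy4⟩ := ((hfr x (U x - e / 2) (by linarith)).and_eventually (ev3.and ev4)).exists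
  have husc : UpperSemicontinuous (fun y => u y - φ y) := by
    have := (hF u huF).add (hφc.neg.upperSemicontinuous)
    simpa [sub_eq_add_neg] using this
  obtain ⟨z, hz, hmax⟩ := UpperSemicontinuousOn.exists_isMaxOn (s := Metric.closedBall x r')
    ⟨y, hy4⟩ (isCompact_closedBall _ _) (husc.upperSemicontinuousOn _)
  have hzx : ‖z - x‖ ≤ r' := by rw [← dist_eq_norm]; exact hz
  obtain ⟨b1, b2⟩ := hball (show dist z x < r by rw [dist_eq_norm]; linarith)
  have h1 : u y - φ y ≤ u z - φ z := hmax hy4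
  have h2 := hle u huF z
  have h3 : η * ‖z - x‖ ^ 2 < η * r' ^ 2 := by
    have : e ≤ η * r' ^ 2 / 2 := min_le_right _ _
    have : 0 < η * r' ^ 2 := by positivity
    linarith
  have h4 : ‖z - x‖ < r' := by
    have := lt_of_mul_lt_mul_left h3 hη.le
    exact lt_of_pow_lt_pow_left₀ 2 hr'0.le this
  refine ⟨u, huF, z, by linarith, ?_, ?_⟩
  · have : e ≤ d / 2 := min_le_left _ _
    have h5 : 0 ≤ η * ‖z - x‖ ^ 2 := by positivity
    have := abs_lt.1 b2
    rw [abs_lt]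
    constructor <;> linarith [this.1, this.2]
  · refine jetUp_of_max (jet_quad x p Y hYs (U x) z) ?_
    have : ∀ᶠ y in 𝓝 z, y ∈ Metric.ball x r' :=
      Metric.isOpen_ball.mem_nhds (by rw [Metric.mem_ball, dist_eq_norm]; exact h4)
    filter_upwards [this] with y' hy'
    exact hmax (Metric.ball_subset_closedBall hy')

end Envelope

section PerronA
open Filter Topology Matrix
namespace Hyps

variable {n : ℕ} {lam Lam m s ρ γ₁ γm cbar A σ₀ : ℝ} {ω : ℝ → ℝ}
    {F : En n → Matrix (Fin n) (Fin n) ℝ → ℝ} {H : En n → En n → ℝ} {f : En n → ℝ}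

theorem Hcont (h : Hyps n lam Lam m s ρ γ₁ γm cbar A σ₀ ω F H f) :
    Continuous (fun z : En n × En n => H z.1 z.2) := by
  rw [continuous_iff_continuousAt]
  rintro ⟨x, p⟩
  have hm := h.m1
  have hω : Tendsto ω (𝓝[≥] 0) (𝓝 0) := by
    have := h.mod.2.2.2
    rw [ContinuousWithinAt, h.mod.2.2.1] at this
    exact this
  have t1 : Tendsto (fun z : En n × En n => ‖z.1 - x‖) (𝓝 (x, p)) (𝓝[≥] 0) := by
    rw [tendsto_nhdsWithin_iff]
    refine ⟨?_, Eventually.of_forall fun z => norm_nonneg _⟩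
    have : Continuous (fun z : En n × En n => ‖z.1 - x‖) := by fun_prop
    have := this.tendsto (x, p)
    simpa using this
  have t2 : Tendsto (fun z : En n × En n => (γ₁ + γm * (‖p‖ ^ (m - 1) + ‖z.2 - p‖ ^ (m - 1))) * ‖z.2 - p‖)
      (𝓝 (x, p)) (𝓝 0) := by
    have c1 : Continuous (fun z : En n × En n => ‖z.2 - p‖) := by fun_prop
    have c2 : Continuous (fun z : En n × En n => ‖z.2 - p‖ ^ (m - 1)) :=
      c1.rpow_const fun _ => Or.inr (by linarith)
    have : Continuous (fun z : En n × En n => (γ₁ + γm * (‖p‖ ^ (m - 1) + ‖z.2 - p‖ ^ (m - 1))) * ‖z.2 - p‖) := by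
      fun_prop
    have := this.tendsto (x, p)
    simpa using this
  have t3 := ((hω.comp t1).mul_const (‖p‖ ^ m + 1)).add t2
  rw [zero_mul, zero_add] at t3
  rw [ContinuousAt, tendsto_iff_dist_tendsto_zero]
  refine squeeze_zero (fun _ => dist_nonneg) (fun z => ?_) t3
  rw [Real.dist_eq]
  have := h.Hstruct z.1 x p (z.2 - p)
  rw [add_sub_cancel] at this
  exact this

theorem gg_cont {s : ℝ} (hs : 1 < s) : Continuous (fun t : ℝ => |t| ^ (s - 1) * t) :=
  (continuous_abs.rpow_const fun _ => Or.inr (by linarith)).mul continuous_id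

/-- continuity of the operator along an affine gradient -/
theorem op_cont (h : Hyps n lam Lam m s ρ γ₁ γm cbar A σ₀ ω F H f) (x p : En n)
    {Y : Matrix (Fin n) (Fin n) ℝ} (hY : Y.IsSymm) :
    Continuous (fun z : En n × ℝ => F z.1 Y + H z.1 (p + toEuclideanCLM (𝕜 := ℝ) Y (z.1 - x))
      - |z.2| ^ (s - 1) * z.2 - f z.1) := by
  have hm := h.m1
  have hsm := h.sm
  have c1 : Continuous (fun z : En n × ℝ => F z.1 Y) := (h.Fcont Y hY).comp continuous_fst
  have c2 : Continuous (fun z : En n × ℝ => H z.1 (p + toEuclideanCLM (𝕜 := ℝ) Y (z.1 - x))) :=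
    h.Hcont.comp (continuous_fst.prodMk (continuous_const.add
      ((toEuclideanCLM (𝕜 := ℝ) Y).continuous.comp (continuous_fst.sub continuous_const))))
  have c3 : Continuous (fun z : En n × ℝ => |z.2| ^ (s - 1) * z.2) :=
    (gg_cont (by linarith : 1 < s)).comp continuous_snd
  exact ((c1.add c2).sub c3).sub (h.fc.comp continuous_fst)

theorem stab_sub (h : Hyps n lam Lam m s ρ γ₁ γm cbar A σ₀ ω F H f)
    {Fam : Set (En n → ℝ)} {U : En n → ℝ} (hF : ∀ u ∈ Fam, UpperSemicontinuous u ∧ SubJ F H s f u)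
    (hle : ∀ u ∈ Fam, ∀ x, u x ≤ U x) (hfr : ∀ x, ∀ c < U x, ∃ᶠ y in 𝓝 x, ∃ u ∈ Fam, c < u y) :
    SubJ F H s f U := by
  intro x p X hJ
  have hLam := h.Lam0
  have key : ∀ η > (0 : ℝ), f x ≤ F x (X + (4 * η) • 1) + H x p - |U x| ^ (s - 1) * U x := by
    intro η hη
    by_contra hcon
    push Not at hcon
    have hc := h.op_cont x p (hJ.1.add (isSymm_smul_one (4 * η)))
    have hv : F x (X + (4 * η) • 1) + H x (p + toEuclideanCLM (𝕜 := ℝ) (X + (4 * η) • 1) (x - x))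
        - |U x| ^ (s - 1) * U x - f x < 0 := by
      rw [sub_self, map_zero, add_zero]; linarith
    have hlim := (hc.tendsto (x, U x)).eventually (Iio_mem_nhds hv)
    obtain ⟨d, hd, hball⟩ := Metric.eventually_nhds_iff.1 hlim
    obtain ⟨u, huF, z, hz, hu, hj⟩ := stab (fun u hu => (hF u hu).1) hle hfr hJ hη hd
    have h1 := hball (y := (z, u z)) (by
      rw [Prod.dist_eq]
      exact max_lt (by rw [dist_eq_norm]; exact hz) (by rw [Real.dist_eq]; exact hu))
    have h2 := (hF u huF).2 z _ _ hj
    have h1 : F z (X + (4 * η) • 1) + H z (p + toEuclideanCLM (𝕜 := ℝ) (X + (4 * η) • 1) (z - x))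
      - |u z| ^ (s - 1) * u z - f z < 0 := h1
    linarith
  refine le_of_forall_pos_le_add fun r hr => ?_
  have hc0 : 0 < Lam * n * 4 + 1 := by positivity
  have h1 := key (r / (Lam * n * 4 + 1)) (by positivity)
  have h2 := h.ell.add_one x hJ.1 (4 * (r / (Lam * n * 4 + 1))) (by positivity)
  have h3 : Lam * n * (4 * (r / (Lam * n * 4 + 1))) ≤ r := by
    have : Lam * n * (4 * (r / (Lam * n * 4 + 1))) = (Lam * n * 4) * r / (Lam * n * 4 + 1) := by ring
    rw [this, div_le_iff₀ hc0]
    nlinarith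
  linarith

end Hyps
end PerronA

section PerronB
open Filter Topology Matrix
namespace Hyps

variable {n : ℕ} {lam Lam m s ρ γ₁ γm cbar A σ₀ : ℝ} {ω : ℝ → ℝ}
    {F : En n → Matrix (Fin n) (Fin n) ℝ → ℝ} {H : En n → En n → ℝ} {f : En n → ℝ}

/-- an explicit continuous subsolution -/
theorem exists_sub (h : Hyps n lam Lam m s ρ γ₁ γm cbar A σ₀ ω F H f) :
    ∃ u : En n → ℝ, Continuous u ∧ SubJ F H s f u := by
  obtain ⟨G, hG0, hG⟩ := h.fgrow
  have hm := h.m1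
  have hsm := h.sm
  have hs : 1 < s := by linarith
  have hLam := h.Lam0
  have g1 := h.g1
  have gm := h.gm
  have hρ := h.rho0
  set k := ρ / (2 * s) with hk
  have hk0 : 0 ≤ k := by positivity
  set Cp := 2 * k + 4 * k * |k - 1| with hCp
  have hCp0 : 0 ≤ Cp := by positivity
  obtain ⟨L, hL1, hL⟩ := exists_large hm hsm (a := G) (b := (Lam * n + γ₁) * Cp) (c := γm * Cp ^ m)
    hG0 (by positivity) (by positivity)
  have hL0 : 0 ≤ L := by linarith
  refine ⟨fun y => -(L * (1 + ‖y‖ ^ 2) ^ k), ?_, ?_⟩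
  · have : Continuous (fun y : En n => (1 + ‖y‖ ^ 2) ^ k) :=
      Continuous.rpow_const (by fun_prop) fun y => Or.inr hk0
    fun_prop
  · intro x p X hJ
    obtain ⟨q, Y, τ, hj, hτ0, hY, hτ, hq⟩ := psi_jet hk0 L hL0 x
    obtain ⟨hpq, hXY⟩ := hJ.compare hj.neg
    set T := 1 + ‖x‖ ^ 2 with hT
    have hT1 : 1 ≤ T := by have := sq_nonneg ‖x‖; linarith
    have hT0 : 0 < T := by linarith
    set S := T ^ k with hS
    have hS1 : 1 ≤ S := one_le_rpow hT1 hk0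
    have hS0 : 0 < S := by linarith
    have hSs : S ^ s = T ^ (ρ / 2) := by
      rw [hS, ← rpow_mul hT0.le, hk]
      congr 1
      field_simp
    have hF := h.Flower x hJ.1 hτ0 (fun v => by
      have h1 := hXY v
      rw [quad_neg] at h1
      have := (abs_le.1 (hY v)).2
      linarith)
    have hH := (abs_le.1 (h.Hbound x p)).1
    have hpn : ‖p‖ ≤ Cp * L * S := by rw [hpq, norm_neg]; exact hq
    have hS1s : S ≤ S ^ s := by
      have := rpow_le_rpow_of_exponent_le hS1 hs.le
      rwa [rpow_one] at this
    have hSms : S ^ m ≤ S ^ s := rpow_le_rpow_of_exponent_le hS1 hsm.le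
    have hpm : ‖p‖ ^ m ≤ Cp ^ m * L ^ m * S ^ m := by
      rw [← mul_rpow hCp0 hL0, ← mul_rpow (by positivity) hS0.le]
      exact rpow_le_rpow (norm_nonneg _) hpn (by linarith)
    have e1 : Lam * n * τ ≤ Lam * n * Cp * L * S ^ s := by
      calc Lam * n * τ ≤ Lam * n * (Cp * L * S) := by gcongr
        _ ≤ Lam * n * (Cp * L * S ^ s) := by gcongr
        _ = _ := by ring
    have e2 : γ₁ * ‖p‖ ≤ γ₁ * Cp * L * S ^ s := by
      calc γ₁ * ‖p‖ ≤ γ₁ * (Cp * L * S) := by gcongr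
        _ ≤ γ₁ * (Cp * L * S ^ s) := by gcongr
        _ = _ := by ring
    have e3 : γm * ‖p‖ ^ m ≤ γm * Cp ^ m * L ^ m * S ^ s := by
      calc γm * ‖p‖ ^ m ≤ γm * (Cp ^ m * L ^ m * S ^ m) := by gcongr
        _ ≤ γm * (Cp ^ m * L ^ m * S ^ s) := by gcongr
        _ = _ := by ring
    have hf := hG x
    rw [← hT, ← hSs] at hf
    have hg := gg_neg_eq hs (a := -(L * S)) (by have : 0 ≤ L * S := by positivity
                                                linarith)
    rw [neg_neg, mul_rpow hL0 hS0.le] at hg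
    have hSp : 0 ≤ S ^ s := by positivity
    have h5 := mul_le_mul_of_nonneg_right hL hSp
    show f x ≤ F x X + H x p - |-(L * S)| ^ (s - 1) * (-(L * S))
    rw [hg]
    linarith

theorem bump (h : Hyps n lam Lam m s ρ γ₁ γm cbar A σ₀ ω F H f) {U w : En n → ℝ}
    (hU : UpperSemicontinuous U) (hS : SubJ F H s f U)
    (hmax : ∀ u, UpperSemicontinuous u → SubJ F H s f u → ∀ x, u x ≤ U x)
    (hw1 : ∀ x, -U x ≤ w x) (hw2 : ∀ x, ∀ c < w x, ∃ᶠ y in 𝓝 x, c < -U y) :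
    SubJ (dualF F) (dualH H) s (-f) w := by
  intro x p X hJ
  by_contra hcon
  push Not at hcon
  have hLam := h.Lam0
  simp only [dualF, dualH, Pi.neg_apply] at hcon
  set v0 := - w x with hv0
  have hgg : |v0| ^ (s - 1) * v0 = -(|w x| ^ (s - 1) * w x) := by rw [hv0, abs_neg]; ring
  set P := -p with hP
  set δ := F x (-X) + H x P - |v0| ^ (s - 1) * v0 - f x with hδ
  have hδ0 : 0 < δ := by rw [hδ, hgg]; linarith
  have hc0 : 0 < Lam * n * 4 + 1 := by positivity
  set η := δ / 2 / (Lam * n * 4 + 1) with hη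
  have hη0 : 0 < η := by positivity
  set Y := -X - (4 * η) • (1 : Matrix (Fin n) (Fin n) ℝ) with hY
  have hYs : Y.IsSymm := hJ.1.neg.sub (isSymm_smul_one _)
  have hFY : F x (-X) - δ / 2 ≤ F x Y := by
    have h1 := h.ell.add_one x hYs (4 * η) (by positivity)
    have e : Y + (4 * η) • 1 = -X := by rw [hY]; abel
    rw [e] at h1
    have h3 : Lam * n * (4 * η) ≤ δ / 2 := by
      have : Lam * n * (4 * η) = (Lam * n * 4) * (δ / 2) / (Lam * n * 4 + 1) := by rw [hη]; ring
      rw [this, div_le_iff₀ hc0]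
      nlinarith
    linarith
  have hv : 0 < F x Y + H x (P + toEuclideanCLM (𝕜 := ℝ) Y (x - x)) - |v0| ^ (s - 1) * v0 - f x := by
    rw [sub_self, map_zero, add_zero]; linarith
  have hlim := ((h.op_cont x P hYs).tendsto (x, v0)).eventually (Ioi_mem_nhds hv)
  obtain ⟨d, hd, hdball⟩ := Metric.eventually_nhds_iff.1 hlim
  set φ : En n → ℝ := fun y => v0 + inner ℝ P (y - x) + quad Y (y - x) / 2 with hφ
  have hφx : φ x = v0 := by simp [hφ, quad]
  have hφc : Continuous φ := by
    have := (continuous_quad Y).comp (continuous_id.sub (continuous_const (y := x)))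
    have h2 : Continuous (fun y : En n => quad Y (y - x)) := this
    simp only [hφ]
    fun_prop
  have hφt : Tendsto φ (𝓝 x) (𝓝 v0) := by have := hφc.tendsto x; rwa [hφx] at this
  have ev1 : ∀ᶠ y in 𝓝 x, φ y + η * ‖y - x‖ ^ 2 ≤ U y := by
    have ht : Tendsto (fun y : En n => y - x) (𝓝 x) (𝓝 0) := by
      have : Continuous (fun y : En n => y - x) := by fun_prop
      have := this.tendsto x
      rwa [sub_self] at this
    filter_upwards [ht.eventually (hJ.2 η hη0)] with y hy
    rw [add_sub_cancel] at hy
    have := hw1 y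
    simp only [hφ, hY, quad_sub, quad_neg, quad_smul, quad_one, hP, inner_neg_left, hv0]
    linarith
  have ev2 : ∀ᶠ y in 𝓝 x, |φ y - v0| < d / 2 := by
    filter_upwards [hφt.eventually (Metric.ball_mem_nhds _ (half_pos hd))] with y hy
    simpa [Real.dist_eq] using hy
  obtain ⟨r0, hr0, hball⟩ := Metric.eventually_nhds_iff.1 (ev1.and ev2)
  set r := min r0 d with hr
  have hrp : 0 < r := lt_min hr0 hd
  set t := min (d / 2) (η * r ^ 2 / 8) with ht
  have ht0 : 0 < t := lt_min (by positivity) (by positivity)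
  have htd : t ≤ d / 2 := min_le_left _ _
  have htr : t ≤ η * r ^ 2 / 8 := min_le_right _ _
  have hin : ∀ y, ‖y - x‖ < r → φ y + η * ‖y - x‖ ^ 2 ≤ U y ∧ |φ y - v0| < d / 2 := fun y hy =>
    hball (by rw [dist_eq_norm]; exact hy.trans_le (min_le_left _ _))
  have hann : ∀ y, ‖y - x‖ < r → r / 2 < ‖y - x‖ → φ y + t ≤ U y := by
    intro y h1 h2
    have := (hin y h1).1
    have h3 : (r / 2) ^ 2 ≤ ‖y - x‖ ^ 2 := by gcongr
    have h4 := mul_le_mul_of_nonneg_left h3 hη0.le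
    have : 0 < η * r ^ 2 := by positivity
    linarith
  set v : En n → ℝ := fun y => if ‖y - x‖ < r then max (U y) (φ y + t) else U y with hvdef
  have hUv : ∀ y, U y ≤ v y := by
    intro y
    simp only [hvdef]
    split_ifs
    · exact le_max_left _ _
    · exact le_rfl
  have hvin : ∀ y, ‖y - x‖ < r → v y = max (U y) (φ y + t) := fun y hy => by
    simp only [hvdef, if_pos hy]
  have hvout : ∀ y, r / 2 < ‖y - x‖ → v y = U y := by
    intro y hy
    simp only [hvdef]
    split_ifs with h1
    · exact max_eq_left (hann y h1 hy)
    · rfl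
  have hnc : Continuous (fun y : En n => ‖y - x‖) := by fun_prop
  have hvusc : UpperSemicontinuous v := by
    intro z c hc
    by_cases hz : ‖z - x‖ < r
    · rw [hvin z hz] at hc
      have e1 := hU z c ((le_max_left _ _).trans_lt hc)
      have e2 : ∀ᶠ y in 𝓝 z, φ y + t < c :=
        ((hφc.add continuous_const).tendsto z).eventually (Iio_mem_nhds ((le_max_right _ _).trans_lt hc))
      have e3 : ∀ᶠ y in 𝓝 z, ‖y - x‖ < r := (hnc.tendsto z).eventually (Iio_mem_nhds hz)
      filter_upwards [e1, e2, e3] with y h1 h2 h3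
      rw [hvin y h3]
      exact max_lt h1 h2
    · push Not at hz
      have hz' : r / 2 < ‖z - x‖ := by linarith
      rw [hvout z hz'] at hc
      have e3 : ∀ᶠ y in 𝓝 z, r / 2 < ‖y - x‖ := (hnc.tendsto z).eventually (Ioi_mem_nhds hz')
      filter_upwards [hU z c hc, e3] with y h1 h3
      rw [hvout y h3]
      exact h1
  have hvsub : SubJ F H s f v := by
    intro z p' X' hj
    by_cases hz : ‖z - x‖ < r ∧ U z < φ z + t
    · obtain ⟨hz, hlt⟩ := hz
      have hvz : v z = φ z + t := by rw [hvin z hz]; exact max_eq_right hlt.le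
      have e3 : ∀ᶠ y in 𝓝 z, ‖y - x‖ < r := (hnc.tendsto z).eventually (Iio_mem_nhds hz)
      have hj2 : JetUp (fun y => (v0 + t) + inner ℝ P (y - x) + quad Y (y - x) / 2) z p' X' := by
        refine hj.mono ?_ ?_
        · filter_upwards [e3] with y hy
          rw [hvin y hy]
          refine le_trans (le_of_eq ?_) (le_max_right _ _)
          simp only [hφ]; ring
        · rw [hvz]; simp only [hφ]; ring
      obtain ⟨e4, e5⟩ := hj2.compare (jet_quad x P Y hYs (v0 + t) z)
      have h1 := h.ell.mono z hYs hj.1 e5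
      have h2 := (abs_lt.1 (hin z hz).2)
      have h3 := hdball (y := (z, v z)) (by
        rw [Prod.dist_eq]
        refine max_lt (by rw [dist_eq_norm]; exact hz.trans_le (min_le_right _ _)) ?_
        rw [Real.dist_eq, hvz, abs_lt]
        constructor <;> linarith [h2.1, h2.2])
      have h3 : 0 < F z Y + H z (P + toEuclideanCLM (𝕜 := ℝ) Y (z - x)) - |v z| ^ (s - 1) * v z - f z := h3
      rw [e4]
      linarith
    · have hvz : v z = U z := by
        by_cases h1 : ‖z - x‖ < r
        · rw [hvin z h1]
          exact max_eq_left (not_lt.1 fun h2 => hz ⟨h1, h2⟩)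
        · simp only [hvdef, if_neg h1]
      rw [hvz]
      exact hS z p' X' (hj.mono (Eventually.of_forall hUv) hvz.symm)
  have hle := hmax v hvusc hvsub
  have ev3 : ∀ᶠ y in 𝓝 x, v0 - t / 2 < φ y := hφt.eventually (Ioi_mem_nhds (by linarith))
  have ev4 : ∀ᶠ y in 𝓝 x, ‖y - x‖ < r :=
    (hnc.tendsto x).eventually (Iio_mem_nhds (by rw [sub_self, norm_zero]; exact hrp))
  obtain ⟨y, hy1, hy2, hy3⟩ := ((hw2 x (w x - t / 2) (by linarith)).and_eventually (ev3.and ev4)).exists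
  have h1 := hle y
  rw [hvin y hy3] at h1
  have h2 := (le_max_right _ _).trans h1
  linarith

theorem existence (h : Hyps n lam Lam m s ρ γ₁ γm cbar A σ₀ ω F H f) :
    ∃ U : En n → ℝ, Continuous U ∧ SubJ F H s f U ∧ SubJ (dualF F) (dualH H) s (-f) (-U) := by
  obtain ⟨u0, hu0c, hu0⟩ := h.exists_sub
  set Fam : Set (En n → ℝ) := {u | UpperSemicontinuous u ∧ SubJ F H s f u} with hFam
  have hFm : ∀ u ∈ Fam, UpperSemicontinuous u ∧ SubJ F H s f u := fun u hu => hu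
  have hu0F : u0 ∈ Fam := ⟨hu0c.upperSemicontinuous, hu0⟩
  set V : En n → ℝ := fun x => sSup ((fun u : En n → ℝ => u x) '' Fam) with hV
  have hne : ∀ x : En n, ((fun u : En n → ℝ => u x) '' Fam).Nonempty := fun x => ⟨_, u0, hu0F, rfl⟩
  have hloc : ∀ x : En n, ∃ M, ∀ u ∈ Fam, ∀ y, ‖y‖ ≤ ‖x‖ + 1 → u y ≤ M := by
    intro x
    obtain ⟨M, hM⟩ := h.local_bound (‖x‖ + 1)
    exact ⟨M, fun u hu y hy => hM u hu.1 hu.2 y hy⟩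
  have hbdd : ∀ x : En n, BddAbove ((fun u : En n → ℝ => u x) '' Fam) := by
    intro x
    obtain ⟨M, hM⟩ := hloc x
    refine ⟨M, ?_⟩
    rintro _ ⟨u, hu, rfl⟩
    exact hM u hu x (by linarith)
  have huV : ∀ u ∈ Fam, ∀ x, u x ≤ V x := fun u hu x => le_csSup (hbdd x) ⟨u, hu, rfl⟩
  have hVloc : ∀ x, ∃ c, ∀ᶠ y in 𝓝 x, V y ≤ c := by
    intro x
    obtain ⟨M, hM⟩ := hloc x
    refine ⟨M, ?_⟩
    have e : ∀ᶠ y : En n in 𝓝 x, ‖y‖ < ‖x‖ + 1 :=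
      (continuous_norm.tendsto x).eventually (Iio_mem_nhds (by linarith))
    filter_upwards [e] with y hy
    refine csSup_le (hne y) ?_
    rintro _ ⟨u, hu, rfl⟩
    exact hM u hu y hy.le
  set U := uenv V with hU
  have hVU : ∀ x, V x ≤ U x := fun x => le_uenv (hVloc x)
  have hUusc : UpperSemicontinuous U := uenv_usc hVloc
  have hUsub : SubJ F H s f U := by
    refine h.stab_sub hFm (fun u hu x => (huV u hu x).trans (hVU x)) fun x c hc => ?_
    refine (uenv_frequently hc).mono fun y hy => ?_
    obtain ⟨_, ⟨u, hu, rfl⟩, hlt⟩ := exists_lt_of_lt_csSup (hne y) hy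
    exact ⟨u, hu, hlt⟩
  have hmax : ∀ u, UpperSemicontinuous u → SubJ F H s f u → ∀ x, u x ≤ U x := fun u h1 h2 x =>
    (huV u ⟨h1, h2⟩ x).trans (hVU x)
  have hloc2 : ∀ x, ∃ c, ∀ᶠ y in 𝓝 x, -U y ≤ c := by
    intro x
    refine ⟨-u0 x + 1, ?_⟩
    have e : ∀ᶠ y in 𝓝 x, u0 x - 1 < u0 y := (hu0c.tendsto x).eventually (Ioi_mem_nhds (by linarith))
    filter_upwards [e] with y hy
    have := hmax u0 hu0c.upperSemicontinuous hu0 y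
    linarith
  set w := uenv (fun y => -U y) with hw
  have hw1 : ∀ x, -U x ≤ w x := fun x => le_uenv (g := fun y => -U y) (hloc2 x)
  have hwusc : UpperSemicontinuous w := uenv_usc hloc2
  have hwsub := h.bump hUusc hUsub hmax hw1 (fun x c hc => uenv_frequently hc)
  have hcmp := h.comparison hUusc hwusc hUsub hwsub
  have hweq : w = -U := by
    funext x
    have h1 := hcmp x
    have h2 := hw1 x
    simp only [Pi.neg_apply]
    linarith
  rw [hweq] at hwsub hwusc
  refine ⟨U, ?_, hUsub, hwsub⟩
  rw [continuous_iff_continuousAt]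
  intro x
  rw [ContinuousAt, tendsto_order]
  refine ⟨fun a ha => ?_, fun a ha => hUusc x a ha⟩
  have := hwusc x (-a) (by simp only [Pi.neg_apply]; linarith)
  filter_upwards [this] with y hy
  simp only [Pi.neg_apply] at hy
  linarith

theorem wellposed (h : Hyps n lam Lam m s ρ γ₁ γm cbar A σ₀ ω F H f) :
    ∃! u : En n → ℝ, Continuous u ∧
      ViscositySubsolution F H s f u ∧ ViscositySupersolution F H s f u := by
  obtain ⟨U, hc, h1, h2⟩ := h.existence
  refine ⟨U, ⟨hc, visc_of_subJ h1, super_iff_sub.2 (visc_of_subJ h2)⟩, ?_⟩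
  rintro v ⟨hvc, hv1, hv2⟩
  have s1 : SubJ F H s f v := subJ_of_visc h.ell hv1
  have s2 : SubJ (dualF F) (dualH H) s (-f) (-v) := subJ_of_visc h.ell.dual (super_iff_sub.1 hv2)
  funext x
  have c1 := h.comparison hvc.upperSemicontinuous hc.neg.upperSemicontinuous s1 h2 x
  have c2 := h.comparison hc.upperSemicontinuous hvc.neg.upperSemicontinuous h1 s2 x
  simp only [Pi.neg_apply] at c1 c2
  linarith

end Hyps

theorem fgrow_of {n : ℕ} {ρ : ℝ} {f : En n → ℝ} (hf : Continuous f) (hρ : 0 ≤ ρ)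
    (hl : ∃ C M : ℝ, ∀ x : En n, M ≤ ‖x‖ → max (f x) 0 ≤ C * ‖x‖ ^ ρ) :
    ∃ G : ℝ, 0 ≤ G ∧ ∀ x, f x ≤ G * (1 + ‖x‖ ^ 2) ^ (ρ / 2) := by
  obtain ⟨C, M, hCM⟩ := hl
  obtain ⟨B, hB⟩ := (isCompact_closedBall (0 : En n) |M|).exists_bound_of_continuousOn hf.continuousOn
  refine ⟨|C| + |B|, by positivity, fun x => ?_⟩
  have hT : 1 ≤ 1 + ‖x‖ ^ 2 := by have := sq_nonneg ‖x‖; linarith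
  have h1 : 1 ≤ (1 + ‖x‖ ^ 2) ^ (ρ / 2) := one_le_rpow hT (by positivity)
  rcases le_total ‖x‖ |M| with hx | hx
  · have := hB x (by simpa using hx)
    have h2 : f x ≤ |B| := (le_abs_self _).trans (this.trans (le_abs_self _))
    have h3 : |B| * 1 ≤ |B| * (1 + ‖x‖ ^ 2) ^ (ρ / 2) := by gcongr
    have h4 : 0 ≤ |C| * (1 + ‖x‖ ^ 2) ^ (ρ / 2) := by positivity
    linarith
  · have h2 := (le_max_left _ _).trans (hCM x ((le_abs_self M).trans hx))
    have h3 : ‖x‖ ^ ρ ≤ (1 + ‖x‖ ^ 2) ^ (ρ / 2) := by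
      have e : ‖x‖ ^ ρ = (‖x‖ ^ 2) ^ (ρ / 2) := by
        rw [← rpow_natCast, ← rpow_mul (norm_nonneg _)]
        congr 1
        push_cast
        ring
      rw [e]
      exact rpow_le_rpow (by positivity) (by linarith) (by positivity)
    have h4 : C * ‖x‖ ^ ρ ≤ |C| * ‖x‖ ^ ρ :=
      mul_le_mul_of_nonneg_right (le_abs_self C) (by positivity)
    have h5 : |C| * ‖x‖ ^ ρ ≤ |C| * (1 + ‖x‖ ^ 2) ^ (ρ / 2) := by gcongr
    have h6 : 0 ≤ |B| * (1 + ‖x‖ ^ 2) ^ (ρ / 2) := by positivity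
    linarith

theorem rho_bound {m s ρ : ℝ} (hm1 : 1 < m) (hsm : m < s)
    (hρ1 : m ≤ 2 * s / (s + 1) → ρ < m * (s - 1) / ((m - 1) * s))
    (hρ2 : 2 * s / (s + 1) < m → ρ < 2 * (s - m) / (s * (m - 1))) : ρ < m / (m - 1) := by
  have hm : 0 < m - 1 := by linarith
  have hs : 0 < s := by linarith
  rcases le_or_gt m (2 * s / (s + 1)) with hc | hc
  · refine (hρ1 hc).trans_le ?_
    rw [div_le_div_iff₀ (by positivity) hm]
    have : 0 ≤ m * (m - 1) := by positivity
    nlinarith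
  · refine (hρ2 hc).trans_le ?_
    rw [div_lt_iff₀ (by linarith)] at hc
    rw [div_le_div_iff₀ (by positivity) hm]
    have : 0 ≤ (m - 1) * (m * s - 2 * (s - m)) := mul_nonneg hm.le (by nlinarith)
    nlinarith

end PerronB

theorem wellposedness_concave_case
    (n : ℕ) (hn : 1 ≤ n) (lam Lam m s ρ γ₁ γm cbar A σ₀ : ℝ) (ω : ℝ → ℝ)
    (F : En n → Matrix (Fin n) (Fin n) ℝ → ℝ)
    (H : En n → En n → ℝ) (f : En n → ℝ)
    (hlam : 0 < lam) (hlamLam : lam ≤ Lam)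
    (hm1 : 1 < m) (hm2 : m ≤ 2) (hsm : m < s)
    -- (i) uniform ellipticity
    (hFell : ∀ (x : En n) (X Y : Matrix (Fin n) (Fin n) ℝ), X.IsSymm → Y.IsSymm →
      Y.PosSemidef →
      lam * Y.trace ≤ F x (X + Y) - F x X ∧ F x (X + Y) - F x X ≤ Lam * Y.trace)
    -- (ii)
    (hF0 : ∀ x, F x 0 = 0)
    -- (iii)
    (hFcont : ∀ X : Matrix (Fin n) (Fin n) ℝ, X.IsSymm → Continuous fun x => F x X)
    -- (iv) structure condition
    (hFstruct : ∀ R > (0 : ℝ), ∃ ωR : ℝ → ℝ, IsModulus ωR ∧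
      ∀ ε > (0 : ℝ), ∀ (x y : En n) (X Y : Matrix (Fin n) (Fin n) ℝ),
        ‖x‖ < R → ‖y‖ < R → X.IsSymm → Y.IsSymm →
        (Matrix.fromBlocks X 0 0 (-Y) +
          (3 / ε) • (1 : Matrix (Fin n ⊕ Fin n) (Fin n ⊕ Fin n) ℝ)).PosSemidef →
        ((3 / ε) • Matrix.fromBlocks (1 : Matrix (Fin n) (Fin n) ℝ) (-1) (-1) 1 -
          Matrix.fromBlocks X 0 0 (-Y)).PosSemidef →
        F x X - F y Y ≤ ωR (‖x - y‖ + ε⁻¹ * ‖x - y‖ ^ 2))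
    -- (v) positive homogeneity
    (hFhom : ∀ σ ∈ Set.Ioo (0 : ℝ) 1, ∀ (x : En n) (X : Matrix (Fin n) (Fin n) ℝ),
      F x (σ • X) = σ * F x X)
    (hH0 : ∀ x, H x 0 = 0)
    (hγ₁ : 0 < γ₁) (hγm : 0 < γm) (hω : IsModulus ω)
    -- (a) structure condition on H
    (hHstruct : ∀ x y p q : En n,
      |H x (p + q) - H y p| ≤ ω ‖x - y‖ * (‖p‖ ^ m + 1) +
        (γ₁ + γm * (‖p‖ ^ (m - 1) + ‖q‖ ^ (m - 1))) * ‖q‖)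
    -- (b) convexity-type condition on H
    (hcbar : 0 < cbar) (hA : 0 < A) (hσ₀ : σ₀ ∈ Set.Ioo (0 : ℝ) 1)
    (hHconv : ∀ (x p : En n), ∀ σ ∈ Set.Ioo σ₀ 1,
      -H x p + σ * H x (σ⁻¹ • p) ≤ (1 - σ) * (-cbar * ‖p‖ ^ m + A))
    (hf : Continuous f) (hρ : 0 ≤ ρ)
    (hρ1 : m ≤ 2 * s / (s + 1) → ρ < m * (s - 1) / ((m - 1) * s))
    (hρ2 : 2 * s / (s + 1) < m → ρ < 2 * (s - m) / (s * (m - 1)))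
    (hflimsup : ∃ C M : ℝ, ∀ x : En n, M ≤ ‖x‖ → max (f x) 0 ≤ C * ‖x‖ ^ ρ) :
    ∃! u : En n → ℝ, Continuous u ∧
      ViscositySubsolution F H s f u ∧ ViscositySupersolution F H s f u := by
  exact Hyps.wellposed (lam := lam) (Lam := Lam) (m := m) (ρ := ρ) (γ₁ := γ₁) (γm := γm) (cbar := cbar)
    (A := A) (σ₀ := σ₀) (ω := ω)
    ⟨⟨hlam, hlamLam, hFell⟩, hm1, hm2, hsm, hF0, hFcont, hFstruct, hFhom, hH0, hγ₁, hγm, hω, hHstruct,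
      hcbar, hA, hσ₀, hHconv, hf, hρ, rho_bound hm1 hsm hρ1 hρ2, fgrow_of hf hρ hflimsup⟩
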